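/- Let n ≥ 1, let B be an invertible real n×n matrix, let L = B(ℤⁿ) be the lattice of periods, L' = {ξ ∈ ℝⁿ : ξ·e ∈ ℤ for all e ∈ L} the dual lattice, and F = B([0,1)ⁿ) a fundamental domain with volume |F| = |det B|. Let φ : ℝ → ℝⁿ be continuous and let u be a bounded measurable function on Π = (0, ∞) × ℝⁿ satisfying: (i) u is an entropy solution of u_t + div_x φ(u) = 0 on Π, i.e., for every k ∈ ℝ and every nonnegative C¹ function f with compact support in Π, ∫_Π ( |u − k| ∂_t f + sgn(u − k) (φ(u) − φ(k))·∇_x f ) dt dx ≥ 0; (ii) u is space-periodic: for every e ∈ L, u(t, x + e) = u(t, x) for almost every (t, x) ∈ Π; (iii) the map t ↦ u(t, ·) is continuous from (0, ∞) into L¹(F), i.e., for every t > 0, ∫_F |u(s, x) − u(t, x)| dx → 0 as s → t; (iv) there is I ∈ ℝ such that (1/|det B|) ∫_F u(t, x) dx = I for every t > 0; (v) non-degeneracy: for every ξ ∈ L' with ξ ≠ 0 and every ε > 0, there are no constants α, β ∈ ℝ with ξ·φ(λ) = αλ + β for all λ ∈ (I − ε, I + ε). Then ∫_F |u(t, x)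 − I| dx → 0 as t → +∞. -/

import Mathlib

open MeasureTheory Filter

/-- A bounded measurable `u` on `Π = (0,∞) × ℝⁿ` is an entropy solution of
`u_t + div_x φ(u) = 0` if for every `k ∈ ℝ` and every nonnegative `C¹` function `f`
compactly supported in `Π`,
`∫_Π (|u−k| ∂_t f + sgn(u−k) (φ(u)−φ(k))·∇_x f) ≥ 0`.
Here `∂_t f (z) = Df(z)(1,0)` and `(φ(u)−φ(k))·∇_x f (z) = Df(z)(0, φ(u(z))−φ(k))`. -/
def IsEntropySolution (n : ℕ) (φ : ℝ → Fin n → ℝ) (u : ℝ × (Fin n → ℝ) → ℝ) : Prop :=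
  ∀ k : ℝ, ∀ f : ℝ × (Fin n → ℝ) → ℝ, ContDiff ℝ 1 f → HasCompactSupport f →
    tsupport f ⊆ Set.Ioi (0 : ℝ) ×ˢ Set.univ → (∀ z, 0 ≤ f z) →
    0 ≤ ∫ z in Set.Ioi (0 : ℝ) ×ˢ (Set.univ : Set (Fin n → ℝ)),
        (|u z - k| * fderiv ℝ f z (1, 0) +
          Real.sign (u z - k) * fderiv ℝ f z (0, fun i => φ (u z) i - φ k i))

section PartA
open MeasureTheory Filter Topology Set

set_option linter.unusedSectionVars false
namespace Decay

section generic
variable {T : Type} [AddCommGroup T] [TopologicalSpace T] [IsTopologicalAddGroup T]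
  [CompactSpace T] [SecondCountableTopology T] [MeasurableSpace T] [BorelSpace T]

/-- Basic assumptions on the trajectory `U`. -/
structure Sys (μ : Measure T) (U : ℝ → T → ℝ) (M : ℝ) : Prop where
  meas : Measurable (fun p : ℝ × T => U p.1 p.2)
  bdd : ∀ t x, |U t x| ≤ M
  cont : ∀ t, 0 < t → Tendsto (fun s => ∫ x, |U s x - U t x| ∂μ) (𝓝 t) (𝓝 0)

/-- The doubled functional. -/
noncomputable def W (μ : Measure T) (U : ℝ → T → ℝ) (h : ℝ × ℝ × T → ℝ) (t s : ℝ) : ℝ :=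
  ∫ p : T × T, h (U t p.1, U s p.2, p.1 - p.2) ∂(μ.prod μ)

lemma unif_bound (h : ℝ × ℝ × T → ℝ) (hh : Continuous h) (M : ℝ) :
    ∃ S : ℝ, 0 ≤ S ∧ ∀ a b z, |a| ≤ M → |b| ≤ M → |h (a, b, z)| ≤ S := by
  have hK : IsCompact (Icc (-M) M ×ˢ (Icc (-M) M ×ˢ (univ : Set T))) :=
    isCompact_Icc.prod (isCompact_Icc.prod isCompact_univ)
  obtain ⟨C, hC⟩ := hK.exists_bound_of_continuousOn hh.continuousOn
  refine ⟨max C 0, le_max_right _ _, fun a b z ha hb => ?_⟩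
  exact (hC (a, b, z) ⟨abs_le.1 ha, abs_le.1 hb, mem_univ _⟩).trans (le_max_left _ _)

lemma unif_cont (h : ℝ × ℝ × T → ℝ) (hh : Continuous h) (M ε : ℝ) (hε : 0 < ε) :
    ∃ C : ℝ, 0 ≤ C ∧ ∀ a a' b b' z, |a| ≤ M → |a'| ≤ M → |b| ≤ M → |b'| ≤ M →
      |h (a, b, z) - h (a', b', z)| ≤ ε + C * (|a - a'| + |b - b'|) := by
  obtain ⟨S, hS0, hS⟩ := unif_bound h hh M
  let K : Set (ℝ × ℝ × ℝ × ℝ × T) :=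
    Icc (-M) M ×ˢ (Icc (-M) M ×ˢ (Icc (-M) M ×ˢ (Icc (-M) M ×ˢ (univ : Set T))))
  have hK : IsCompact K :=
    isCompact_Icc.prod (isCompact_Icc.prod (isCompact_Icc.prod (isCompact_Icc.prod isCompact_univ)))
  let Ψ : ℝ × ℝ × ℝ × ℝ × T → ℝ := fun q =>
    |h (q.1, q.2.2.1, q.2.2.2.2) - h (q.2.1, q.2.2.2.1, q.2.2.2.2)|
  have hΨ : Continuous Ψ := by fun_prop
  let d : ℝ × ℝ × ℝ × ℝ × T → ℝ := fun q => |q.1 - q.2.1| + |q.2.2.1 - q.2.2.2.1|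
  have hd : Continuous d := by fun_prop
  have hK' : IsCompact (K ∩ {q | ε ≤ Ψ q}) := hK.inter_right (isClosed_le continuous_const hΨ)
  rcases (K ∩ {q | ε ≤ Ψ q}).eq_empty_or_nonempty with he | hne
  · refine ⟨0, le_rfl, fun a a' b b' z ha ha' hb hb' => ?_⟩
    by_contra hcon
    have : (a, a', b, b', z) ∈ K ∩ {q | ε ≤ Ψ q} := by
      refine ⟨⟨abs_le.1 ha, abs_le.1 ha', abs_le.1 hb, abs_le.1 hb', mem_univ _⟩, ?_⟩
      simp only [zero_mul, add_zero, not_le] at hcon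
      exact hcon.le
    rw [he] at this
    exact this
  · obtain ⟨q0, hq0, hmin⟩ := hK'.exists_isMinOn hne hd.continuousOn
    have hd0 : 0 < d q0 := by
      by_contra hcon
      have h0 : d q0 = 0 := le_antisymm (not_lt.1 hcon) (by positivity)
      have h1 : |q0.1 - q0.2.1| = 0 := by
        have := abs_nonneg (q0.1 - q0.2.1); have := abs_nonneg (q0.2.2.1 - q0.2.2.2.1)
        simp only [d] at h0; linarith
      have h2 : |q0.2.2.1 - q0.2.2.2.1| = 0 := by
        have := abs_nonneg (q0.1 - q0.2.1); have := abs_nonneg (q0.2.2.1 - q0.2.2.2.1)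
        simp only [d] at h0; linarith
      have h1' := sub_eq_zero.1 (abs_eq_zero.1 h1)
      have h2' := sub_eq_zero.1 (abs_eq_zero.1 h2)
      have : ε ≤ Ψ q0 := hq0.2
      simp only [Ψ, h1', h2', sub_self, abs_zero] at this
      linarith
    refine ⟨2 * S / d q0, by positivity, fun a a' b b' z ha ha' hb hb' => ?_⟩
    by_cases hc : ε ≤ |h (a, b, z) - h (a', b', z)|
    · have hm : (a, a', b, b', z) ∈ K ∩ {q | ε ≤ Ψ q} :=
        ⟨⟨abs_le.1 ha, abs_le.1 ha', abs_le.1 hb, abs_le.1 hb', mem_univ _⟩, hc⟩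
      have h3 : d q0 ≤ |a - a'| + |b - b'| := hmin hm
      have h4 : |h (a, b, z) - h (a', b', z)| ≤ 2 * S := by
        have := hS a b z ha hb
        have := hS a' b' z ha' hb'
        have := abs_sub (h (a, b, z)) (h (a', b', z))
        linarith
      have h5 : 2 * S ≤ 2 * S / d q0 * (|a - a'| + |b - b'|) := by
        rw [div_mul_eq_mul_div, le_div_iff₀ hd0]
        gcongr
      linarith
    · push Not at hc
      have : 0 ≤ 2 * S / d q0 * (|a - a'| + |b - b'|) := by positivity
      linarith

variable {μ : Measure T} [IsProbabilityMeasure μ] {U : ℝ → T → ℝ} {M : ℝ}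

lemma Sys.meas_t (hU : Sys μ U M) (t : ℝ) : Measurable (U t) :=
  hU.meas.comp (measurable_const.prodMk measurable_id)

lemma Sys.meas_h (hU : Sys μ U M) (h : ℝ × ℝ × T → ℝ) (hh : Continuous h) :
    Measurable (fun q : ℝ × ℝ × T × T => h (U q.1 q.2.2.1, U q.2.1 q.2.2.2, q.2.2.1 - q.2.2.2)) := by
  apply hh.measurable.comp
  refine Measurable.prodMk ?_ (Measurable.prodMk ?_ ?_)
  · exact hU.meas.comp (by fun_prop : Measurable (fun q : ℝ × ℝ × T × T => (q.1, q.2.2.1)))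
  · exact hU.meas.comp (by fun_prop : Measurable (fun q : ℝ × ℝ × T × T => (q.2.1, q.2.2.2)))
  · fun_prop

lemma Sys.integrable_h (hU : Sys μ U M) (h : ℝ × ℝ × T → ℝ) (hh : Continuous h) (t s : ℝ) :
    Integrable (fun p : T × T => h (U t p.1, U s p.2, p.1 - p.2)) (μ.prod μ) := by
  obtain ⟨S, -, hS⟩ := unif_bound h hh M
  refine Integrable.of_bound (C := S) ?_ (ae_of_all _ fun p => hS _ _ _ (hU.bdd _ _) (hU.bdd _ _))
  exact ((hU.meas_h h hh).comp (measurable_const.prodMk (measurable_const.prodMk measurable_id)) :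
    Measurable (fun p : T × T => h (U t p.1, U s p.2, p.1 - p.2))).aestronglyMeasurable

lemma Sys.integrable_abs (hU : Sys μ U M) (t s : ℝ) :
    Integrable (fun x => |U t x - U s x|) μ := by
  refine Integrable.of_bound (C := 2 * M) ((hU.meas_t t).sub (hU.meas_t s)).abs.aestronglyMeasurable
    (ae_of_all _ fun x => ?_)
  have := abs_sub (U t x) (U s x); have := hU.bdd t x; have := hU.bdd s x
  rw [Real.norm_eq_abs, abs_abs]; linarith

lemma W_contOn (hU : Sys μ U M) (h : ℝ × ℝ × T → ℝ) (hh : Continuous h) :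
    ContinuousOn (fun q : ℝ × ℝ => W μ U h q.1 q.2) (Ioi 0 ×ˢ Ioi 0) := by
  rintro ⟨t0, s0⟩ ⟨ht0, hs0⟩
  apply ContinuousAt.continuousWithinAt
  rw [Metric.continuousAt_iff']
  intro ε hε
  obtain ⟨C, hC0, hC⟩ := unif_cont h hh M (ε / 2) (by positivity)
  have h1 : Tendsto (fun q : ℝ × ℝ => ∫ x, |U q.1 x - U t0 x| ∂μ) (𝓝 (t0, s0)) (𝓝 0) :=
    (hU.cont t0 ht0).comp continuousAt_fst
  have h2 : Tendsto (fun q : ℝ × ℝ => ∫ x, |U q.2 x - U s0 x| ∂μ) (𝓝 (t0, s0)) (𝓝 0) :=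
    (hU.cont s0 hs0).comp continuousAt_snd
  have h3 : Tendsto (fun q : ℝ × ℝ => ε / 2 + C * ((∫ x, |U q.1 x - U t0 x| ∂μ) +
      ∫ x, |U q.2 x - U s0 x| ∂μ)) (𝓝 (t0, s0)) (𝓝 (ε / 2)) := by
    have := ((h1.add h2).const_mul C).const_add (ε / 2)
    simpa using this
  filter_upwards [h3.eventually (gt_mem_nhds (half_lt_self hε))] with q hq
  refine lt_of_le_of_lt ?_ hq
  rw [Real.dist_eq, W, W, ← integral_sub (hU.integrable_h h hh _ _) (hU.integrable_h h hh _ _)]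
  have i1 : Integrable (fun p : T × T => |U q.1 p.1 - U t0 p.1|) (μ.prod μ) :=
    (hU.integrable_abs q.1 t0).comp_fst μ
  have i2 : Integrable (fun p : T × T => |U q.2 p.2 - U s0 p.2|) (μ.prod μ) :=
    (hU.integrable_abs q.2 s0).comp_snd μ
  calc _ ≤ ∫ p : T × T, |h (U q.1 p.1, U q.2 p.2, p.1 - p.2) - h (U t0 p.1, U s0 p.2, p.1 - p.2)|
        ∂(μ.prod μ) := abs_integral_le_integral_abs
    _ ≤ ∫ p : T × T, (ε / 2 + C * (|U q.1 p.1 - U t0 p.1| + |U q.2 p.2 - U s0 p.2|)) ∂(μ.prod μ) := by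
        refine integral_mono ((hU.integrable_h h hh _ _).sub (hU.integrable_h h hh _ _)).abs ?_ ?_
        · exact (integrable_const _).add ((i1.add i2).const_mul C)
        · intro p
          exact hC _ _ _ _ _ (hU.bdd _ _) (hU.bdd _ _) (hU.bdd _ _) (hU.bdd _ _)
    _ = _ := by
        have i3 : Integrable (fun p : T × T => C * (|U q.1 p.1 - U t0 p.1| + |U q.2 p.2 - U s0 p.2|))
          (μ.prod μ) := (i1.add i2).const_mul C
        rw [integral_add (integrable_const _) i3, integral_const_mul,
          integral_add i1 i2]
        have e1 : ∫ p : T × T, |U q.1 p.1 - U t0 p.1| ∂(μ.prod μ) = ∫ x, |U q.1 x - U t0 x| ∂μ := by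
          rw [integral_fun_fst (fun x => |U q.1 x - U t0 x|)]; simp
        have e2 : ∫ p : T × T, |U q.2 p.2 - U s0 p.2| ∂(μ.prod μ) = ∫ x, |U q.2 x - U s0 x| ∂μ := by
          rw [integral_fun_snd (fun x => |U q.2 x - U s0 x|)]; simp
        rw [e1, e2]; simp

end generic
end Decay
end PartA

section PartB
open MeasureTheory Filter Topology Set
set_option linter.unusedSectionVars false
namespace Decay

lemma dini {H : ℝ → ℝ} {a b : ℝ} (hab : a ≤ b) (hc : ContinuousOn H (Icc a b))
    (hd : ∀ x ∈ Ico a b, ∀ r, 0 < r → ∀ᶠ z in 𝓝[>] x, H z - H x ≤ r * (z - x)) : H b ≤ H a := by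
  have key : ∀ r, 0 < r → H b ≤ H a + r * (b - a) := by
    intro r hr
    refine image_le_of_liminf_slope_right_lt_deriv_boundary' (f := H) (f' := fun _ => 0)
      (B := fun x => H a + r * (x - a)) (B' := fun _ => r) hc ?_ (by simp) (by fun_prop) ?_ ?_
      (right_mem_Icc.2 hab)
    · intro x hx q hq
      apply Eventually.frequently
      filter_upwards [hd x hx (q / 2) (by linarith), self_mem_nhdsWithin] with z hz hz'
      have : 0 < z - x := sub_pos.2 hz'
      rw [slope_def_field, div_lt_iff₀ this]
      nlinarith
    · intro x _
      have h := (((hasDerivAt_id x).sub_const a).const_mul r).const_add (H a)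
      simpa using h.hasDerivWithinAt
    · intro x _ _; exact hr
  refine le_of_forall_pos_le_add fun ε hε => ?_
  have h := key (ε / (b - a + 1)) (div_pos hε (by linarith))
  have : ε / (b - a + 1) * (b - a) ≤ ε := by
    rw [div_mul_eq_mul_div, div_le_iff₀ (by linarith)]; nlinarith
  linarith

lemma chain {D Q1 Q2 : ℝ × ℝ → ℝ} {m1 m2 : ℝ → ℝ}
    (hD : ContinuousOn D (Ioi 0 ×ˢ Ioi 0)) (hQ1 : ContinuousOn Q1 (Ioi 0 ×ˢ Ioi 0))
    (hQ2 : ContinuousOn Q2 (Ioi 0 ×ˢ Ioi 0)) (hm1 : ContinuousOn m1 (Ioi 0))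
    (hm2 : ContinuousOn m2 (Ioi 0))
    (h1 : ∀ t1 t2 s, 0 < t1 → t1 ≤ t2 → 0 < s →
      D (t2, s) - D (t1, s) ≤ (∫ t in t1..t2, Q1 (t, s)) + (m1 t1 - m1 t2))
    (h2 : ∀ t s1 s2, 0 < s1 → s1 ≤ s2 → 0 < t →
      D (t, s2) - D (t, s1) ≤ (∫ s in s1..s2, Q2 (t, s)) + (m2 s1 - m2 s2))
    {a b : ℝ} (ha : 0 < a) (hab : a ≤ b) :
    D (b, b) - D (a, a) ≤ (∫ t in a..b, (Q1 (t, t) + Q2 (t, t))) +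
      (m1 a - m1 b) + (m2 a - m2 b) := by
  have diag : ∀ F : ℝ × ℝ → ℝ, ContinuousOn F (Ioi 0 ×ˢ Ioi 0) →
      ContinuousOn (fun t => F (t, t)) (Ioi 0) := fun F hF =>
    hF.comp (by fun_prop) (fun t ht => ⟨ht, ht⟩)
  have hQd : ContinuousOn (fun t => Q1 (t, t) + Q2 (t, t)) (Ioi 0) :=
    (diag _ hQ1).add (diag _ hQ2)
  have hsub : ∀ x y : ℝ, 0 < x → 0 < y → uIcc x y ⊆ Ioi 0 := fun x y hx hy z hz =>
    lt_of_lt_of_le (lt_min hx hy) hz.1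
  have h_intble : ∀ x y : ℝ, 0 < x → 0 < y →
      IntervalIntegrable (fun t => Q1 (t, t) + Q2 (t, t)) volume x y := fun x y hx hy =>
    (hQd.mono (hsub x y hx hy)).intervalIntegrable
  set H : ℝ → ℝ := fun t => D (t, t) - (∫ τ in a..t, (Q1 (τ, τ) + Q2 (τ, τ))) + m1 t + m2 t with hH
  have hIcc : Icc a b ⊆ Ioi 0 := fun x hx => lt_of_lt_of_le ha hx.1
  have main : H b ≤ H a := by
    apply dini hab
    · refine ((((diag _ hD).mono hIcc).sub ?_).add (hm1.mono hIcc)).add (hm2.mono hIcc)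
      have := intervalIntegral.continuousOn_primitive_interval'
        (h_intble a b ha (ha.trans_le hab)) (left_mem_uIcc)
      rwa [uIcc_of_le hab] at this
    · intro x hx r hr
      have hx0 : 0 < x := lt_of_lt_of_le ha hx.1
      have hop : (Ioi (0:ℝ) ×ˢ Ioi (0:ℝ)) ∈ 𝓝 (x, x) := prod_mem_nhds (Ioi_mem_nhds hx0) (Ioi_mem_nhds hx0)
      have c1 := hQ1.continuousAt hop
      have c2 := hQ2.continuousAt hop
      rw [Metric.continuousAt_iff] at c1 c2
      obtain ⟨d1, hd1, c1⟩ := c1 (r / 4) (by positivity)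
      obtain ⟨d2, hd2, c2⟩ := c2 (r / 4) (by positivity)
      have hev : ∀ᶠ z in 𝓝[>] x, z < x + min d1 d2 :=
        nhdsWithin_le_nhds (gt_mem_nhds (by linarith [lt_min hd1 hd2]))
      filter_upwards [hev, self_mem_nhdsWithin] with z hz hz'
      have hxz : x < z := hz'
      have hz0 : 0 < z := hx0.trans hxz
      have e1 := h1 x z z hx0 hxz.le hz0
      have e2 := h2 x x z hx0 hxz.le hx0
      have e3 : (∫ τ in a..z, (Q1 (τ, τ) + Q2 (τ, τ))) - (∫ τ in a..x, (Q1 (τ, τ) + Q2 (τ, τ)))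
          = ∫ τ in x..z, (Q1 (τ, τ) + Q2 (τ, τ)) :=
        intervalIntegral.integral_interval_sub_left (h_intble a z ha hz0) (h_intble a x ha hx0)
      have i1 : IntervalIntegrable (fun t => Q1 (t, z)) volume x z :=
        (hQ1.comp (f := fun t => (t, z)) (by fun_prop)
          (fun t ht => ⟨hsub x z hx0 hz0 ht, hz0⟩)).intervalIntegrable
      have i2 : IntervalIntegrable (fun s => Q2 (x, s)) volume x z :=
        (hQ2.comp (f := fun s => (x, s)) (by fun_prop)
          (fun t ht => ⟨hx0, hsub x z hx0 hz0 ht⟩)).intervalIntegrable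
      have e4 : (∫ t in x..z, Q1 (t, z)) + (∫ s in x..z, Q2 (x, s))
          ≤ ∫ τ in x..z, ((Q1 (τ, τ) + Q2 (τ, τ)) + r) := by
        rw [← intervalIntegral.integral_add i1 i2]
        refine intervalIntegral.integral_mono_on hxz.le (i1.add i2)
          ((h_intble x z hx0 hz0).add intervalIntegrable_const) ?_
        intro τ hτ
        have near : ∀ p q : ℝ, p ∈ Icc x z → q ∈ Icc x z → dist (p, q) (x, x) < min d1 d2 := by
          intro p q hp hq
          rw [Prod.dist_eq, max_lt_iff, Real.dist_eq, Real.dist_eq]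
          constructor
          · rw [abs_of_nonneg (by linarith [hp.1])]; simp only; linarith [hp.2]
          · rw [abs_of_nonneg (by linarith [hq.1])]; simp only; linarith [hq.2]
        have hzm : z ∈ Icc x z := ⟨hxz.le, le_rfl⟩
        have hxm : x ∈ Icc x z := ⟨le_rfl, hxz.le⟩
        have a1 := c1 ((near τ z hτ hzm).trans_le (min_le_left _ _))
        have a2 := c1 ((near τ τ hτ hτ).trans_le (min_le_left _ _))
        have a3 := c2 ((near x τ hxm hτ).trans_le (min_le_right _ _))
        have a4 := c2 ((near τ τ hτ hτ).trans_le (min_le_right _ _))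
        rw [Real.dist_eq, abs_lt] at a1 a2 a3 a4
        linarith [a1.1, a1.2, a2.1, a2.2, a3.1, a3.2, a4.1, a4.2]
      rw [intervalIntegral.integral_add (h_intble x z hx0 hz0) intervalIntegrable_const,
        intervalIntegral.integral_const, smul_eq_mul] at e4
      simp only [hH]
      linarith
  simp only [hH, intervalIntegral.integral_same] at main
  linarith

section generic
variable {T : Type} [AddCommGroup T] [TopologicalSpace T] [IsTopologicalAddGroup T]
  [CompactSpace T] [SecondCountableTopology T] [MeasurableSpace T] [BorelSpace T]
variable {μ : Measure T} [IsProbabilityMeasure μ] {U : ℝ → T → ℝ} {M : ℝ}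

lemma W_swap (h : ℝ × ℝ × T → ℝ) (t s : ℝ) :
    W μ U (fun q => h (q.2.1, q.1, -q.2.2)) s t = W μ U h t s := by
  unfold W
  rw [← integral_prod_swap]
  simp

lemma W_eq1 (hU : Sys μ U M) (h : ℝ × ℝ × T → ℝ) (hh : Continuous h) (t s : ℝ) :
    W μ U h t s = ∫ y, ∫ x, h (U t x, U s y, x - y) ∂μ ∂μ :=
  integral_prod_symm _ (hU.integrable_h h hh t s)

lemma W_eq2 (hU : Sys μ U M) (h : ℝ × ℝ × T → ℝ) (hh : Continuous h) (t s : ℝ) :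
    W μ U h t s = ∫ x, ∫ y, h (U t x, U s y, x - y) ∂μ ∂μ :=
  integral_prod _ (hU.integrable_h h hh t s)

lemma inner_int (hU : Sys μ U M) (h : ℝ × ℝ × T → ℝ) (hh : Continuous h) (s t1 t2 : ℝ) :
    Integrable (fun p : T × ℝ => ∫ x, h (U p.2 x, U s p.1, x - p.1) ∂μ)
      (μ.prod (volume.restrict (Ioc t1 t2))) := by
  obtain ⟨S, hS0, hS⟩ := unif_bound h hh M
  refine Integrable.of_bound (C := S) ?_ (ae_of_all _ fun p => ?_)
  · have h1 : Measurable (fun q : (T × ℝ) × T => h (U q.1.2 q.2, U s q.1.1, q.2 - q.1.1)) :=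
      (hU.meas_h h hh).comp (by fun_prop :
        Measurable (fun q : (T × ℝ) × T => ((q.1.2, s, q.2, q.1.1) : ℝ × ℝ × T × T)))
    exact (h1.stronglyMeasurable.integral_prod_right' (ν := μ)).aestronglyMeasurable
  · have := norm_integral_le_of_norm_le_const (μ := μ)
      (f := fun x => h (U p.2 x, U s p.1, x - p.1)) (C := S) (ae_of_all _ fun x => hS (U p.2 x) (U s p.1) (x - p.1) (hU.bdd _ _) (hU.bdd _ _))
    simpa using this

lemma inner_int' (hU : Sys μ U M) (h : ℝ × ℝ × T → ℝ) (hh : Continuous h) (s t1 t2 : ℝ)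
    (ht : t1 ≤ t2) :
    Integrable (fun y : T => ∫ t in t1..t2, ∫ x, h (U t x, U s y, x - y) ∂μ) μ := by
  simp only [intervalIntegral.integral_of_le ht]
  exact (inner_int hU h hh s t1 t2).integral_prod_left

lemma W_fubini1 (hU : Sys μ U M) (h : ℝ × ℝ × T → ℝ) (hh : Continuous h) (s t1 t2 : ℝ)
    (ht : t1 ≤ t2) :
    ∫ y, (∫ t in t1..t2, ∫ x, h (U t x, U s y, x - y) ∂μ) ∂μ = ∫ t in t1..t2, W μ U h t s := by
  simp only [intervalIntegral.integral_of_le ht]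
  rw [integral_integral_swap (inner_int hU h hh s t1 t2)]
  congr 1
  ext t
  rw [W_eq1 hU h hh]

lemma W_fubini2 (hU : Sys μ U M) (h : ℝ × ℝ × T → ℝ) (hh : Continuous h) (t s1 s2 : ℝ)
    (ht : s1 ≤ s2) :
    ∫ x, (∫ s in s1..s2, ∫ y, h (U t x, U s y, x - y) ∂μ) ∂μ = ∫ s in s1..s2, W μ U h t s := by
  have := W_fubini1 hU (fun q => h (q.2.1, q.1, -q.2.2)) (by fun_prop) t s1 s2 ht
  simpa [W_swap] using this

lemma inner_int2' (hU : Sys μ U M) (h : ℝ × ℝ × T → ℝ) (hh : Continuous h) (t s1 s2 : ℝ)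
    (ht : s1 ≤ s2) :
    Integrable (fun x : T => ∫ s in s1..s2, ∫ y, h (U t x, U s y, x - y) ∂μ) μ := by
  have := inner_int' hU (fun q => h (q.2.1, q.1, -q.2.2)) (by fun_prop) t s1 s2 ht
  simpa using this

/-- Kruzhkov flux. -/
noncomputable def sf {n : ℕ} (φ : ℝ → Fin n → ℝ) (i : Fin n) (a k : ℝ) : ℝ :=
  Real.sign (a - k) * (φ a i - φ k i)

lemma sf_comm {n : ℕ} (φ : ℝ → Fin n → ℝ) (i : Fin n) (a k : ℝ) : sf φ i a k = sf φ i k a := by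
  unfold sf
  rw [show a - k = -(k - a) by ring, Real.sign_neg]; ring

lemma sf_cont {n : ℕ} {φ : ℝ → Fin n → ℝ} (hφ : Continuous φ) (i : Fin n) :
    Continuous (fun p : ℝ × ℝ => sf φ i p.1 p.2) := by
  have hc : Continuous (fun p : ℝ × ℝ => φ p.1 i - φ p.2 i) := by fun_prop
  rw [continuous_iff_continuousAt]
  rintro ⟨a, k⟩
  rcases lt_trichotomy a k with h | h | h
  · have : (fun p : ℝ × ℝ => sf φ i p.1 p.2) =ᶠ[𝓝 (a, k)] fun p => -(φ p.1 i - φ p.2 i) := by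
      filter_upwards [(isOpen_lt continuous_fst continuous_snd).mem_nhds (show (a,k).1 < (a,k).2 from h)]
        with p hp
      have hp' : p.1 < p.2 := hp
      simp [sf, Real.sign_of_neg (sub_neg.2 hp')]
    exact (hc.neg.continuousAt).congr this.symm
  · subst h
    rw [ContinuousAt, show sf φ i (a, a).1 (a, a).2 = 0 by simp [sf]]
    have h0 : Tendsto (fun p : ℝ × ℝ => φ p.1 i - φ p.2 i) (𝓝 (a, a)) (𝓝 0) := by
      have := hc.tendsto (a, a); simpa using this
    refine squeeze_zero_norm (a := fun p : ℝ × ℝ => |φ p.1 i - φ p.2 i|) (fun p => ?_) (by simpa using h0.abs)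
    rw [sf, norm_mul, Real.norm_eq_abs, Real.norm_eq_abs]
    have : |Real.sign (p.1 - p.2)| ≤ 1 := by
      rcases Real.sign_apply_eq (p.1 - p.2) with h | h | h <;> simp [h]
    exact mul_le_of_le_one_left (abs_nonneg _) this
  · have : (fun p : ℝ × ℝ => sf φ i p.1 p.2) =ᶠ[𝓝 (a, k)] fun p => (φ p.1 i - φ p.2 i) := by
      filter_upwards [(isOpen_lt continuous_snd continuous_fst).mem_nhds (show (a,k).2 < (a,k).1 from h)]
        with p hp
      have hp' : p.2 < p.1 := hp
      simp [sf, Real.sign_of_pos (sub_pos.2 hp')]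
    exact (hc.continuousAt).congr this.symm

/-- entropy inequality tested against `g` with gradient `G`. -/
def EntIneq {n : ℕ} (μ : Measure T) (U : ℝ → T → ℝ) (φ : ℝ → Fin n → ℝ) (g : T → ℝ)
    (G : Fin n → T → ℝ) : Prop :=
  ∀ k t1 t2, 0 < t1 → t1 ≤ t2 →
    (∫ x, |U t2 x - k| * g x ∂μ) - (∫ x, |U t1 x - k| * g x ∂μ) ≤
      ∫ t in t1..t2, ∫ x, ∑ i, G i x * sf φ i (U t x) k ∂μ

/-- `g` (with gradient `G`) may be used as a kernel. -/
def Ker {n : ℕ} (μ : Measure T) (U : ℝ → T → ℝ) (φ : ℝ → Fin n → ℝ) (g : T → ℝ)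
    (G : Fin n → T → ℝ) : Prop :=
  (∀ y, EntIneq μ U φ (fun x => g (x - y)) (fun i x => G i (x - y))) ∧
  (∀ x, EntIneq μ U φ (fun y => g (x - y)) (fun i y => - G i (x - y)))

lemma D_antitone {n : ℕ} (hU : Sys μ U M) {φ : ℝ → Fin n → ℝ} (hφ : Continuous φ) {g : T → ℝ}
    {G : Fin n → T → ℝ} (hg : Continuous g) (hG : ∀ i, Continuous (G i)) (hK : Ker μ U φ g G)
    {a b : ℝ} (ha : 0 < a) (hab : a ≤ b) :
    W μ U (fun q => |q.1 - q.2.1| * g q.2.2) b b ≤ W μ U (fun q => |q.1 - q.2.1| * g q.2.2) a a := by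
  have hDc : Continuous (fun q : ℝ × ℝ × T => |q.1 - q.2.1| * g q.2.2) := by fun_prop
  have hsf := fun i => sf_cont hφ i
  have hQc : Continuous (fun q : ℝ × ℝ × T => ∑ i, G i q.2.2 * sf φ i q.1 q.2.1) := by
    refine continuous_finsetSum _ fun i _ => ?_
    exact ((hG i).comp (by fun_prop)).mul ((hsf i).comp (by fun_prop : Continuous fun q : ℝ × ℝ × T => (q.1, q.2.1)))
  have hQc' : Continuous (fun q : ℝ × ℝ × T => ∑ i, - G i q.2.2 * sf φ i q.2.1 q.1) := by
    refine continuous_finsetSum _ fun i _ => ?_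
    exact ((hG i).comp (by fun_prop)).neg.mul ((hsf i).comp (by fun_prop : Continuous fun q : ℝ × ℝ × T => (q.2.1, q.1)))
  have := chain (D := fun q => W μ U (fun q => |q.1 - q.2.1| * g q.2.2) q.1 q.2)
    (Q1 := fun q => W μ U (fun q => ∑ i, G i q.2.2 * sf φ i q.1 q.2.1) q.1 q.2)
    (Q2 := fun q => W μ U (fun q => ∑ i, - G i q.2.2 * sf φ i q.2.1 q.1) q.1 q.2)
    (m1 := fun _ => 0) (m2 := fun _ => 0)
    (W_contOn hU _ hDc) (W_contOn hU _ hQc) (W_contOn hU _ hQc') continuousOn_const continuousOn_const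
    ?_ ?_ ha hab
  · simp only [sub_zero, add_zero] at this
    have hz : ∀ t, W μ U (fun q => ∑ i, G i q.2.2 * sf φ i q.1 q.2.1) t t +
        W μ U (fun q => ∑ i, - G i q.2.2 * sf φ i q.2.1 q.1) t t = 0 := by
      intro t
      have : (fun q : ℝ × ℝ × T => ∑ i, - G i q.2.2 * sf φ i q.2.1 q.1) =
          fun q => - ∑ i, G i q.2.2 * sf φ i q.1 q.2.1 := by
        ext q
        rw [← Finset.sum_neg_distrib]
        refine Finset.sum_congr rfl fun i _ => ?_
        rw [sf_comm]; ring
      rw [this]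
      unfold W
      rw [integral_neg]; ring
    simp only [hz, intervalIntegral.integral_zero] at this
    linarith
  · intro t1 t2 s h1 h2 hs
    simp only [sub_zero, add_zero]
    rw [← W_fubini1 hU _ hQc s t1 t2 h2, W_eq1 hU _ hDc, W_eq1 hU _ hDc, ← integral_sub
      (hU.integrable_h _ hDc t2 s).integral_prod_right (hU.integrable_h _ hDc t1 s).integral_prod_right]
    refine integral_mono ((hU.integrable_h _ hDc t2 s).integral_prod_right.sub
      (hU.integrable_h _ hDc t1 s).integral_prod_right) (inner_int' hU _ hQc s t1 t2 h2) ?_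
    intro y
    exact hK.1 y (U s y) t1 t2 h1 h2
  · intro t t1 t2 h1 h2 hs
    simp only [sub_zero, add_zero]
    rw [← W_fubini2 hU _ hQc' t t1 t2 h2, W_eq2 hU _ hDc, W_eq2 hU _ hDc, ← integral_sub
      (hU.integrable_h _ hDc t t2).integral_prod_left (hU.integrable_h _ hDc t t1).integral_prod_left]
    refine integral_mono ((hU.integrable_h _ hDc t t2).integral_prod_left.sub
      (hU.integrable_h _ hDc t t1).integral_prod_left) (inner_int2' hU _ hQc' t t1 t2 h2) ?_
    intro x
    have := hK.2 x (U t x) t1 t2 h1 h2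
    simp only [abs_sub_comm (U _ _) (U t x)] at this
    exact this

end generic
end Decay
end PartB

section PartC
open MeasureTheory Filter Topology Set
set_option linter.unusedSectionVars false
set_option linter.unusedVariables false
namespace Decay

/-- centered ramp -/
noncomputable def eta (k1 k2 a : ℝ) : ℝ := (|a - k1| - |a - k2|) / 2
/-- flux of the centered ramp -/
noncomputable def qf {n : ℕ} (φ : ℝ → Fin n → ℝ) (i : Fin n) (k1 k2 a : ℝ) : ℝ :=
  (sf φ i a k1 - sf φ i a k2) / 2

lemma eta_cont (k1 k2 : ℝ) : Continuous (eta k1 k2) := by unfold eta; fun_prop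

lemma eta_le (k1 k2 a : ℝ) : |eta k1 k2 a| ≤ |k1 - k2| / 2 := by
  unfold eta
  rw [abs_div, abs_of_pos (by norm_num : (0:ℝ) < 2)]
  have := abs_abs_sub_abs_le_abs_sub (a - k1) (a - k2)
  rw [show a - k1 - (a - k2) = -(k1 - k2) by ring, abs_neg] at this
  linarith

lemma qf_cont {n : ℕ} {φ : ℝ → Fin n → ℝ} (hφ : Continuous φ) (i : Fin n) (k1 k2 : ℝ) :
    Continuous (qf φ i k1 k2) := by
  unfold qf
  have h := sf_cont hφ i
  exact ((h.comp (by fun_prop : Continuous fun a : ℝ => (a, k1))).sub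
    (h.comp (by fun_prop : Continuous fun a : ℝ => (a, k2)))).div_const _

section generic
variable {T : Type} [AddCommGroup T] [TopologicalSpace T] [IsTopologicalAddGroup T]
  [CompactSpace T] [SecondCountableTopology T] [MeasurableSpace T] [BorelSpace T]
variable {μ : Measure T} [IsProbabilityMeasure μ] {U : ℝ → T → ℝ} {M : ℝ}

lemma unif_bound1 (h : ℝ × T → ℝ) (hh : Continuous h) (M : ℝ) :
    ∃ S : ℝ, 0 ≤ S ∧ ∀ a z, |a| ≤ M → |h (a, z)| ≤ S := by
  obtain ⟨S, h0, h1⟩ := unif_bound (fun q : ℝ × ℝ × T => h (q.1, q.2.2)) (by fun_prop) M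
  exact ⟨S, h0, fun a z ha => h1 a a z ha ha⟩

lemma Sys.integrable1 (hU : Sys μ U M) (h : ℝ × T → ℝ) (hh : Continuous h) (t : ℝ) :
    Integrable (fun x => h (U t x, x)) μ := by
  obtain ⟨S, -, hS⟩ := unif_bound1 h hh M
  refine Integrable.of_bound (C := S) ?_ (ae_of_all _ fun p => hS _ _ (hU.bdd _ _))
  exact (hh.measurable.comp ((hU.meas_t t).prodMk measurable_id)).aestronglyMeasurable

lemma Sys.intervalIntegrable1 (hU : Sys μ U M) (h : ℝ × T → ℝ) (hh : Continuous h) (t1 t2 : ℝ) :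
    IntervalIntegrable (fun t => ∫ x, h (U t x, x) ∂μ) volume t1 t2 := by
  obtain ⟨S, -, hS⟩ := unif_bound1 h hh M
  have hm : Measurable (fun q : ℝ × T => h (U q.1 q.2, q.2)) :=
    hh.measurable.comp (hU.meas.prodMk measurable_snd)
  have hm' := (hm.stronglyMeasurable.integral_prod_right' (ν := μ))
  have hb : ∀ t, ‖∫ x, h (U t x, x) ∂μ‖ ≤ S := fun t => by
    have := norm_integral_le_of_norm_le_const (μ := μ) (f := fun x => h (U t x, x)) (C := S)
      (ae_of_all _ fun x => hS _ _ (hU.bdd _ _))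
    simpa using this
  rw [intervalIntegrable_iff]
  exact Measure.integrableOn_of_bounded (M := S) (by simp) hm'.aestronglyMeasurable (ae_of_all _ hb)

/-- the `L¹` distance to a constant -/
noncomputable def mk (μ : Measure T) (U : ℝ → T → ℝ) (k t : ℝ) : ℝ := ∫ x, |U t x - k| ∂μ

lemma mk_nonneg (k t : ℝ) : 0 ≤ mk μ U k t := integral_nonneg fun _ => abs_nonneg _

lemma mk_le (hU : Sys μ U M) (k t : ℝ) : mk μ U k t ≤ M + |k| := by
  have h1 := hU.integrable1 (fun q => |q.1 - k|) (by fun_prop) t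
  have : mk μ U k t ≤ ∫ _x : T, (M + |k|) ∂μ := by
    refine integral_mono h1 (integrable_const _) fun x => ?_
    have := abs_sub (U t x) k; have := hU.bdd t x
    simp only; linarith
  simpa using this

lemma W_fst (hU : Sys μ U M) (h : ℝ → ℝ) (hh : Continuous h) (t s : ℝ) :
    W μ U (fun q => h q.1) t s = ∫ x, h (U t x) ∂μ := by
  unfold W
  have := integral_fun_fst (μ := μ) (ν := μ) (fun x => h (U t x))
  simpa using this

lemma W_snd (hU : Sys μ U M) (h : ℝ → ℝ) (hh : Continuous h) (t s : ℝ) :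
    W μ U (fun q => h q.2.1) t s = ∫ x, h (U s x) ∂μ := by
  unfold W
  have := integral_fun_snd (μ := μ) (ν := μ) (fun x => h (U s x))
  simpa using this

lemma mk_contOn (hU : Sys μ U M) (k : ℝ) : ContinuousOn (mk μ U k) (Ioi 0) := by
  have h1 := W_contOn hU (fun q => |q.1 - k|) (by fun_prop)
  have h2 : ContinuousOn (fun t : ℝ => ((t, t) : ℝ × ℝ)) (Ioi 0) := by fun_prop
  have h3 := h1.comp h2 (fun t ht => ⟨ht, ht⟩)
  refine h3.congr fun t ht => ?_
  exact (W_fst hU (fun a => |a - k|) (by fun_prop) t t).symm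

lemma mk_anti {n : ℕ} {φ : ℝ → Fin n → ℝ} (h1 : EntIneq μ U φ (fun _ => 1) (fun _ _ => 0)) (k : ℝ)
    {t1 t2 : ℝ} (ht1 : 0 < t1) (ht : t1 ≤ t2) : mk μ U k t2 ≤ mk μ U k t1 := by
  have := h1 k t1 t2 ht1 ht
  simp at this
  exact this

section inc
variable {n : ℕ} {φ : ℝ → Fin n → ℝ}

lemma inc_abs (hU : Sys μ U M) (hφ : Continuous φ) {g : T → ℝ} {G : Fin n → T → ℝ} (C : ℝ)
    (hg : Continuous g) (hG : ∀ i, Continuous (G i))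
    (h1 : EntIneq μ U φ (fun x => C + g x) G) (h2 : EntIneq μ U φ (fun x => C - g x) (fun i x => - G i x))
    (k : ℝ) {t1 t2 : ℝ} (ht1 : 0 < t1) (ht : t1 ≤ t2) :
    |(∫ x, |U t2 x - k| * g x ∂μ) - (∫ x, |U t1 x - k| * g x ∂μ) -
      ∫ t in t1..t2, ∫ x, ∑ i, G i x * sf φ i (U t x) k ∂μ| ≤ C * (mk μ U k t1 - mk μ U k t2) := by
  have e1 : ∀ t, ∫ x, |U t x - k| * (C + g x) ∂μ = C * mk μ U k t + ∫ x, |U t x - k| * g x ∂μ := by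
    intro t
    rw [mk, ← integral_const_mul, ← integral_add]
    · congr 1; ext x; ring
    · exact hU.integrable1 (fun q => C * |q.1 - k|) (by fun_prop) t
    · exact hU.integrable1 (fun q => |q.1 - k| * g q.2) (by fun_prop) t
  have e2 : ∀ t, ∫ x, |U t x - k| * (C - g x) ∂μ = C * mk μ U k t - ∫ x, |U t x - k| * g x ∂μ := by
    intro t
    rw [mk, ← integral_const_mul, ← integral_sub]
    · congr 1; ext x; ring
    · exact hU.integrable1 (fun q => C * |q.1 - k|) (by fun_prop) t
    · exact hU.integrable1 (fun q => |q.1 - k| * g q.2) (by fun_prop) t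
  have a1 := h1 k t1 t2 ht1 ht
  have a2 := h2 k t1 t2 ht1 ht
  simp only [e1, e2, neg_mul, Finset.sum_neg_distrib, integral_neg, intervalIntegral.integral_neg] at a1 a2
  rw [abs_le]
  constructor <;> linarith

lemma inc_eta (hU : Sys μ U M) (hφ : Continuous φ) {g : T → ℝ} {G : Fin n → T → ℝ} (C : ℝ)
    (hg : Continuous g) (hG : ∀ i, Continuous (G i))
    (h1 : EntIneq μ U φ (fun x => C + g x) G) (h2 : EntIneq μ U φ (fun x => C - g x) (fun i x => - G i x))
    (k1 k2 : ℝ) {t1 t2 : ℝ} (ht1 : 0 < t1) (ht : t1 ≤ t2) :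
    |(∫ x, eta k1 k2 (U t2 x) * g x ∂μ) - (∫ x, eta k1 k2 (U t1 x) * g x ∂μ) -
      ∫ t in t1..t2, ∫ x, ∑ i, G i x * qf φ i k1 k2 (U t x) ∂μ| ≤
      C * ((mk μ U k1 t1 + mk μ U k2 t1) / 2 - (mk μ U k1 t2 + mk μ U k2 t2) / 2) := by
  have a1 := inc_abs hU hφ C hg hG h1 h2 k1 ht1 ht
  have a2 := inc_abs hU hφ C hg hG h1 h2 k2 ht1 ht
  have e1 : ∀ t, ∫ x, eta k1 k2 (U t x) * g x ∂μ =
      ((∫ x, |U t x - k1| * g x ∂μ) - ∫ x, |U t x - k2| * g x ∂μ) / 2 := by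
    intro t
    rw [← integral_sub, ← integral_div]
    · congr 1; ext x; unfold eta; ring
    · exact hU.integrable1 (fun q => |q.1 - k1| * g q.2) (by fun_prop) t
    · exact hU.integrable1 (fun q => |q.1 - k2| * g q.2) (by fun_prop) t
  have hs : ∀ k, Continuous (fun q : ℝ × T => ∑ i, G i q.2 * sf φ i q.1 k) := by
    intro k
    refine continuous_finsetSum _ fun i _ => ?_
    exact ((hG i).comp continuous_snd).mul ((sf_cont hφ i).comp (by fun_prop : Continuous fun q : ℝ × T => (q.1, k)))
  have e2 : ∀ t, ∫ x, ∑ i, G i x * qf φ i k1 k2 (U t x) ∂μ =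
      ((∫ x, ∑ i, G i x * sf φ i (U t x) k1 ∂μ) - ∫ x, ∑ i, G i x * sf φ i (U t x) k2 ∂μ) / 2 := by
    intro t
    rw [← integral_sub, ← integral_div]
    · congr 1; ext x; unfold qf
      rw [← Finset.sum_sub_distrib, Finset.sum_div]
      refine Finset.sum_congr rfl fun i _ => ?_
      ring
    · exact hU.integrable1 _ (hs k1) t
    · exact hU.integrable1 _ (hs k2) t
  simp only [e1, e2, intervalIntegral.integral_div]
  rw [intervalIntegral.integral_sub (hU.intervalIntegrable1 _ (hs k1) _ _)
    (hU.intervalIntegrable1 _ (hs k2) _ _)]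
  rw [abs_le] at a1 a2 ⊢
  constructor <;> linarith [a1.1, a1.2, a2.1, a2.2]

lemma inc_W (hU : Sys μ U M) (hφ : Continuous φ) {κ : T → ℝ} {G : Fin n → T → ℝ} (C : ℝ)
    (hκ : Continuous κ) (hG : ∀ i, Continuous (G i))
    (h1 : Ker μ U φ (fun x => C + κ x) G) (h2 : Ker μ U φ (fun x => C - κ x) (fun i x => - G i x))
    (k1 k2 : ℝ) (w : ℝ → ℝ) (hw : Continuous w) (Cw : ℝ) (hCw : ∀ a, |w a| ≤ Cw)
    {t1 t2 : ℝ} (s : ℝ) (ht1 : 0 < t1) (ht : t1 ≤ t2) :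
    W μ U (fun q => eta k1 k2 q.1 * κ q.2.2 * w q.2.1) t2 s -
      W μ U (fun q => eta k1 k2 q.1 * κ q.2.2 * w q.2.1) t1 s ≤
      (∫ t in t1..t2, W μ U (fun q => (∑ i, G i q.2.2 * qf φ i k1 k2 q.1) * w q.2.1) t s) +
      (Cw * (C * ((mk μ U k1 t1 + mk μ U k2 t1) / 2)) - Cw * (C * ((mk μ U k1 t2 + mk μ U k2 t2) / 2))) := by
  have hec := eta_cont k1 k2
  have hqc := fun i => qf_cont hφ i k1 k2
  have hDc : Continuous (fun q : ℝ × ℝ × T => eta k1 k2 q.1 * κ q.2.2 * w q.2.1) := by fun_prop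
  have hQc : Continuous (fun q : ℝ × ℝ × T => (∑ i, G i q.2.2 * qf φ i k1 k2 q.1) * w q.2.1) := by
    fun_prop
  have hCw0 : 0 ≤ Cw := (abs_nonneg _).trans (hCw 0)
  rw [← W_fubini1 hU _ hQc s t1 t2 ht, W_eq1 hU _ hDc, W_eq1 hU _ hDc, ← integral_sub
      (hU.integrable_h _ hDc t2 s).integral_prod_right (hU.integrable_h _ hDc t1 s).integral_prod_right]
  set cc := (Cw * (C * ((mk μ U k1 t1 + mk μ U k2 t1) / 2)) -
    Cw * (C * ((mk μ U k1 t2 + mk μ U k2 t2) / 2))) with hcc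
  have hconst : cc = ∫ _y : T, cc ∂μ := by simp
  rw [hconst, ← integral_add (inner_int' hU _ hQc s t1 t2 ht) (integrable_const _)]
  refine integral_mono ((hU.integrable_h _ hDc t2 s).integral_prod_right.sub
      (hU.integrable_h _ hDc t1 s).integral_prod_right)
      ((inner_int' hU _ hQc s t1 t2 ht).add (integrable_const _)) ?_
  intro y
  have key := inc_eta hU hφ (g := fun x => κ (x - y)) (G := fun i x => G i (x - y)) C
    (by fun_prop) (fun i => by have := hG i; fun_prop) (h1.1 y) (h2.1 y) k1 k2 ht1 ht
  simp only [integral_mul_const, intervalIntegral.integral_mul_const]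
  rw [← sub_mul]
  set X := (∫ x, eta k1 k2 (U t2 x) * κ (x - y) ∂μ) - ∫ x, eta k1 k2 (U t1 x) * κ (x - y) ∂μ
  set Y := ∫ t in t1..t2, ∫ x, ∑ i, G i (x - y) * qf φ i k1 k2 (U t x) ∂μ
  have h3 : X * w (U s y) - Y * w (U s y) ≤ |w (U s y)| * |X - Y| := by
    rw [← sub_mul, mul_comm, ← abs_mul]; exact le_abs_self _
  have h4 : |w (U s y)| * |X - Y| ≤ Cw * (C * ((mk μ U k1 t1 + mk μ U k2 t1) / 2 - (mk μ U k1 t2 + mk μ U k2 t2) / 2)) :=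
    mul_le_mul (hCw _) key (abs_nonneg _) hCw0
  rw [hcc]
  linarith

lemma Ker.flip {g : T → ℝ} {G : Fin n → T → ℝ} (h : Ker μ U φ g G) :
    Ker μ U φ (fun x => g (-x)) (fun i x => - G i (-x)) := by
  constructor
  · intro y; simpa using h.2 y
  · intro y; simpa using h.1 y

/-- One-sided bound. -/
lemma K_one (hU : Sys μ U M) (hφ : Continuous φ) {κ : T → ℝ} {G : Fin n → T → ℝ} (C : ℝ)
    (hκ : Continuous κ) (hG : ∀ i, Continuous (G i))
    (h1 : Ker μ U φ (fun x => C + κ x) G) (h2 : Ker μ U φ (fun x => C - κ x) (fun i x => - G i x))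
    (k1 k2 l1 l2 : ℝ) :
    ∃ Cst, ∀ b, 1 ≤ b → -Cst ≤ ∫ t in (1:ℝ)..b, W μ U (fun q => ∑ i, G i q.2.2 *
      (qf φ i k1 k2 q.1 * eta l1 l2 q.2.1 - eta k1 k2 q.1 * qf φ i l1 l2 q.2.1)) t t := by
  have hec := eta_cont k1 k2
  have hqc := fun i => qf_cont hφ i k1 k2
  have hec' := eta_cont l1 l2
  have hqc' := fun i => qf_cont hφ i l1 l2
  have hDc : Continuous (fun q : ℝ × ℝ × T => eta k1 k2 q.1 * κ q.2.2 * eta l1 l2 q.2.1) := by fun_prop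
  have hQ1c : Continuous (fun q : ℝ × ℝ × T => (∑ i, G i q.2.2 * qf φ i k1 k2 q.1) * eta l1 l2 q.2.1) := by
    fun_prop
  have hQ2c : Continuous (fun q : ℝ × ℝ × T => (∑ i, - G i q.2.2 * qf φ i l1 l2 q.2.1) * eta k1 k2 q.1) := by
    fun_prop
  set P := |k1 - k2| / 2
  set P' := |l1 - l2| / 2
  have hch := fun b (hb : (1:ℝ) ≤ b) => chain (D := fun q => W μ U (fun q => eta k1 k2 q.1 * κ q.2.2 * eta l1 l2 q.2.1) q.1 q.2)
    (Q1 := fun q => W μ U (fun q => (∑ i, G i q.2.2 * qf φ i k1 k2 q.1) * eta l1 l2 q.2.1) q.1 q.2)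
    (Q2 := fun q => W μ U (fun q => (∑ i, - G i q.2.2 * qf φ i l1 l2 q.2.1) * eta k1 k2 q.1) q.1 q.2)
    (m1 := fun t => P' * (C * ((mk μ U k1 t + mk μ U k2 t) / 2)))
    (m2 := fun t => P * (C * ((mk μ U l1 t + mk μ U l2 t) / 2)))
    (W_contOn hU _ hDc) (W_contOn hU _ hQ1c) (W_contOn hU _ hQ2c)
    (by have := mk_contOn hU k1; have := mk_contOn hU k2; fun_prop)
    (by have := mk_contOn hU l1; have := mk_contOn hU l2; fun_prop)
    (fun t1 t2 s ht1 ht hs => inc_W hU hφ C hκ hG h1 h2 k1 k2 (eta l1 l2) hec' P' (eta_le l1 l2) s ht1 ht)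
    (by
      intro t s1 s2 hs1 hs ht
      have := inc_W hU hφ C (κ := fun x => κ (-x)) (G := fun i x => - G i (-x)) (by fun_prop)
        (fun i => by have := hG i; fun_prop) h1.flip (by simpa using h2.flip) l1 l2 (eta k1 k2) hec P
        (eta_le k1 k2) t hs1 hs
      have e1 : ∀ s, W μ U (fun q => eta l1 l2 q.1 * κ (-q.2.2) * eta k1 k2 q.2.1) s t =
          W μ U (fun q => eta k1 k2 q.1 * κ q.2.2 * eta l1 l2 q.2.1) t s := by
        intro s
        rw [← W_swap]
        congr 1; ext q; simp only [neg_neg]; ring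
      have e2 : ∀ s, W μ U (fun q => (∑ i, -G i (-q.2.2) * qf φ i l1 l2 q.1) * eta k1 k2 q.2.1) s t =
          W μ U (fun q => (∑ i, - G i q.2.2 * qf φ i l1 l2 q.2.1) * eta k1 k2 q.1) t s := by
        intro s
        rw [← W_swap]
        simp only [neg_neg]
      simp only [e1, e2] at this
      exact this) (a := 1) (b := b) one_pos hb
  obtain ⟨S, hS0, hS⟩ := unif_bound _ hDc M
  have hWS : ∀ t, |W μ U (fun q => eta k1 k2 q.1 * κ q.2.2 * eta l1 l2 q.2.1) t t| ≤ S := by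
    intro t
    have := norm_integral_le_of_norm_le_const (μ := μ.prod μ)
      (f := fun p : T × T => eta k1 k2 (U t p.1) * κ (p.1 - p.2) * eta l1 l2 (U t p.2)) (C := S)
      (ae_of_all _ fun p => hS _ _ _ (hU.bdd _ _) (hU.bdd _ _))
    simpa [W] using this
  have hmb : ∀ k t, |mk μ U k t| ≤ M + |k| := fun k t => by
    rw [abs_of_nonneg (mk_nonneg k t)]; exact mk_le hU k t
  have hmb2 : ∀ k l t, |C * ((mk μ U k t + mk μ U l t) / 2)| ≤ |C| * (M + |k| + |l| + M) := by
    intro k l t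
    rw [abs_mul]
    refine mul_le_mul_of_nonneg_left ?_ (abs_nonneg _)
    have := hmb k t; have := hmb l t
    rw [abs_le] at *
    constructor <;> linarith [abs_nonneg k, abs_nonneg l, (abs_le.1 (hmb k t)).1, (abs_le.1 (hmb k t)).2]
  refine ⟨2 * S + 2 * (P' * (|C| * (M + |k1| + |k2| + M))) + 2 * (P * (|C| * (M + |l1| + |l2| + M))),
    fun b hb => ?_⟩
  have hP : 0 ≤ P := by positivity
  have hP' : 0 ≤ P' := by positivity
  have c0 := hch b hb
  have c1 := abs_le.1 (hWS b)
  have c2 := abs_le.1 (hWS 1)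
  have m1 := fun t => mul_le_mul_of_nonneg_left (abs_le.1 (hmb2 k1 k2 t)).1 hP'
  have m2 := fun t => mul_le_mul_of_nonneg_left (abs_le.1 (hmb2 k1 k2 t)).2 hP'
  have m3 := fun t => mul_le_mul_of_nonneg_left (abs_le.1 (hmb2 l1 l2 t)).1 hP
  have m4 := fun t => mul_le_mul_of_nonneg_left (abs_le.1 (hmb2 l1 l2 t)).2 hP
  have e : ∀ t, W μ U (fun q => ∑ i, G i q.2.2 *
      (qf φ i k1 k2 q.1 * eta l1 l2 q.2.1 - eta k1 k2 q.1 * qf φ i l1 l2 q.2.1)) t t =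
      W μ U (fun q => (∑ i, G i q.2.2 * qf φ i k1 k2 q.1) * eta l1 l2 q.2.1) t t +
      W μ U (fun q => (∑ i, - G i q.2.2 * qf φ i l1 l2 q.2.1) * eta k1 k2 q.1) t t := by
    intro t
    rw [W, W, W, ← integral_add (hU.integrable_h _ hQ1c t t) (hU.integrable_h _ hQ2c t t)]
    congr 1; ext p
    simp only [Finset.sum_mul, ← Finset.sum_add_distrib]
    refine Finset.sum_congr rfl fun i _ => ?_
    ring
  simp only [e]
  linarith [m1 b, m2 b, m3 b, m4 b, m1 1, m2 1, m3 1, m4 1]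

lemma K_bound (hU : Sys μ U M) (hφ : Continuous φ) {κ : T → ℝ} {G : Fin n → T → ℝ} (C : ℝ)
    (hκ : Continuous κ) (hG : ∀ i, Continuous (G i))
    (h1 : Ker μ U φ (fun x => C + κ x) G) (h2 : Ker μ U φ (fun x => C - κ x) (fun i x => - G i x))
    (k1 k2 l1 l2 : ℝ) :
    ∃ Cst, ∀ b, 1 ≤ b → |∫ t in (1:ℝ)..b, W μ U (fun q => ∑ i, G i q.2.2 *
      (qf φ i k1 k2 q.1 * eta l1 l2 q.2.1 - eta k1 k2 q.1 * qf φ i l1 l2 q.2.1)) t t| ≤ Cst := by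
  obtain ⟨c1, h3⟩ := K_one hU hφ C hκ hG h1 h2 k1 k2 l1 l2
  obtain ⟨c2, h4⟩ := K_one hU hφ (κ := fun x => - κ x) (G := fun i x => - G i x) C (by fun_prop)
    (fun i => by have := hG i; fun_prop) (by simpa [sub_eq_add_neg] using h2) (by simpa using h1) k1 k2 l1 l2
  refine ⟨max c1 c2, fun b hb => ?_⟩
  have a1 := h3 b hb
  have a2 := h4 b hb
  simp only [W, neg_mul, Finset.sum_neg_distrib, integral_neg, intervalIntegral.integral_neg] at a1 a2 ⊢
  rw [abs_le]
  constructor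
  · linarith [le_max_left c1 c2]
  · linarith [le_max_right c1 c2]

end inc
end generic
end Decay
end PartC

section PartD
open MeasureTheory Filter Topology Set
set_option linter.unusedSectionVars false
set_option linter.unusedVariables false
namespace Decay

/-- The pair of intervals is good for `f`. -/
def Good (f : ℝ → ℝ) (k1 k2 l1 l2 O O' : ℝ) : Prop :=
  (∀ u ∈ Icc k1 k2, |f u - f k1| ≤ O ∧ |f u - f k2| ≤ O) ∧
  (∀ u ∈ Icc l1 l2, |f u - f l1| ≤ O' ∧ |f u - f l2| ≤ O') ∧
  O * (l2 - l1) + (k2 - k1) * O' ≤ 2 * |(f k2 - f k1) * (l2 - l1) - (k2 - k1) * (f l2 - f l1)| ∧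
  0 < |(f k2 - f k1) * (l2 - l1) - (k2 - k1) * (f l2 - f l1)|

lemma Good.symm {f : ℝ → ℝ} {k1 k2 l1 l2 O O' : ℝ} (h : Good f k1 k2 l1 l2 O O') :
    Good f l1 l2 k1 k2 O' O := by
  obtain ⟨h1, h2, h3, h4⟩ := h
  have e : (f l2 - f l1) * (k2 - k1) - (l2 - l1) * (f k2 - f k1) =
    -((f k2 - f k1) * (l2 - l1) - (k2 - k1) * (f l2 - f l1)) := by ring
  refine ⟨h2, h1, ?_, ?_⟩
  · rw [e, abs_neg]; linarith
  · rw [e, abs_neg]; exact h4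

lemma mono_interval {f : ℝ → ℝ} (hf : Continuous f) {a b : ℝ} (hab : a < b) :
    ∃ k1 k2, a < k1 ∧ k1 < k2 ∧ k2 < b ∧
      ∀ u ∈ Icc k1 k2, |f u - f k1| ≤ |f k2 - f k1| ∧ |f u - f k2| ≤ |f k2 - f k1| := by
  set x := (2 * a + b) / 3
  set y := (a + 2 * b) / 3
  have hxy : x < y := by simp only [x, y]; linarith
  have hax : a < x := by simp only [x]; linarith
  have hyb : y < b := by simp only [y]; linarith
  obtain ⟨m, hm, hm'⟩ := isCompact_Icc.exists_isMinOn (nonempty_Icc.2 hxy.le) hf.continuousOn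
  obtain ⟨p, hp, hp'⟩ := isCompact_Icc.exists_isMaxOn (nonempty_Icc.2 hxy.le) hf.continuousOn
  have hlo : ∀ u ∈ Icc x y, f m ≤ f u := fun u hu => hm' hu
  have hhi : ∀ u ∈ Icc x y, f u ≤ f p := fun u hu => hp' hu
  rcases lt_trichotomy m p with h | h | h
  · refine ⟨m, p, by linarith [hm.1], h, by linarith [hp.2], fun u hu => ?_⟩
    have hu' : u ∈ Icc x y := ⟨hm.1.trans hu.1, hu.2.trans hp.2⟩
    have a1 := hlo u hu'; have a2 := hhi u hu'
    rw [abs_of_nonneg (show 0 ≤ f p - f m by linarith), abs_of_nonneg (show 0 ≤ f u - f m by linarith),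
      abs_of_nonpos (show f u - f p ≤ 0 by linarith)]
    constructor <;> linarith
  · refine ⟨x, y, hax, hxy, hyb, fun u hu => ?_⟩
    subst h
    have e : ∀ v ∈ Icc x y, f v = f m := fun v hv => le_antisymm (hhi v hv) (hlo v hv)
    rw [e u hu, e x (left_mem_Icc.2 hxy.le), e y (right_mem_Icc.2 hxy.le)]
    simp
  · refine ⟨p, m, by linarith [hp.1], h, by linarith [hm.2], fun u hu => ?_⟩
    have hu' : u ∈ Icc x y := ⟨hp.1.trans hu.1, hu.2.trans hm.2⟩
    have a1 := hlo u hu'; have a2 := hhi u hu'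
    rw [abs_of_nonpos (show f m - f p ≤ 0 by linarith), abs_of_nonneg (show 0 ≤ f u - f m by linarith),
      abs_of_nonpos (show f u - f p ≤ 0 by linarith)]
    constructor <;> linarith

lemma chord {f : ℝ → ℝ} {c d : ℝ} (hcd : c < d)
    (hna : ¬ ∃ α β : ℝ, ∀ l ∈ Ioo c d, f l = α * l + β) :
    ∃ x p y, c < x ∧ x < p ∧ p < y ∧ y < d ∧ (f p - f x) * (y - x) ≠ (f y - f x) * (p - x) := by
  by_contra! hcon
  apply hna
  set x := (2 * c + d) / 3
  set y := (c + 2 * d) / 3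
  have hxy : x < y := by simp only [x, y]; linarith
  have hax : c < x := by simp only [x]; linarith
  have hyb : y < d := by simp only [y]; linarith
  have hne : y - x ≠ 0 := by linarith
  refine ⟨(f y - f x) / (y - x), f x - (f y - f x) / (y - x) * x, fun l hl => ?_⟩
  have key : (f l - f x) * (y - x) = (f y - f x) * (l - x) := by
    rcases lt_trichotomy l x with h | h | h
    · have := hcon l x y hl.1 h hxy hyb; linarith
    · subst h; ring
    rcases lt_trichotomy l y with h' | h' | h'
    · exact hcon x l y hax h h' hyb
    · rw [h']
    · have := hcon x y l hax hxy h' hl.2; linarith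
  field_simp
  linarith

lemma calc_one {f0 : ℝ → ℝ} (hf : Continuous f0) {a b c d : ℝ} (hab : a < b) (hcd : c < d)
    (hna : ¬ ∃ α β : ℝ, ∀ l ∈ Ioo c d, f0 l = α * l + β) :
    ∃ α k1 k2 l1 l2 O O', a < k1 ∧ k1 < k2 ∧ k2 < b ∧ c < l1 ∧ l1 < l2 ∧ l2 < d ∧
      Good (fun l => f0 l - α * l) k1 k2 l1 l2 O O' := by
  obtain ⟨x, p0, y, hx, hxp, hpy, hy, hne⟩ := chord hcd hna
  have hxy : x < y := hxp.trans hpy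
  set α := (f0 y - f0 x) / (y - x)
  set g : ℝ → ℝ := fun l => f0 l - α * l
  have hg : Continuous g := by fun_prop
  have hyx : y - x ≠ 0 := by linarith
  have hα : α * (y - x) = f0 y - f0 x := by simp only [α]; field_simp
  have hgxy : g y = g x := by simp only [g]; linarith
  have hgp0 : g p0 ≠ g x := by
    intro h
    apply hne
    simp only [g] at h
    have : f0 p0 - f0 x = α * (p0 - x) := by linarith
    rw [this, ← hα]; ring
  obtain ⟨p, hp, hp'⟩ := isCompact_Icc.exists_isMaxOn (nonempty_Icc.2 hxy.le)
    (f := fun l => |g l - g x|) (by fun_prop)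
  have hmax : ∀ u ∈ Icc x y, |g u - g x| ≤ |g p - g x| := fun u hu => hp' hu
  set A := |g p - g x| with hA
  have hApos : 0 < A := lt_of_lt_of_le (abs_pos.2 (sub_ne_zero.2 hgp0)) (hmax p0 ⟨hxp.le, hpy.le⟩)
  have hpx : p ≠ x := by rintro rfl; simp [hA] at hApos
  have hpy' : p ≠ y := by rintro rfl; simp [hA, hgxy] at hApos
  have hxp' : x < p := lt_of_le_of_ne hp.1 hpx.symm
  have hpy'' : p < y := lt_of_le_of_ne hp.2 hpy'
  have hb : ∀ u ∈ Icc x y, |g u - g x| ≤ 2 * A ∧ |g u - g p| ≤ 2 * A := by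
    intro u hu
    have h1 := hmax u hu
    refine ⟨by linarith, ?_⟩
    have : |g u - g p| ≤ |g u - g x| + |g p - g x| := by
      rw [abs_sub_comm (g p)]; exact abs_sub_le _ _ _
    linarith
  obtain ⟨k1, k2, hk1, hk, hk2, hO⟩ := mono_interval hg hab
  set D := g k2 - g k1
  have main : ∀ l1 l2 s, c < l1 → l1 < l2 → l2 < d → g l2 - g l1 = s → |s| = A → D * s ≤ 0 →
      (∀ u ∈ Icc l1 l2, |g u - g l1| ≤ 2 * A ∧ |g u - g l2| ≤ 2 * A) →
      ∃ α k1 k2 l1 l2 O O', a < k1 ∧ k1 < k2 ∧ k2 < b ∧ c < l1 ∧ l1 < l2 ∧ l2 < d ∧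
      Good (fun l => f0 l - α * l) k1 k2 l1 l2 O O' := by
    intro l1 l2 s h1 h2 h3 h4 h5 h6 h7
    have hR : |D * (l2 - l1) - (k2 - k1) * s| = |D| * (l2 - l1) + (k2 - k1) * A := by
      rw [← h5]
      rcases le_total 0 D with hD | hD <;> rcases le_total 0 s with hs | hs
      · have : D * s = 0 := le_antisymm h6 (mul_nonneg hD hs)
        rcases mul_eq_zero.1 this with h | h
        · rw [h]; rw [abs_of_nonneg hs, abs_of_nonpos (by nlinarith)]; simp
        · rw [h]; rw [abs_of_nonneg hD, abs_of_nonneg (by nlinarith)]; simp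
      · rw [abs_of_nonneg hD, abs_of_nonpos hs, abs_of_nonneg (by nlinarith)]; ring
      · rw [abs_of_nonpos hD, abs_of_nonneg hs, abs_of_nonpos (by nlinarith)]; ring
      · have : D * s = 0 := le_antisymm h6 (mul_nonneg_of_nonpos_of_nonpos hD hs)
        rcases mul_eq_zero.1 this with h | h
        · rw [h]; rw [abs_of_nonpos hs, abs_of_nonneg (by nlinarith)]; simp
        · rw [h]; rw [abs_of_nonpos hD, abs_of_nonpos (by nlinarith)]; simp
    refine ⟨α, k1, k2, l1, l2, |D|, 2 * A, hk1, hk, hk2, h1, h2, h3, hO, h7, ?_, ?_⟩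
    · change _ ≤ 2 * |D * (l2 - l1) - (k2 - k1) * (g l2 - g l1)|
      rw [h4, hR]
      have := mul_nonneg (abs_nonneg D) (sub_nonneg.2 h2.le)
      linarith
    · change 0 < |D * (l2 - l1) - (k2 - k1) * (g l2 - g l1)|
      rw [h4, hR]
      have := mul_nonneg (abs_nonneg D) (sub_nonneg.2 h2.le)
      have := mul_pos (sub_pos.2 hk) hApos
      linarith
  rcases le_total (D * (g p - g x)) 0 with hs | hs
  · exact main x p _ hx hxp' (hpy''.trans hy) rfl rfl hs fun u hu => hb u ⟨hu.1, hu.2.trans hpy''.le⟩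
  · refine main p y (g y - g p) (hx.trans hxp') hpy'' hy rfl ?_ ?_ fun u hu => ?_
    · rw [hgxy, abs_sub_comm]
    · rw [hgxy]; linarith
    · rw [hgxy]; exact (hb u ⟨hxp'.le.trans hu.1, hu.2⟩).symm

lemma calculus {f0 : ℝ → ℝ} (hf : Continuous f0) {I δ : ℝ} (hδ : 0 < δ)
    (hna : ¬ ∃ α β : ℝ, ∀ l ∈ Ioo (I - δ) (I + δ), f0 l = α * l + β) :
    ∃ α k1 k2 l1 l2 O O', I < k1 ∧ k1 < k2 ∧ k2 < I + δ ∧ I - δ < l1 ∧ l1 < l2 ∧ l2 < I ∧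
      Good (fun l => f0 l - α * l) k1 k2 l1 l2 O O' := by
  by_cases hR : ∃ α β : ℝ, ∀ l ∈ Ioo I (I + δ), f0 l = α * l + β
  swap
  · obtain ⟨α, k1, k2, l1, l2, O, O', h1, h2, h3, h4, h5, h6, h7⟩ :=
      calc_one hf (a := I - δ) (b := I) (by linarith) (by linarith) hR
    exact ⟨α, l1, l2, k1, k2, O', O, h4, h5, h6, h1, h2, h3, h7.symm⟩
  by_cases hL : ∃ α β : ℝ, ∀ l ∈ Ioo (I - δ) I, f0 l = α * l + β
  swap
  · exact calc_one hf (by linarith) (by linarith) hL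
  obtain ⟨α, β, h1⟩ := hR
  obtain ⟨α', β', h2⟩ := hL
  have hIR : f0 I = α * I + β := by
    refine tendsto_nhds_unique (f := f0) (l := 𝓝[>] I) hf.continuousAt.continuousWithinAt ?_
    refine Tendsto.congr' ?_ ((by fun_prop : Continuous (fun l => α * l + β)).continuousAt.continuousWithinAt (s := Ioi I))
    filter_upwards [Ioo_mem_nhdsGT (show I < I + δ by linarith)] with l hl using (h1 l hl).symm
  have hIL : f0 I = α' * I + β' := by
    refine tendsto_nhds_unique (f := f0) (l := 𝓝[<] I) hf.continuousAt.continuousWithinAt ?_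
    refine Tendsto.congr' ?_ ((by fun_prop : Continuous (fun l => α' * l + β')).continuousAt.continuousWithinAt (s := Iio I))
    filter_upwards [Ioo_mem_nhdsLT (show I - δ < I by linarith)] with l hl using (h2 l hl).symm
  have hne : α ≠ α' := by
    rintro rfl
    refine hna ⟨α, β, fun l hl => ?_⟩
    rcases lt_trichotomy l I with h | h | h
    · rw [h2 l ⟨hl.1, h⟩]; linarith
    · rw [h, hIR]
    · exact h1 l ⟨h, hl.2⟩
  have e1 : ∀ u ∈ Icc (I + δ / 3) (I + 2 * δ / 3), f0 u - α * u = β := fun u hu => by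
    rw [h1 u ⟨by linarith [hu.1], by linarith [hu.2]⟩]; ring
  have e2 : ∀ u ∈ Icc (I - 2 * δ / 3) (I - δ / 3), f0 u - α * u = (α' - α) * u + β' := fun u hu => by
    rw [h2 u ⟨by linarith [hu.1], by linarith [hu.2]⟩]; ring
  have e1a := e1 (I + δ / 3) ⟨le_rfl, by linarith⟩
  have e1b := e1 (I + 2 * δ / 3) ⟨by linarith, le_rfl⟩
  have e2a := e2 (I - 2 * δ / 3) ⟨le_rfl, by linarith⟩
  have e2b := e2 (I - δ / 3) ⟨by linarith, le_rfl⟩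
  have hRR : |(β - β) * (I - δ / 3 - (I - 2 * δ / 3)) - (I + 2 * δ / 3 - (I + δ / 3)) *
      ((α' - α) * (I - δ / 3) + β' - ((α' - α) * (I - 2 * δ / 3) + β'))| = |α' - α| * (δ / 3) * (δ / 3) := by
    rw [show (β - β) * (I - δ / 3 - (I - 2 * δ / 3)) - (I + 2 * δ / 3 - (I + δ / 3)) *
      ((α' - α) * (I - δ / 3) + β' - ((α' - α) * (I - 2 * δ / 3) + β')) = - ((α' - α) * ((δ / 3) * (δ / 3))) by ring,
      abs_neg, abs_mul, abs_of_pos (show 0 < δ / 3 * (δ / 3) by positivity)]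
    ring
  have hap : 0 < |α' - α| := abs_pos.2 (sub_ne_zero.2 hne.symm)
  refine ⟨α, I + δ / 3, I + 2 * δ / 3, I - 2 * δ / 3, I - δ / 3, 0, |α' - α| * (δ / 3), by linarith,
    by linarith, by linarith, by linarith, by linarith, by linarith, ?_, ?_, ?_, ?_⟩
  · intro u hu
    simp only [e1 u hu, e1a, e1b]; simp
  · intro u hu
    simp only [e2 u hu, e2a, e2b]
    rw [show (α' - α) * u + β' - ((α' - α) * (I - 2 * δ / 3) + β') = (α' - α) * (u - (I - 2 * δ / 3)) by ring,
      show (α' - α) * u + β' - ((α' - α) * (I - δ / 3) + β') = (α' - α) * (u - (I - δ / 3)) by ring, abs_mul, abs_mul]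
    constructor
    · refine mul_le_mul_of_nonneg_left ?_ hap.le
      rw [abs_le]; constructor <;> linarith [hu.1, hu.2]
    · refine mul_le_mul_of_nonneg_left ?_ hap.le
      rw [abs_le]; constructor <;> linarith [hu.1, hu.2]
  · simp only [e1a, e1b, e2a, e2b, hRR]
    have : 0 ≤ |α' - α| * (δ / 3) * (δ / 3) := by positivity
    linarith
  · simp only [e1a, e1b, e2a, e2b, hRR]
    positivity

/-- normalized ramp: `0` left of `k1`, `1` right of `k2`. -/
noncomputable def ps (k1 k2 a : ℝ) : ℝ := eta k1 k2 a / (k2 - k1) + 1 / 2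
/-- scalar flux of the ramp. -/
noncomputable def qs (f : ℝ → ℝ) (k1 k2 a : ℝ) : ℝ :=
  (Real.sign (a - k1) * (f a - f k1) - Real.sign (a - k2) * (f a - f k2)) / 2

lemma ps_cont (k1 k2 : ℝ) : Continuous (ps k1 k2) := by
  have := eta_cont k1 k2
  unfold ps; fun_prop

lemma eta_ps {k1 k2 : ℝ} (h : k1 < k2) (a : ℝ) : eta k1 k2 a = (k2 - k1) * (ps k1 k2 a - 1 / 2) := by
  have : k2 - k1 ≠ 0 := by linarith
  unfold ps; field_simp; ring

lemma ps_left {k1 k2 a : ℝ} (h : k1 < k2) (ha : a ≤ k1) : ps k1 k2 a = 0 := by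
  have : k2 - k1 ≠ 0 := by linarith
  unfold ps eta
  rw [abs_of_nonpos (by linarith), abs_of_nonpos (by linarith)]; field_simp; ring

lemma ps_right {k1 k2 a : ℝ} (h : k1 < k2) (ha : k2 ≤ a) : ps k1 k2 a = 1 := by
  have : k2 - k1 ≠ 0 := by linarith
  unfold ps eta
  rw [abs_of_nonneg (by linarith), abs_of_nonneg (by linarith)]; field_simp; ring

lemma ps_mid {k1 k2 a : ℝ} (h : k1 < k2) (ha : k1 ≤ a) (ha' : a ≤ k2) : ps k1 k2 a = (a - k1) / (k2 - k1) := by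
  have : k2 - k1 ≠ 0 := by linarith
  unfold ps eta
  rw [abs_of_nonneg (by linarith), abs_of_nonpos (by linarith)]; field_simp; ring

lemma ps_mem {k1 k2 : ℝ} (h : k1 < k2) (a : ℝ) : 0 ≤ ps k1 k2 a ∧ ps k1 k2 a ≤ 1 := by
  have h2 : 0 < k2 - k1 := by linarith
  rcases le_total a k1 with h1 | h1
  · rw [ps_left h h1]; norm_num
  rcases le_total a k2 with h3 | h3
  · rw [ps_mid h h1 h3]
    exact ⟨div_nonneg (by linarith) h2.le, (div_le_one h2).2 (by linarith)⟩
  · rw [ps_right h h3]; norm_num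

lemma ps_lip {k1 k2 : ℝ} (h : k1 < k2) (a b : ℝ) : |ps k1 k2 a - ps k1 k2 b| ≤ |a - b| / (k2 - k1) := by
  have h2 : 0 < k2 - k1 := by linarith
  unfold ps eta
  rw [show (|a - k1| - |a - k2|) / 2 / (k2 - k1) + 1 / 2 - ((|b - k1| - |b - k2|) / 2 / (k2 - k1) + 1 / 2) =
    ((|a - k1| - |b - k1|) / 2 - (|a - k2| - |b - k2|) / 2) / (k2 - k1) by ring, abs_div, abs_of_pos h2]
  refine div_le_div_of_nonneg_right ?_ h2.le
  have e1 := abs_le.1 (abs_abs_sub_abs_le_abs_sub (a - k1) (b - k1))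
  have e2 := abs_le.1 (abs_abs_sub_abs_le_abs_sub (a - k2) (b - k2))
  rw [show a - k1 - (b - k1) = a - b by ring] at e1
  rw [show a - k2 - (b - k2) = a - b by ring] at e2
  rw [abs_le]; constructor <;> linarith [e1.1, e1.2, e2.1, e2.2]

lemma ps_anti {k1 k2 m1 m2 : ℝ} (h : k1 < k2) (h' : m1 < m2) (hm : k2 ≤ m1) (a : ℝ) :
    ps m1 m2 a ≤ ps k1 k2 a := by
  rcases le_total a k2 with h1 | h1
  · rw [ps_left h' (h1.trans hm)]; exact (ps_mem h a).1
  · rw [ps_right h h1]; exact (ps_mem h' a).2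

lemma qs_left {f : ℝ → ℝ} {k1 k2 a : ℝ} (h : k1 < k2) (ha : a ≤ k1) : qs f k1 k2 a = -((f k2 - f k1) / 2) := by
  unfold qs
  rw [Real.sign_of_neg (show a - k2 < 0 by linarith)]
  rcases eq_or_lt_of_le ha with rfl | h1
  · simp; ring
  · rw [Real.sign_of_neg (by linarith)]; ring

lemma qs_right {f : ℝ → ℝ} {k1 k2 a : ℝ} (h : k1 < k2) (ha : k2 ≤ a) : qs f k1 k2 a = (f k2 - f k1) / 2 := by
  unfold qs
  rw [Real.sign_of_pos (show 0 < a - k1 by linarith)]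
  rcases eq_or_lt_of_le ha with rfl | h1
  · simp
  · rw [Real.sign_of_pos (by linarith)]; ring

lemma qs_mid {f : ℝ → ℝ} {k1 k2 a : ℝ} (ha : k1 < a) (ha' : a < k2) :
    qs f k1 k2 a = ((f a - f k1) + (f a - f k2)) / 2 := by
  unfold qs
  rw [Real.sign_of_pos (by linarith), Real.sign_of_neg (by linarith)]; ring

lemma qs_id (k1 k2 a : ℝ) : qs (fun x => x) k1 k2 a = eta k1 k2 a := by
  have : ∀ x : ℝ, Real.sign x * x = |x| := fun x => by
    rcases lt_trichotomy x 0 with h | h | h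
    · rw [Real.sign_of_neg h, abs_of_neg h]; ring
    · simp [h]
    · rw [Real.sign_of_pos h, abs_of_pos h]; ring
  unfold qs eta
  rw [this, this]

lemma qs_le {f : ℝ → ℝ} {k1 k2 O : ℝ} (h : k1 < k2)
    (hO : ∀ u ∈ Icc k1 k2, |f u - f k1| ≤ O ∧ |f u - f k2| ≤ O) (a : ℝ) : |qs f k1 k2 a| ≤ O := by
  have hD := (hO k2 ⟨h.le, le_rfl⟩).1
  have hp := abs_nonneg (f k2 - f k1)
  rcases le_or_gt a k1 with h1 | h1
  · rw [qs_left h h1, abs_neg, abs_div, abs_two]; linarith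
  rcases le_or_gt k2 a with h3 | h3
  · rw [qs_right h h3, abs_div, abs_two]; linarith
  · rw [qs_mid h1 h3]
    obtain ⟨h4, h5⟩ := hO a ⟨h1.le, h3.le⟩
    rw [abs_le] at *
    constructor <;> linarith

/-- approximation by the far ramp, right side -/
lemma approx_right {f : ℝ → ℝ} {l1 l2 k1 k2 m1 m2 O : ℝ} (hl : l1 < l2) (hlk : l2 ≤ k1) (hk : k1 < k2)
    (hkm : k2 ≤ m1) (hm : m1 < m2)
    (hO : ∀ u ∈ Icc k1 k2, |f u - f k1| ≤ O ∧ |f u - f k2| ≤ O) (a : ℝ) :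
    |qs f k1 k2 a - (f k2 - f k1) * (ps m1 m2 a - 1 / 2)| ≤ O * (ps l1 l2 a - ps m1 m2 a) := by
  have hD := (hO k2 ⟨hk.le, le_rfl⟩).1
  have hO0 : 0 ≤ O := (abs_nonneg _).trans hD
  rcases le_or_gt a k1 with h1 | h1
  · rw [qs_left hk h1, ps_left hm (by linarith)]
    rw [show -((f k2 - f k1) / 2) - (f k2 - f k1) * (0 - 1 / 2) = 0 by ring, abs_zero]
    have := (ps_mem hl a).1
    nlinarith
  rw [ps_right hl (by linarith)]
  rcases le_or_gt k2 a with h3 | h3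
  · rw [qs_right hk h3, show (f k2 - f k1) / 2 - (f k2 - f k1) * (ps m1 m2 a - 1 / 2) =
      (f k2 - f k1) * (1 - ps m1 m2 a) by ring, abs_mul]
    have := (ps_mem hm a).2
    rw [abs_of_nonneg (show 0 ≤ 1 - ps m1 m2 a by linarith)]
    exact mul_le_mul_of_nonneg_right hD (by linarith)
  · rw [qs_mid h1 h3, ps_left hm (by linarith),
      show (f a - f k1 + (f a - f k2)) / 2 - (f k2 - f k1) * (0 - 1 / 2) = f a - f k1 by ring]
    linarith [(hO a ⟨h1.le, h3.le⟩).1]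

lemma approx_left {f : ℝ → ℝ} {l1 l2 k1 k2 m1 m2 O : ℝ} (hl : l1 < l2) (hlk : k2 ≤ l1) (hk : k1 < k2)
    (hkm : m2 ≤ k1) (hm : m1 < m2)
    (hO : ∀ u ∈ Icc k1 k2, |f u - f k1| ≤ O ∧ |f u - f k2| ≤ O) (a : ℝ) :
    |qs f k1 k2 a - (f k2 - f k1) * (ps m1 m2 a - 1 / 2)| ≤ O * (ps m1 m2 a - ps l1 l2 a) := by
  have hD := (hO k2 ⟨hk.le, le_rfl⟩).1
  have hO0 : 0 ≤ O := (abs_nonneg _).trans hD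
  rcases le_or_gt k2 a with h3 | h3
  · rw [qs_right hk h3, ps_right hm (by linarith)]
    rw [show (f k2 - f k1) / 2 - (f k2 - f k1) * (1 - 1 / 2) = 0 by ring, abs_zero]
    have := (ps_mem hl a).2
    nlinarith
  rw [ps_left hl (by linarith)]
  rcases le_or_gt a k1 with h1 | h1
  · rw [qs_left hk h1, show -((f k2 - f k1) / 2) - (f k2 - f k1) * (ps m1 m2 a - 1 / 2) =
      -((f k2 - f k1) * (ps m1 m2 a)) by ring, abs_neg, abs_mul]
    have := (ps_mem hm a).1
    rw [abs_of_nonneg this]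
    nlinarith
  · rw [qs_mid h1 h3, ps_right hm (by linarith),
      show (f a - f k1 + (f a - f k2)) / 2 - (f k2 - f k1) * (1 - 1 / 2) = f a - f k2 by ring]
    linarith [(hO a ⟨h1.le, h3.le⟩).2]

end Decay
end PartD

section PartE
open MeasureTheory Filter Topology Set
set_option linter.unusedSectionVars false
set_option linter.unusedVariables false
namespace Decay

lemma qs_cont {f : ℝ → ℝ} (hf : Continuous f) (k1 k2 : ℝ) : Continuous (qs f k1 k2) := by
  have := qf_cont (n := 1) (φ := fun a _ => f a) (by fun_prop) 0 k1 k2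
  exact this

lemma qs_sum {n : ℕ} (φ : ℝ → Fin n → ℝ) (ζ : Fin n → ℝ) (k1 k2 a : ℝ) :
    ∑ i, ζ i * qf φ i k1 k2 a = qs (fun l => ∑ i, ζ i * φ l i) k1 k2 a := by
  unfold qf qs sf
  rw [← Finset.sum_sub_distrib, ← Finset.sum_sub_distrib, Finset.mul_sum, Finset.mul_sum,
    ← Finset.sum_sub_distrib, Finset.sum_div]
  exact Finset.sum_congr rfl fun i _ => by ring

lemma qs_sub (f : ℝ → ℝ) (α k1 k2 a : ℝ) :
    qs (fun l => f l - α * l) k1 k2 a = qs f k1 k2 a - α * eta k1 k2 a := by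
  rw [← qs_id]
  unfold qs; ring

/-- pointwise comparison -/
lemma approx_bracket {f : ℝ → ℝ} {k1 k2 l1 l2 m1 m2 p1 p2 O O' d d' : ℝ} {a b : ℝ}
    (hk : k1 < k2) (hl : l1 < l2) (hm : m1 < m2) (hp : p1 < p2)
    (hG : Good f k1 k2 l1 l2 O O') (hd : 0 ≤ d) (hd' : 0 ≤ d')
    (h1 : |qs f k1 k2 a - (f k2 - f k1) * (ps m1 m2 a - 1 / 2)| ≤ O * d)
    (h2 : |eta k1 k2 a - (k2 - k1) * (ps m1 m2 a - 1 / 2)| ≤ (k2 - k1) * d)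
    (h3 : |qs f l1 l2 b - (f l2 - f l1) * (ps p1 p2 b - 1 / 2)| ≤ O' * d')
    (h4 : |eta l1 l2 b - (l2 - l1) * (ps p1 p2 b - 1 / 2)| ≤ (l2 - l1) * d') :
    |(qs f k1 k2 a * eta l1 l2 b - eta k1 k2 a * qs f l1 l2 b) -
      ((f k2 - f k1) * (l2 - l1) - (k2 - k1) * (f l2 - f l1)) *
        ((ps m1 m2 a - 1 / 2) * (ps p1 p2 b - 1 / 2))| ≤
    2 * |(f k2 - f k1) * (l2 - l1) - (k2 - k1) * (f l2 - f l1)| * (d + d') := by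
  obtain ⟨g1, g2, g3, g4⟩ := hG
  have hO : |f k2 - f k1| ≤ O := (g1 k2 ⟨hk.le, le_rfl⟩).1
  have hO' : |f l2 - f l1| ≤ O' := (g2 l2 ⟨hl.le, le_rfl⟩).1
  have q2 := qs_le hl g2 b
  have e2 : |eta l1 l2 b| ≤ l2 - l1 := by
    have := eta_le l1 l2 b
    rw [abs_sub_comm l1 l2, abs_of_pos (show 0 < l2 - l1 by linarith)] at this; linarith
  have x1 : |ps m1 m2 a - 1 / 2| ≤ 1 := by
    rw [abs_le]; constructor <;> linarith [(ps_mem hm a).1, (ps_mem hm a).2]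
  have hO0 := (abs_nonneg _).trans hO
  have hO0' := (abs_nonneg _).trans hO'
  have hkp : 0 < k2 - k1 := by linarith
  have hlp : 0 < l2 - l1 := by linarith
  clear g1 g2 g4
  generalize ps m1 m2 a - 1 / 2 = x at *
  generalize ps p1 p2 b - 1 / 2 = y at *
  generalize qs f k1 k2 a = q at *
  generalize qs f l1 l2 b = q' at *
  generalize eta k1 k2 a = e at *
  generalize eta l1 l2 b = e' at *
  generalize f k2 - f k1 = Δf at *
  generalize f l2 - f l1 = Δf' at *
  generalize k2 - k1 = Δ at *
  generalize l2 - l1 = Δ' at *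
  have key : (q * e' - e * q') - (Δf * Δ' - Δ * Δf') * (x * y) =
      (q - Δf * x) * e' + Δf * x * (e' - Δ' * y) - (e - Δ * x) * q' - Δ * x * (q' - Δf' * y) := by ring
  rw [key]
  have b1 : |(q - Δf * x) * e'| ≤ O * d * Δ' := by
    rw [abs_mul]; exact mul_le_mul h1 e2 (abs_nonneg _) (by positivity)
  have b2 : |Δf * x * (e' - Δ' * y)| ≤ O * 1 * (Δ' * d') := by
    rw [abs_mul, abs_mul]
    exact mul_le_mul (mul_le_mul hO x1 (abs_nonneg _) hO0) h4 (abs_nonneg _) (by positivity)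
  have b3 : |(e - Δ * x) * q'| ≤ Δ * d * O' := by
    rw [abs_mul]; exact mul_le_mul h2 q2 (abs_nonneg _) (by positivity)
  have b4 : |Δ * x * (q' - Δf' * y)| ≤ Δ * 1 * (O' * d') := by
    rw [abs_mul, abs_mul]
    exact mul_le_mul (mul_le_mul (le_of_eq (abs_of_pos hkp)) x1 (abs_nonneg _) hkp.le) h3 (abs_nonneg _)
      (by positivity)
  have b5 := mul_le_mul_of_nonneg_right g3 (add_nonneg hd hd')
  refine le_trans ?_ b5
  refine (abs_sub _ _).trans ?_
  refine (add_le_add ((abs_sub _ _).trans (add_le_add (abs_add_le _ _) le_rfl)) le_rfl).trans ?_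
  linarith

section generic
variable {T : Type} [AddCommGroup T] [TopologicalSpace T] [IsTopologicalAddGroup T]
  [CompactSpace T] [SecondCountableTopology T] [MeasurableSpace T] [BorelSpace T]
variable {μ : Measure T} [IsProbabilityMeasure μ] {U : ℝ → T → ℝ} {M : ℝ}

lemma W_mono (hU : Sys μ U M) {h h' : ℝ × ℝ × T → ℝ} (hh : Continuous h) (hh' : Continuous h')
    (hle : ∀ q, h q ≤ h' q) (t s : ℝ) : W μ U h t s ≤ W μ U h' t s :=
  integral_mono (hU.integrable_h h hh t s) (hU.integrable_h h' hh' t s) fun p => hle _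

lemma W_ii (hU : Sys μ U M) {h : ℝ × ℝ × T → ℝ} (hh : Continuous h) {a b : ℝ} (ha : 0 < a) (hb : 0 < b) :
    IntervalIntegrable (fun t => W μ U h t t) volume a b := by
  have h1 := W_contOn hU h hh
  have h2 : ContinuousOn (fun t : ℝ => ((t, t) : ℝ × ℝ)) (Ioi 0) := by fun_prop
  have h3 := h1.comp h2 (fun t ht => ⟨ht, ht⟩)
  refine (h3.mono ?_).intervalIntegrable
  intro x hx
  exact lt_of_lt_of_le (lt_min ha hb) hx.1

lemma W_abs (hU : Sys μ U M) {h h' : ℝ × ℝ × T → ℝ} (hh : Continuous h) (hh' : Continuous h')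
    (hle : ∀ q, |h q| ≤ h' q) (t s : ℝ) : |W μ U h t s| ≤ W μ U h' t s := by
  have : |W μ U h t s| ≤ W μ U (fun q => |h q|) t s := by
    unfold W; exact abs_integral_le_integral_abs
  exact this.trans (W_mono hU (by fun_prop) hh' hle t s)

variable {n : ℕ} {φ : ℝ → Fin n → ℝ}

/-- A Fourier-like mode: kernels that are gradients in direction `ζ`. -/
def Mode (μ : Measure T) (U : ℝ → T → ℝ) (φ : ℝ → Fin n → ℝ) (κ : T → ℝ) (ζ : Fin n → ℝ) : Prop :=
  Continuous κ ∧ ∃ (κ' : T → ℝ) (C' : ℝ), Continuous κ' ∧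
    Ker μ U φ (fun x => C' + κ' x) (fun i x => ζ i * κ x) ∧
    Ker μ U φ (fun x => C' - κ' x) (fun i x => - (ζ i * κ x))

lemma Mode.bound (hU : Sys μ U M) (hφ : Continuous φ) {κ : T → ℝ} {ζ : Fin n → ℝ}
    (hm : Mode μ U φ κ ζ) (α k1 k2 l1 l2 : ℝ) :
    ∃ Cst, ∀ b, 1 ≤ b → |∫ t in (1:ℝ)..b, W μ U (fun q => κ q.2.2 *
      (qs (fun l => (∑ i, ζ i * φ l i) - α * l) k1 k2 q.1 * eta l1 l2 q.2.1 -
        eta k1 k2 q.1 * qs (fun l => (∑ i, ζ i * φ l i) - α * l) l1 l2 q.2.1)) t t| ≤ Cst := by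
  obtain ⟨hκ, κ', C', hκ', h1, h2⟩ := hm
  obtain ⟨Cst, h⟩ := K_bound hU hφ C' hκ' (fun i => by fun_prop) h1 h2 k1 k2 l1 l2
  refine ⟨Cst, fun b hb => ?_⟩
  have e : ∀ q : ℝ × ℝ × T, κ q.2.2 *
      (qs (fun l => (∑ i, ζ i * φ l i) - α * l) k1 k2 q.1 * eta l1 l2 q.2.1 -
        eta k1 k2 q.1 * qs (fun l => (∑ i, ζ i * φ l i) - α * l) l1 l2 q.2.1) = ∑ i, ζ i * κ q.2.2 *
      (qf φ i k1 k2 q.1 * eta l1 l2 q.2.1 - eta k1 k2 q.1 * qf φ i l1 l2 q.2.1) := by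
    intro q
    rw [qs_sub, qs_sub, ← qs_sum, ← qs_sum]
    rw [show (∑ i, ζ i * qf φ i k1 k2 q.1 - α * eta k1 k2 q.1) * eta l1 l2 q.2.1 -
      eta k1 k2 q.1 * (∑ i, ζ i * qf φ i l1 l2 q.2.1 - α * eta l1 l2 q.2.1) =
      (∑ i, ζ i * qf φ i k1 k2 q.1) * eta l1 l2 q.2.1 -
      eta k1 k2 q.1 * (∑ i, ζ i * qf φ i l1 l2 q.2.1) by ring]
    rw [Finset.sum_mul, Finset.mul_sum, ← Finset.sum_sub_distrib, Finset.mul_sum]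
    exact Finset.sum_congr rfl fun i _ => by ring
  simp only [e]
  exact h b hb

/-- Tail property of the right ramp. -/
def TailR (μ : Measure T) (U : ℝ → T → ℝ) (I ε m1 m2 : ℝ) : Prop :=
  ∀ l1 l2, I < l1 → l1 < l2 → l2 ≤ m1 →
    ∀ᶠ t in atTop, ∫ x, (ps l1 l2 (U t x) - ps m1 m2 (U t x)) ∂μ ≤ ε
/-- Tail property of the left ramp. -/
def TailL (μ : Measure T) (U : ℝ → T → ℝ) (I ε m1 m2 : ℝ) : Prop :=
  ∀ l1 l2, m2 ≤ l1 → l1 < l2 → l2 < I →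
    ∀ᶠ t in atTop, ∫ x, (ps m1 m2 (U t x) - ps l1 l2 (U t x)) ∂μ ≤ ε

lemma ps_int (hU : Sys μ U M) (k1 k2 t : ℝ) : Integrable (fun x => ps k1 k2 (U t x)) μ :=
  hU.integrable1 (fun q => ps k1 k2 q.1) (by have := ps_cont k1 k2; fun_prop) t

lemma ps_lim (hU : Sys μ U M) (h1 : EntIneq μ U φ (fun _ => 1) (fun _ _ => 0)) (k1 k2 : ℝ) :
    ∃ c, Tendsto (fun t => ∫ x, ps k1 k2 (U t x) ∂μ) atTop (𝓝 c) := by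
  have hlim : ∀ k, ∃ c, Tendsto (fun t => mk μ U k t) atTop (𝓝 c) := by
    intro k
    have ha : Antitone (fun t => mk μ U k (max t 1)) := fun t1 t2 ht =>
      mk_anti h1 k (lt_max_of_lt_right one_pos) (max_le_max_right 1 ht)
    have := tendsto_atTop_ciInf ha ⟨0, by rintro _ ⟨t, rfl⟩; exact mk_nonneg _ _⟩
    refine ⟨_, this.congr' ?_⟩
    filter_upwards [eventually_ge_atTop 1] with t ht
    rw [max_eq_left ht]
  obtain ⟨c1, hc1⟩ := hlim k1
  obtain ⟨c2, hc2⟩ := hlim k2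
  refine ⟨(c1 - c2) / 2 / (k2 - k1) + 1 / 2, ((((hc1.sub hc2).div_const 2).div_const _).add_const _).congr ?_⟩
  intro t
  have i1 := hU.integrable1 (fun q => |q.1 - k1|) (by fun_prop) t
  have i2 := hU.integrable1 (fun q => |q.1 - k2|) (by fun_prop) t
  unfold ps eta mk
  have i3 : Integrable (fun x => (|U t x - k1| - |U t x - k2|) / 2 / (k2 - k1)) μ :=
    ((i1.sub i2).div_const 2).div_const _
  rw [integral_add i3 (integrable_const _), integral_div, integral_div]
  have := integral_sub i1 i2
  simp only at this
  rw [this]; simp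

lemma near_sup {ι : Type*} [Nonempty ι] (c : ι → ℝ) (hc : ∀ j, c j ≤ 1) (ε : ℝ) (hε : 0 < ε) :
    ∃ j0, ∀ j, c j - c j0 < ε := by
  have hb : BddAbove (range c) := ⟨1, by rintro _ ⟨j, rfl⟩; exact hc j⟩
  obtain ⟨j0, hj0⟩ := exists_lt_of_lt_ciSup (show (⨆ j, c j) - ε < ⨆ j, c j by linarith)
  exact ⟨j0, fun j => by linarith [le_ciSup hb j]⟩

lemma exists_tailR (hU : Sys μ U M) (h1 : EntIneq μ U φ (fun _ => 1) (fun _ _ => 0)) (I δ ε : ℝ)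
    (hδ : 0 < δ) (hε : 0 < ε) :
    ∃ m1 m2, I < m1 ∧ m1 < m2 ∧ m2 < I + δ ∧ TailR μ U I ε m1 m2 := by
  let ι := {p : ℝ × ℝ // I < p.1 ∧ p.1 < p.2 ∧ p.2 < I + δ}
  have : Nonempty ι := ⟨⟨(I + δ / 3, I + δ / 2), by simp; exact ⟨hδ, by linarith, by linarith⟩⟩⟩
  choose c hc using fun p : ι => ps_lim hU h1 p.1.1 p.1.2
  obtain ⟨⟨⟨m1, m2⟩, hm⟩, h⟩ := near_sup c (fun j => by
    refine le_of_tendsto (hc j) (Eventually.of_forall fun t => ?_)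
    have := integral_mono (ps_int hU j.1.1 j.1.2 t) (integrable_const (μ := μ) (1:ℝ)) fun x =>
      (ps_mem j.2.2.1 _).2
    simpa using this) ε hε
  refine ⟨m1, m2, hm.1, hm.2.1, hm.2.2, fun l1 l2 a1 a2 a3 => ?_⟩
  have hl : I < l1 ∧ l1 < l2 ∧ l2 < I + δ := ⟨a1, a2, by linarith [hm.2.1, hm.2.2]⟩
  have := ((hc ⟨(l1, l2), hl⟩).sub (hc ⟨(m1, m2), hm⟩)).eventually_lt_const (h ⟨(l1, l2), hl⟩)
  filter_upwards [this] with t ht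
  rw [integral_sub (ps_int hU _ _ _) (ps_int hU _ _ _)]
  exact ht.le

lemma exists_tailL (hU : Sys μ U M) (h1 : EntIneq μ U φ (fun _ => 1) (fun _ _ => 0)) (I δ ε : ℝ)
    (hδ : 0 < δ) (hε : 0 < ε) :
    ∃ m1 m2, I - δ < m1 ∧ m1 < m2 ∧ m2 < I ∧ TailL μ U I ε m1 m2 := by
  let ι := {p : ℝ × ℝ // I - δ < p.1 ∧ p.1 < p.2 ∧ p.2 < I}
  have : Nonempty ι := ⟨⟨(I - δ / 2, I - δ / 3), by simp; exact ⟨by linarith, by linarith, by linarith⟩⟩⟩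
  choose c hc using fun p : ι => ps_lim hU h1 p.1.1 p.1.2
  obtain ⟨⟨⟨m1, m2⟩, hm⟩, h⟩ := near_sup (fun j => - c j) (fun j => by
    have : 0 ≤ c j := by
      refine ge_of_tendsto (hc j) (Eventually.of_forall fun t => ?_)
      exact integral_nonneg fun x => (ps_mem j.2.2.1 _).1
    linarith) ε hε
  refine ⟨m1, m2, hm.1, hm.2.1, hm.2.2, fun l1 l2 a1 a2 a3 => ?_⟩
  have hl : I - δ < l1 ∧ l1 < l2 ∧ l2 < I := ⟨by linarith [hm.1, hm.2.1], a2, a3⟩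
  have hlt := h ⟨(l1, l2), hl⟩
  have := ((hc ⟨(m1, m2), hm⟩).sub (hc ⟨(l1, l2), hl⟩)).eventually_lt_const (u := ε) (by linarith)
  filter_upwards [this] with t ht
  rw [integral_sub (ps_int hU _ _ _) (ps_int hU _ _ _)]
  exact ht.le

lemma corr_bound (hU : Sys μ U M) (hφ : Continuous φ) {κ : T → ℝ} {ζ : Fin n → ℝ}
    (hm : Mode μ U φ κ ζ) {C : ℝ} (hC : ∀ x, |κ x| ≤ C) {I : ℝ}
    (hnd : ∀ δ, 0 < δ → ¬ ∃ α β : ℝ, ∀ l ∈ Ioo (I - δ) (I + δ), (∑ i, ζ i * φ l i) = α * l + β)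
    {ε m1 m2 p1 p2 : ℝ} (hIm : I < m1) (hm12 : m1 < m2) (hp12 : p1 < p2) (hpI : p2 < I)
    (hR : TailR μ U I ε m1 m2) (hL : TailL μ U I ε p1 p2) :
    ∃ K, ∀ b, 1 ≤ b → |∫ t in (1:ℝ)..b, W μ U (fun q =>
      (ps m1 m2 q.1 - 1 / 2) * (ps p1 p2 q.2.1 - 1 / 2) * κ q.2.2) t t| ≤ K + 4 * C * ε * b := by
  set f0 : ℝ → ℝ := fun l => ∑ i, ζ i * φ l i
  have hf0 : Continuous f0 := by fun_prop
  have hκ := hm.1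
  have hC0 : 0 ≤ C := (abs_nonneg _).trans (hC 0)
  set δ := min (m1 - I) (I - p2)
  have hδ : 0 < δ := lt_min (by linarith) (by linarith)
  have hδ1 : δ ≤ m1 - I := min_le_left _ _
  have hδ2 : δ ≤ I - p2 := min_le_right _ _
  obtain ⟨α, k1, k2, l1, l2, O, O', hk1, hk, hk2, hl1, hl, hl2, hgood⟩ := calculus hf0 hδ (hnd δ hδ)
  set f : ℝ → ℝ := fun l => f0 l - α * l
  have hf : Continuous f := by fun_prop
  obtain ⟨Cst, hCst⟩ := hm.bound hU hφ α k1 k2 l1 l2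
  set R := (f k2 - f k1) * (l2 - l1) - (k2 - k1) * (f l2 - f l1)
  have hRpos : 0 < |R| := hgood.2.2.2
  have ev := (hR ((I + k1) / 2) k1 (by linarith) (by linarith) (by linarith)).and
    (hL l2 ((I + l2) / 2) (by linarith) (by linarith) (by linarith))
  obtain ⟨t0, ht0⟩ := eventually_atTop.1 ev
  have c1 := ps_cont m1 m2
  have c2 := ps_cont p1 p2
  have c3 := ps_cont ((I + k1) / 2) k1
  have c4 := ps_cont l2 ((I + l2) / 2)
  have c5 := qs_cont hf k1 k2
  have c6 := qs_cont hf l1 l2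
  have c7 := eta_cont k1 k2
  have c8 := eta_cont l1 l2
  set hE : ℝ × ℝ × T → ℝ := fun q => κ q.2.2 * (qs f k1 k2 q.1 * eta l1 l2 q.2.1 - eta k1 k2 q.1 * qs f l1 l2 q.2.1)
  set hcor : ℝ × ℝ × T → ℝ := fun q => (ps m1 m2 q.1 - 1 / 2) * (ps p1 p2 q.2.1 - 1 / 2) * κ q.2.2
  have cE : Continuous hE := by fun_prop
  have ccor : Continuous hcor := by fun_prop
  have hpt : ∀ t, t0 ≤ t → |W μ U (fun q => hE q - R * hcor q) t t| ≤ 4 * C * |R| * ε := by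
    intro t ht
    have hle : ∀ q, |hE q - R * hcor q| ≤ (2 * C * |R|) * ((ps ((I + k1) / 2) k1 q.1 - ps m1 m2 q.1) +
        (ps p1 p2 q.2.1 - ps l2 ((I + l2) / 2) q.2.1)) := by
      intro q
      have r1 := approx_right (f := f) (l1 := (I + k1) / 2) (l2 := k1) (by linarith) le_rfl hk
        (show k2 ≤ m1 by linarith) hm12 hgood.1 q.1
      have r2 := approx_right (f := fun x => x) (O := k2 - k1) (l1 := (I + k1) / 2) (l2 := k1) (by linarith) le_rfl hk
        (show k2 ≤ m1 by linarith) hm12 (fun u hu => by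
          constructor <;> rw [abs_le] <;> constructor <;> linarith [hu.1, hu.2]) q.1
      have r3 := approx_left (f := f) (l1 := l2) (l2 := (I + l2) / 2) (by linarith) le_rfl hl
        (show p2 ≤ l1 by linarith) hp12 hgood.2.1 q.2.1
      have r4 := approx_left (f := fun x => x) (O := l2 - l1) (l1 := l2) (l2 := (I + l2) / 2) (by linarith) le_rfl hl
        (show p2 ≤ l1 by linarith) hp12 (fun u hu => by
          constructor <;> rw [abs_le] <;> constructor <;> linarith [hu.1, hu.2]) q.2.1
      rw [qs_id] at r2 r4
      have d1 := ps_anti (show (I + k1) / 2 < k1 by linarith) hm12 (show k1 ≤ m1 by linarith) q.1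
      have d2 := ps_anti hp12 (show l2 < (I + l2) / 2 by linarith) (show p2 ≤ l2 by linarith) q.2.1
      have := approx_bracket hk hl hm12 hp12 hgood (sub_nonneg.2 d1) (sub_nonneg.2 d2) r1 r2 r3 r4
      have e : hE q - R * hcor q = κ q.2.2 * ((qs f k1 k2 q.1 * eta l1 l2 q.2.1 - eta k1 k2 q.1 * qs f l1 l2 q.2.1) -
        R * ((ps m1 m2 q.1 - 1 / 2) * (ps p1 p2 q.2.1 - 1 / 2))) := by simp only [hE, hcor]; ring
      rw [e, abs_mul]
      refine (mul_le_mul (hC _) this (abs_nonneg _) hC0).trans (le_of_eq ?_)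
      ring
    refine (W_abs hU (by fun_prop) (by fun_prop) hle t t).trans ?_
    have e : W μ U (fun q => (2 * C * |R|) * ((ps ((I + k1) / 2) k1 q.1 - ps m1 m2 q.1) +
        (ps p1 p2 q.2.1 - ps l2 ((I + l2) / 2) q.2.1))) t t = (2 * C * |R|) *
        ((∫ x, (ps ((I + k1) / 2) k1 (U t x) - ps m1 m2 (U t x)) ∂μ) +
          ∫ x, (ps p1 p2 (U t x) - ps l2 ((I + l2) / 2) (U t x)) ∂μ) := by
      rw [← W_fst hU (fun a => ps ((I + k1) / 2) k1 a - ps m1 m2 a) (by fun_prop) t t,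
        ← W_snd hU (fun a => ps p1 p2 a - ps l2 ((I + l2) / 2) a) (by fun_prop) t t]
      unfold W
      rw [integral_const_mul, integral_add]
      · exact hU.integrable_h (fun q => ps ((I + k1) / 2) k1 q.1 - ps m1 m2 q.1) (by fun_prop) t t
      · exact hU.integrable_h (fun q => ps p1 p2 q.2.1 - ps l2 ((I + l2) / 2) q.2.1) (by fun_prop) t t
    rw [e]
    have := mul_le_mul_of_nonneg_left (add_le_add (ht0 t ht).1 (ht0 t ht).2)
      (show 0 ≤ 2 * C * |R| by positivity)
    linarith
  have hε : 0 ≤ 4 * C * |R| * ε := (abs_nonneg _).trans (hpt t0 le_rfl)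
  have hCε : 0 ≤ 4 * C * ε := by
    by_contra hcon
    have := mul_neg_of_neg_of_pos (not_le.1 hcon) hRpos
    linarith
  obtain ⟨S, hS0, hS⟩ := unif_bound _ (show Continuous (fun q => hE q - R * hcor q) by fun_prop) M
  have hWS : ∀ t, |W μ U (fun q => hE q - R * hcor q) t t| ≤ S := by
    intro t
    have := norm_integral_le_of_norm_le_const (μ := μ.prod μ)
      (f := fun p : T × T => hE (U t p.1, U t p.2, p.1 - p.2) - R * hcor (U t p.1, U t p.2, p.1 - p.2)) (C := S)
      (ae_of_all _ fun p => hS _ _ _ (hU.bdd _ _) (hU.bdd _ _))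
    simpa [W] using this
  set s0 := max t0 1
  have hs0 : 1 ≤ s0 := le_max_right _ _
  have herr : ∀ b, 1 ≤ b → |∫ t in (1:ℝ)..b, W μ U (fun q => hE q - R * hcor q) t t| ≤
      S * s0 + 4 * C * |R| * ε * b := by
    intro b hb
    have ii := fun (a b : ℝ) (ha : 0 < a) (hb : 0 < b) =>
      W_ii hU (h := fun q => hE q - R * hcor q) (by fun_prop) ha hb
    rcases le_total b s0 with hbs | hbs
    · have := intervalIntegral.norm_integral_le_of_norm_le_const (a := 1) (b := b)
        (f := fun t => W μ U (fun q => hE q - R * hcor q) t t) (C := S) (fun t _ => hWS t)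
      rw [abs_of_nonneg (by linarith), Real.norm_eq_abs] at this
      refine this.trans ?_
      have : S * (b - 1) ≤ S * s0 := mul_le_mul_of_nonneg_left (by linarith) hS0
      have := mul_nonneg hε (show 0 ≤ b by linarith)
      linarith
    · rw [← intervalIntegral.integral_add_adjacent_intervals (ii 1 s0 one_pos (by linarith))
        (ii s0 b (by linarith) (by linarith))]
      refine (abs_add_le _ _).trans (add_le_add ?_ ?_)
      · have := intervalIntegral.norm_integral_le_of_norm_le_const (a := 1) (b := s0)
          (f := fun t => W μ U (fun q => hE q - R * hcor q) t t) (C := S) (fun t _ => hWS t)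
        rw [abs_of_nonneg (by linarith), Real.norm_eq_abs] at this
        refine this.trans ?_
        exact mul_le_mul_of_nonneg_left (by linarith) hS0
      · have := intervalIntegral.norm_integral_le_of_norm_le_const (a := s0) (b := b)
          (f := fun t => W μ U (fun q => hE q - R * hcor q) t t) (C := 4 * C * |R| * ε) (fun t ht => by
            rw [uIoc_of_le hbs] at ht
            exact hpt t ((le_max_left _ _).trans ht.1.le))
        rw [abs_of_nonneg (show 0 ≤ b - s0 by linarith), Real.norm_eq_abs] at this
        refine this.trans ?_
        exact mul_le_mul_of_nonneg_left (by linarith) hε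
  refine ⟨(Cst + S * s0) / |R|, fun b hb => ?_⟩
  have h1 := hCst b hb
  have h2 := herr b hb
  have e : ∫ t in (1:ℝ)..b, W μ U (fun q => hE q - R * hcor q) t t =
      (∫ t in (1:ℝ)..b, W μ U hE t t) - R * ∫ t in (1:ℝ)..b, W μ U hcor t t := by
    rw [← intervalIntegral.integral_const_mul, ← intervalIntegral.integral_sub (W_ii hU cE one_pos (by linarith))
      ((W_ii hU ccor one_pos (by linarith)).const_mul _)]
    congr 1; ext t
    unfold W
    rw [← integral_const_mul, ← integral_sub (hU.integrable_h _ cE t t) ((hU.integrable_h _ ccor t t).const_mul _)]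
  rw [e] at h2
  have h3 : |R| * |∫ t in (1:ℝ)..b, W μ U hcor t t| ≤ Cst + (S * s0 + 4 * C * |R| * ε * b) := by
    rw [← abs_mul]
    have : R * ∫ t in (1:ℝ)..b, W μ U hcor t t = (∫ t in (1:ℝ)..b, W μ U hE t t) -
      ((∫ t in (1:ℝ)..b, W μ U hE t t) - R * ∫ t in (1:ℝ)..b, W μ U hcor t t) := by ring
    rw [this]
    exact (abs_sub _ _).trans (add_le_add h1 h2)
  rw [mul_comm, ← le_div_iff₀ hRpos] at h3
  refine h3.trans (le_of_eq ?_)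
  field_simp
  ring

end generic
end Decay
end PartE

section PartF
open MeasureTheory Filter Topology Set
set_option linter.unusedSectionVars false
set_option linter.unusedVariables false
namespace Decay

section generic
variable {T : Type} [AddCommGroup T] [TopologicalSpace T] [IsTopologicalAddGroup T]
  [CompactSpace T] [SecondCountableTopology T] [MeasurableSpace T] [BorelSpace T]
variable {μ : Measure T} [IsProbabilityMeasure μ] {U : ℝ → T → ℝ} {M : ℝ}

lemma W_add (hU : Sys μ U M) {h h' : ℝ × ℝ × T → ℝ} (hh : Continuous h) (hh' : Continuous h') (t s : ℝ) :
    W μ U (fun q => h q + h' q) t s = W μ U h t s + W μ U h' t s :=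
  integral_add (hU.integrable_h h hh t s) (hU.integrable_h h' hh' t s)

lemma W_smul (c : ℝ) (h : ℝ × ℝ × T → ℝ) (t s : ℝ) :
    W μ U (fun q => c * h q) t s = c * W μ U h t s := integral_const_mul _ _

lemma W_sum (hU : Sys μ U M) {ι : Type*} (S : Finset ι) {h : ι → ℝ × ℝ × T → ℝ}
    (hh : ∀ j ∈ S, Continuous (h j)) (t s : ℝ) :
    W μ U (fun q => ∑ j ∈ S, h j q) t s = ∑ j ∈ S, W μ U (h j) t s :=
  integral_finsetSum _ fun j hj => hU.integrable_h _ (hh j hj) t s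

lemma W_prod (g g' : ℝ → ℝ) (t s : ℝ) :
    W μ U (fun q => g q.1 * g' q.2.1) t s = (∫ x, g (U t x) ∂μ) * ∫ x, g' (U s x) ∂μ :=
  integral_prod_mul (μ := μ) (ν := μ) (fun x => g (U t x)) (fun x => g' (U s x))

variable [μ.IsAddLeftInvariant] [μ.IsNegInvariant]

lemma W_fst_ker (hU : Sys μ U M) {g : ℝ → ℝ} (hg : Continuous g) {κ : T → ℝ} (hκ : Continuous κ) (t s : ℝ) :
    W μ U (fun q => g q.1 * κ q.2.2) t s = (∫ x, g (U t x) ∂μ) * ∫ x, κ x ∂μ := by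
  rw [W_eq2 hU _ (by fun_prop)]
  simp only [integral_const_mul, integral_sub_left_eq_self κ μ, integral_mul_const]

lemma W_snd_ker (hU : Sys μ U M) {g : ℝ → ℝ} (hg : Continuous g) {κ : T → ℝ} (hκ : Continuous κ) (t s : ℝ) :
    W μ U (fun q => g q.2.1 * κ q.2.2) t s = (∫ x, g (U s x) ∂μ) * ∫ x, κ x ∂μ := by
  rw [W_eq1 hU _ (by fun_prop)]
  simp only [integral_const_mul, integral_sub_right_eq_self κ, integral_mul_const]

variable {n : ℕ} {φ : ℝ → Fin n → ℝ}

/-- existence of good kernels -/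
def HK (μ : Measure T) (U : ℝ → T → ℝ) (φ : ℝ → Fin n → ℝ) (I : ℝ) (ι : Type) : Prop :=
  ∀ ε, 0 < ε → ∃ (ρ : T → ℝ) (G : Fin n → T → ℝ) (r0 : ℝ) (S : Finset ι) (κ : ι → T → ℝ)
    (ζ : ι → Fin n → ℝ), Continuous ρ ∧ (∀ i, Continuous (G i)) ∧ (∀ x, 0 ≤ ρ x) ∧ 0 < r0 ∧
    Ker μ U φ ρ G ∧ W μ U (fun q => |q.1 - q.2.1| * ρ q.2.2) 1 1 ≤ ε * r0 ∧
    (∀ x, ρ x = r0 + ∑ j ∈ S, κ j x) ∧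
    ∀ j ∈ S, Mode μ U φ (κ j) (ζ j) ∧ ∫ x, κ j x ∂μ = 0 ∧
      ∀ δ, 0 < δ → ¬ ∃ α β : ℝ, ∀ l ∈ Ioo (I - δ) (I + δ), (∑ i, ζ j i * φ l i) = α * l + β

lemma lower (hU : Sys μ U M) {ρ : T → ℝ} (hρ : Continuous ρ) (hρ0 : ∀ x, 0 ≤ ρ x) {r0 : ℝ}
    (hr : ∫ x, ρ x ∂μ = r0) (hr0 : 0 < r0) {I a1 a2 m1 m2 p1 p2 : ℝ} (ha : a1 < a2) (hap : a2 ≤ p1) (hp : p1 < p2)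
    (hpI : p2 < I) (hIm : I < m1) (hm : m1 < m2) (t σ ε1 D : ℝ)
    (hw : σ ≤ ∫ x, ps m1 m2 (U t x) ∂μ) (hv : σ ≤ 1 - ∫ x, ps p1 p2 (U t x) ∂μ) (hσ : 0 ≤ σ)
    (hε1 : ∫ x, (ps a1 a2 (U t x) - ps p1 p2 (U t x)) ∂μ ≤ ε1)
    (hD : W μ U (fun q => |q.1 - q.2.1| * ρ q.2.2) t t ≤ D) :
    r0 * (σ ^ 2 - ε1) - D / (a2 - a1) ≤ W μ U (fun q =>
      (ps m1 m2 q.1 - 1 / 2) * (ps p1 p2 q.2.1 - 1 / 2) * (ρ q.2.2 - r0)) t t := by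
  have c1 := ps_cont m1 m2
  have c2 := ps_cont p1 p2
  have c3 := ps_cont a1 a2
  have hdp : 0 < a2 - a1 := by linarith
  have hle : ∀ q : ℝ × ℝ × T,
      ps m1 m2 q.1 * ρ q.2.2 + ((-1 / (a2 - a1)) * (|q.1 - q.2.1| * ρ q.2.2) +
      ((-1) * ((ps a1 a2 q.2.1 - ps p1 p2 q.2.1) * ρ q.2.2) +
      ((-r0) * (ps m1 m2 q.1 * ps p1 p2 q.2.1) +
      (((1 / 4 - 1 / 2 * ps m1 m2 q.1) * (ρ q.2.2 - r0)) +
       ((- 1 / 2 * ps p1 p2 q.2.1) * (ρ q.2.2 - r0)))))) ≤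
      (ps m1 m2 q.1 - 1 / 2) * (ps p1 p2 q.2.1 - 1 / 2) * (ρ q.2.2 - r0) := by
    rintro ⟨a, b, z⟩
    simp only
    have key : ps m1 m2 a - |a - b| / (a2 - a1) - (ps a1 a2 b - ps p1 p2 b) ≤ ps m1 m2 a * ps p1 p2 b := by
      have w := ps_mem hm a
      have v := ps_mem hp b
      have u := ps_mem ha b
      have uv := ps_anti ha hp hap b
      have lip := ps_lip ha a b
      rcases le_or_gt a m1 with h | h
      · rw [ps_left hm h]
        have : 0 ≤ |a - b| / (a2 - a1) := by positivity
        linarith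
      · rw [ps_right ha (show a2 ≤ a by linarith)] at lip
        have := (abs_le.1 lip).2
        have h2 : 0 ≤ |a - b| / (a2 - a1) := by positivity
        nlinarith [w.1, w.2, v.1, v.2, u.1, u.2]
    have := mul_le_mul_of_nonneg_right key (hρ0 z)
    have e : -1 / (a2 - a1) * (|a - b| * ρ z) = - (|a - b| / (a2 - a1)) * ρ z := by ring
    rw [e]
    linarith
  refine le_trans ?_ (W_mono hU (by fun_prop) (by fun_prop) hle t t)
  have hz : ∫ x, (ρ x - r0) ∂μ = 0 := by
    have hi : Integrable ρ μ := by
      have := hU.integrable1 (fun q => ρ q.2) (by fun_prop) t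
      exact this
    rw [integral_sub hi (integrable_const _), hr]; simp
  rw [W_add hU (by fun_prop) (by fun_prop), W_add hU (by fun_prop) (by fun_prop), W_add hU (by fun_prop) (by fun_prop),
    W_add hU (by fun_prop) (by fun_prop), W_add hU (by fun_prop) (by fun_prop), W_smul, W_smul, W_smul,
    W_fst_ker hU c1 hρ, W_snd_ker hU (g := fun a => ps a1 a2 a - ps p1 p2 a) (by fun_prop) hρ, W_prod,
    W_fst_ker hU (g := fun a => 1 / 4 - 1 / 2 * ps m1 m2 a) (κ := fun x => ρ x - r0) (by fun_prop) (by fun_prop),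
    W_snd_ker hU (g := fun a => -1 / 2 * ps p1 p2 a) (κ := fun x => ρ x - r0) (by fun_prop) (by fun_prop), hz, hr]
  set w := ∫ x, ps m1 m2 (U t x) ∂μ
  set v := ∫ x, ps p1 p2 (U t x) ∂μ
  have h1 : σ ^ 2 ≤ w * (1 - v) := by
    have := mul_le_mul hw hv hσ (hσ.trans hw)
    nlinarith
  have h2 := mul_le_mul_of_nonneg_left h1 hr0.le
  have h3 := mul_le_mul_of_nonneg_left hε1 hr0.le
  have h4 := div_le_div_of_nonneg_right hD hdp.le
  have e : ∀ X, -1 / (a2 - a1) * X = - (X / (a2 - a1)) := fun X => by ring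
  rw [e]
  linarith

theorem mk_tendsto (hU : Sys μ U M) (hφ : Continuous φ) (h1 : EntIneq μ U φ (fun _ => 1) (fun _ _ => 0))
    {I : ℝ} (hmean : ∀ t, 0 < t → ∫ x, U t x ∂μ = I) {ι : Type} (hHK : HK μ U φ I ι) :
    Tendsto (fun t => mk μ U I t) atTop (𝓝 0) := by
  by_contra hnot
  obtain ⟨G, hG, hGle⟩ : ∃ G, 0 < G ∧ ∀ t, 1 ≤ t → G ≤ mk μ U I t := by
    by_contra! hcon
    apply hnot
    rw [Metric.tendsto_atTop]
    intro ε hε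
    obtain ⟨t0, ht0, hlt⟩ := hcon ε hε
    refine ⟨t0, fun t ht => ?_⟩
    rw [Real.dist_eq, sub_zero, abs_of_nonneg (mk_nonneg _ _)]
    exact (mk_anti h1 I (by linarith) ht).trans_lt hlt
  have hid : ∀ t, Integrable (fun x => U t x) μ := fun t =>
    hU.integrable1 (fun q => q.1) (by fun_prop) t
  have hI : |I| ≤ M := by
    rw [← hmean 1 one_pos]
    have := norm_integral_le_of_norm_le_const (μ := μ) (f := fun x => U 1 x) (C := M)
      (ae_of_all _ fun x => hU.bdd _ _)
    simpa using this
  have hM : 0 < M := by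
    have := (hGle 1 le_rfl).trans (mk_le hU I 1)
    linarith
  set δ := G / 4 with hδ
  have hδ0 : 0 < δ := by positivity
  set σ := G / (8 * M) with hσ
  have hσ0 : 0 < σ := by positivity
  have hσM : 4 * M * σ = G / 2 := by rw [hσ]; field_simp; norm_num
  have habs : ∀ t, Integrable (fun x => |U t x - I|) μ := fun t =>
    hU.integrable1 (fun q => |q.1 - I|) (by fun_prop) t
  have hdiff : ∀ t, 0 < t → ∫ x, (U t x - I) ∂μ = 0 := fun t ht => by
    rw [integral_sub (hid t) (integrable_const _), hmean t ht]; simp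
  have hidI : ∀ t, Integrable (fun x => U t x - I) μ := fun t => (hid t).sub (integrable_const _)
  have hw : ∀ m1 m2, I < m1 → m1 < m2 → m2 < I + δ → ∀ t, 1 ≤ t → σ ≤ ∫ x, ps m1 m2 (U t x) ∂μ := by
    intro m1 m2 h2 h3 h4 t ht
    have hle : ∫ x, (|U t x - I| + (U t x - I)) ∂μ ≤ ∫ x, (2 * δ + 4 * M * ps m1 m2 (U t x)) ∂μ := by
      refine integral_mono ((habs t).add (hidI t)) ((integrable_const _).add ((ps_int hU _ _ t).const_mul _))
        fun x => ?_
      simp only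
      have hb := abs_le.1 (hU.bdd t x)
      have hi := abs_le.1 hI
      have := ps_mem h3 (U t x)
      rcases le_total (U t x) I with h | h
      · rw [abs_of_nonpos (by linarith)]; nlinarith
      · rw [abs_of_nonneg (by linarith)]
        rcases le_total (U t x) m2 with h' | h'
        · nlinarith
        · rw [ps_right h3 h']; linarith
    rw [integral_add (habs t) (hidI t), hdiff t (by linarith),
      integral_add (integrable_const _) ((ps_int hU _ _ t).const_mul _)] at hle
    simp only [integral_const, integral_const_mul, probReal_univ, smul_eq_mul, one_mul] at hle
    have := hGle t ht
    unfold mk at this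
    by_contra! hcon
    have := mul_lt_mul_of_pos_left hcon (show 0 < 4 * M by positivity)
    linarith
  have hv : ∀ m1 m2, I - δ < m1 → m1 < m2 → m2 < I → ∀ t, 1 ≤ t → σ ≤ 1 - ∫ x, ps m1 m2 (U t x) ∂μ := by
    intro m1 m2 h2 h3 h4 t ht
    have hle : ∫ x, (|U t x - I| - (U t x - I)) ∂μ ≤ ∫ x, ((2 * δ + 4 * M) - 4 * M * ps m1 m2 (U t x)) ∂μ := by
      refine integral_mono ((habs t).sub (hidI t)) ((integrable_const _).sub ((ps_int hU _ _ t).const_mul _))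
        fun x => ?_
      simp only
      have hb := abs_le.1 (hU.bdd t x)
      have hi := abs_le.1 hI
      have := ps_mem h3 (U t x)
      rcases le_total I (U t x) with h | h
      · rw [abs_of_nonneg (by linarith)]; nlinarith
      · rw [abs_of_nonpos (by linarith)]
        rcases le_total m1 (U t x) with h' | h'
        · nlinarith
        · rw [ps_left h3 h']; linarith
    rw [integral_sub (habs t) (hidI t), hdiff t (by linarith),
      integral_sub (integrable_const _) ((ps_int hU _ _ t).const_mul _)] at hle
    simp only [integral_const, integral_const_mul, probReal_univ, smul_eq_mul, one_mul] at hle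
    have := hGle t ht
    unfold mk at this
    by_contra! hcon
    have := mul_lt_mul_of_pos_left hcon (show 0 < 4 * M by positivity)
    linarith
  obtain ⟨a1, a2, ha1, ha, ha2, htail⟩ := exists_tailL hU h1 I δ (σ ^ 2 / 4) hδ0 (by positivity)
  obtain ⟨ρ, Gρ, r0, S, κ, ζ, hρ, hGρ, hρ0, hr0, hker, hD1, hsum, hmodes⟩ :=
    hHK ((a2 - a1) * (σ ^ 2 / 4)) (mul_pos (by linarith) (by positivity))
  have hκint : ∀ j ∈ S, Integrable (κ j) μ := fun j hj =>
    hU.integrable1 (fun q => κ j q.2) (by have := (hmodes j hj).1.1; fun_prop) 1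
  have hr : ∫ x, ρ x ∂μ = r0 := by
    simp only [hsum]
    rw [integral_add (integrable_const _) (integrable_finsetSum _ hκint), integral_finsetSum _ hκint,
      Finset.sum_eq_zero fun j hj => (hmodes j hj).2.1]
    simp
  have hCex : ∀ j ∈ S, ∃ C, ∀ x, |κ j x| ≤ C := fun j hj => by
    obtain ⟨C, -, hC⟩ := unif_bound1 (fun q : ℝ × T => κ j q.2) (by have := (hmodes j hj).1.1; fun_prop) 0
    exact ⟨C, fun x => hC 0 x (by simp)⟩
  choose! C hC using hCex
  have hCn : ∀ j ∈ S, 0 ≤ C j := fun j hj => (abs_nonneg _).trans (hC j hj 0)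
  set Ct := ∑ j ∈ S, C j with hCt
  have hCt0 : 0 ≤ Ct := Finset.sum_nonneg hCn
  set ε2 := r0 * σ ^ 2 / (16 * (Ct + 1)) with hε2
  have hε20 : 0 < ε2 := by positivity
  obtain ⟨m1, m2, hm1, hm, hm2, htR⟩ := exists_tailR hU h1 I δ ε2 hδ0 hε20
  obtain ⟨p1, p2, hp1, hp, hp2, htL⟩ := exists_tailL hU h1 I (I - a2) ε2 (by linarith) hε20
  have c1 := ps_cont m1 m2
  have c2 := ps_cont p1 p2
  obtain ⟨t0, ht0⟩ := eventually_atTop.1 (htail p1 p2 (by linarith) hp hp2)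
  set s0 := max t0 1 with hs0
  have hs01 : 1 ≤ s0 := le_max_right _ _
  set hH : ℝ × ℝ × T → ℝ := fun q => (ps m1 m2 q.1 - 1 / 2) * (ps p1 p2 q.2.1 - 1 / 2) * (ρ q.2.2 - r0)
  have cH : Continuous hH := by fun_prop
  have hlow : ∀ t, s0 ≤ t → r0 * (σ ^ 2 / 2) ≤ W μ U hH t t := by
    intro t ht
    have ht1 : 1 ≤ t := hs01.trans ht
    have := lower hU hρ hρ0 hr hr0 ha (show a2 ≤ p1 by linarith) hp hp2 hm1 hm t σ (σ ^ 2 / 4)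
      ((a2 - a1) * (σ ^ 2 / 4) * r0) (hw m1 m2 hm1 hm hm2 t ht1) (hv p1 p2 (by linarith) hp hp2 t ht1) hσ0.le
      (ht0 t ((le_max_left _ _).trans ht)) ((D_antitone hU hφ hρ hGρ hker one_pos ht1).trans hD1)
    refine le_trans (le_of_eq ?_) this
    have : a2 - a1 ≠ 0 := by linarith
    field_simp; ring
  choose! K hK using fun j (hj : j ∈ S) => corr_bound hU hφ (hmodes j hj).1 (hC j hj) (hmodes j hj).2.2 hm1 hm hp hp2
    htR htL
  have hupper : ∀ b, 1 ≤ b → ∫ t in (1:ℝ)..b, W μ U hH t t ≤ (∑ j ∈ S, K j) + 4 * Ct * ε2 * b := by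
    intro b hb
    have e : ∀ t, W μ U hH t t = ∑ j ∈ S, W μ U (fun q =>
        (ps m1 m2 q.1 - 1 / 2) * (ps p1 p2 q.2.1 - 1 / 2) * κ j q.2.2) t t := by
      intro t
      rw [← W_sum hU S (fun j hj => by have := (hmodes j hj).1.1; fun_prop)]
      congr 1; ext q
      simp only [hH, hsum, add_sub_cancel_left, Finset.mul_sum]
    simp only [e]
    rw [intervalIntegral.integral_finsetSum fun j hj =>
      W_ii hU (by have := (hmodes j hj).1.1; fun_prop) one_pos (by linarith)]
    calc _ ≤ ∑ j ∈ S, (K j + 4 * C j * ε2 * b) := Finset.sum_le_sum fun j hj =>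
            (le_abs_self _).trans (hK j hj b hb)
      _ = _ := by
        rw [Finset.sum_add_distrib, hCt, Finset.mul_sum, Finset.sum_mul, Finset.sum_mul]
  set A := ∫ t in (1:ℝ)..s0, W μ U hH t t
  have hfin : ∀ b, s0 ≤ b → A + r0 * (σ ^ 2 / 2) * (b - s0) ≤ (∑ j ∈ S, K j) + 4 * Ct * ε2 * b := by
    intro b hb
    refine le_trans ?_ (hupper b (hs01.trans hb))
    rw [← intervalIntegral.integral_add_adjacent_intervals (W_ii hU cH one_pos (by linarith : 0 < s0))
        (W_ii hU cH (by linarith) (by linarith : 0 < b))]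
    refine add_le_add le_rfl ?_
    have := intervalIntegral.integral_mono_on hb (intervalIntegrable_const (c := r0 * (σ ^ 2 / 2)) (μ := volume))
      (W_ii hU cH (by linarith) (by linarith : 0 < b)) (fun t ht => hlow t ht.1)
    rw [intervalIntegral.integral_const] at this
    simpa [mul_comm] using this
  have h4 : 4 * Ct * ε2 ≤ r0 * (σ ^ 2 / 4) := by
    rw [hε2]
    have : Ct / (Ct + 1) ≤ 1 := by rw [div_le_one (by linarith)]; linarith
    have h5 : 4 * Ct * (r0 * σ ^ 2 / (16 * (Ct + 1))) = (r0 * (σ ^ 2 / 4)) * (Ct / (Ct + 1)) := by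
      field_simp; ring
    rw [h5]
    exact mul_le_of_le_one_right (by positivity) this
  set c := r0 * (σ ^ 2 / 4) with hc
  have hc0 : 0 < c := by positivity
  have hbig := hfin (s0 + max 0 ((∑ j ∈ S, K j) - A + c * s0 + 1) / c) (by
    have : 0 ≤ max 0 ((∑ j ∈ S, K j) - A + c * s0 + 1) / c := by positivity
    linarith)
  set X := max 0 ((∑ j ∈ S, K j) - A + c * s0 + 1)
  have hX : (∑ j ∈ S, K j) - A + c * s0 + 1 ≤ X := le_max_right _ _
  have hX0 : 0 ≤ X := le_max_left _ _
  have h6 : 4 * Ct * ε2 * (s0 + X / c) ≤ c * (s0 + X / c) :=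
    mul_le_mul_of_nonneg_right h4 (by positivity)
  have h7 : c * (X / c) = X := by field_simp
  have h8 : r0 * (σ ^ 2 / 2) * (s0 + X / c - s0) = 2 * (c * (X / c)) := by rw [hc]; ring
  rw [h8, h7] at hbig
  have h9 : c * (s0 + X / c) = c * s0 + X := by rw [mul_add, h7]
  linarith

end generic
end Decay
end PartF

section PartG
open MeasureTheory Filter Topology Set
set_option linter.unusedSectionVars false
set_option linter.unusedVariables false
namespace Decay

abbrev Tor (n : ℕ) := Fin n → UnitAddCircle

instance torProb (n : ℕ) : IsProbabilityMeasure (volume : Measure (Tor n)) :=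
  ⟨by rw [volume_pi, Measure.pi_univ]; simp⟩

instance torNeg (n : ℕ) : (volume : Measure (Tor n)).IsNegInvariant :=
  Measure.IsAddHaarMeasure.isNegInvariant_of_regular _

/-- projection to the torus -/
def prj {n : ℕ} (x : Fin n → ℝ) : Tor n := fun i => (x i : UnitAddCircle)

lemma prj_cont {n : ℕ} : Continuous (prj (n := n)) :=
  continuous_pi fun i => (AddCircle.continuous_mk' 1).comp (continuous_apply i)

lemma prj_surj {n : ℕ} (y : Tor n) : ∃ x, prj x = y := by
  choose x hx using fun i => QuotientAddGroup.mk_surjective (y i)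
  exact ⟨x, funext hx⟩

lemma prj_add {n : ℕ} (x y : Fin n → ℝ) : prj (x + y) = prj x + prj y := by
  funext i; simp [prj]

lemma prj_sub {n : ℕ} (x y : Fin n → ℝ) : prj (x - y) = prj x - prj y := by
  funext i; simp [prj]

/-- linear functional with given coefficients -/
noncomputable def lin {n : ℕ} (a : Fin n → ℝ) : (Fin n → ℝ) →L[ℝ] ℝ :=
  ∑ i, a i • ContinuousLinearMap.proj (R := ℝ) (φ := fun _ : Fin n => ℝ) i

lemma lin_apply {n : ℕ} (a v : Fin n → ℝ) : lin a v = ∑ i, a i * v i := by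
  simp [lin]

structure IsTest {n : ℕ} (g : Tor n → ℝ) (G : Fin n → Tor n → ℝ) : Prop where
  nonneg : ∀ x, 0 ≤ g x
  cont : Continuous g
  contG : ∀ i, Continuous (G i)
  deriv : ∀ x : Fin n → ℝ, HasFDerivAt (fun y => g (prj y)) (lin fun i => G i (prj x)) x

variable {n : ℕ}

lemma IsTest.shift {g : Tor n → ℝ} {G} (h : IsTest g G) (y : Tor n) :
    IsTest (fun x => g (x - y)) (fun i x => G i (x - y)) := by
  obtain ⟨y, rfl⟩ := prj_surj y
  refine ⟨fun x => h.nonneg _, h.cont.comp (by fun_prop), fun i => (h.contG i).comp (by fun_prop), fun x => ?_⟩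
  have := (h.deriv (x - y)).comp x ((hasFDerivAt_id x).sub_const y)
  simp only [← prj_sub]
  simpa [Function.comp_def] using this

lemma IsTest.refl {g : Tor n → ℝ} {G} (h : IsTest g G) (x : Tor n) :
    IsTest (fun y => g (x - y)) (fun i y => - G i (x - y)) := by
  obtain ⟨x, rfl⟩ := prj_surj x
  refine ⟨fun x => h.nonneg _, h.cont.comp (by fun_prop), fun i => ((h.contG i).comp (by fun_prop)).neg, fun y => ?_⟩
  have := (h.deriv (x - y)).comp y ((hasFDerivAt_id y).const_sub x)
  simp only [← prj_sub]
  refine HasFDerivAt.congr_fderiv this ?_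
  ext v
  simp [lin_apply]

lemma IsTest.ker {U : ℝ → Tor n → ℝ} {φ : ℝ → Fin n → ℝ}
    (H : ∀ g G, IsTest g G → EntIneq volume U φ g G) {g : Tor n → ℝ} {G} (h : IsTest g G) :
    Ker volume U φ g G := ⟨fun y => H _ _ (h.shift y), fun x => H _ _ (h.refl x)⟩

open UnitAddTorus in
/-- real modes -/
noncomputable def kap (ξ : Fin n → ℤ) (c : ℂ) (z : Tor n) : ℝ := (c * mFourier ξ z).re

lemma kap_cont (ξ : Fin n → ℤ) (c : ℂ) : Continuous (kap ξ c) :=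
  Complex.continuous_re.comp (continuous_const.mul (ContinuousMap.continuous _))

lemma kap_prj (ξ : Fin n → ℤ) (c : ℂ) (y : Fin n → ℝ) :
    kap ξ c (prj y) = (c * Complex.exp (2 * Real.pi * Complex.I * ((∑ i, (ξ i : ℝ) * y i : ℝ) : ℂ))).re := by
  unfold kap UnitAddTorus.mFourier prj
  simp only [ContinuousMap.coe_mk, fourier_coe_apply]
  rw [← Complex.exp_sum]
  congr 4
  push_cast
  rw [Finset.mul_sum]
  exact Finset.sum_congr rfl fun i _ => by ring

lemma kap_deriv (ξ : Fin n → ℤ) (c : ℂ) (x : Fin n → ℝ) :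
    HasFDerivAt (fun y => kap ξ c (prj y))
      (lin fun i => (ξ i : ℝ) * kap ξ (2 * Real.pi * Complex.I * c) (prj x)) x := by
  simp only [kap_prj]
  have h1 : HasFDerivAt (fun y : Fin n → ℝ => ∑ i, (ξ i : ℝ) * y i) (lin fun i => (ξ i : ℝ)) x := by
    have := (lin fun i => (ξ i : ℝ)).hasFDerivAt (x := x)
    have e : (fun y : Fin n → ℝ => ∑ i, (ξ i : ℝ) * y i) = ⇑(lin fun i => (ξ i : ℝ)) := by
      funext y; rw [lin_apply]
    rw [e]; exact this
  have h2 : ∀ s : ℝ, HasDerivAt (fun s : ℝ => (c * Complex.exp (2 * Real.pi * Complex.I * (s : ℂ))).re)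
      (2 * Real.pi * Complex.I * c * Complex.exp (2 * Real.pi * Complex.I * (s : ℂ))).re s := by
    intro s
    have : HasDerivAt (fun s : ℂ => c * Complex.exp (2 * Real.pi * Complex.I * s))
      (2 * Real.pi * Complex.I * c * Complex.exp (2 * Real.pi * Complex.I * (s : ℂ))) (s:ℂ) := by
      have := (((hasDerivAt_id (s:ℂ)).const_mul (2 * Real.pi * Complex.I)).cexp).const_mul c
      refine this.congr_deriv ?_
      simp only [id]
      ring
    exact this.real_of_complex
  have := (h2 _).comp_hasFDerivAt x h1
  refine HasFDerivAt.congr_fderiv this ?_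
  ext v
  simp only [smul_apply, lin_apply, smul_eq_mul, Finset.mul_sum]
  exact Finset.sum_congr rfl fun i _ => by ring

lemma kap_bound (ξ : Fin n → ℤ) (c : ℂ) (z : Tor n) : |kap ξ c z| ≤ ‖c‖ := by
  refine (Complex.abs_re_le_norm _).trans ?_
  rw [norm_mul]
  have : ‖UnitAddTorus.mFourier ξ z‖ ≤ 1 := by
    exact (ContinuousMap.norm_coe_le_norm _ _).trans UnitAddTorus.mFourier_norm.le
  nlinarith [norm_nonneg c]

lemma kap_integral {ξ : Fin n → ℤ} (hξ : ξ ≠ 0) (c : ℂ) : ∫ z, kap ξ c z = 0 := by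
  obtain ⟨i, hi⟩ := Function.ne_iff.mp hξ
  have hi' : (ξ i : ℝ) ≠ 0 := by exact_mod_cast hi
  have key : ∀ z, kap ξ c (prj (Pi.single i (1 / 2 / (ξ i : ℝ))) + z) = - kap ξ c z := by
    intro z
    obtain ⟨z, rfl⟩ := prj_surj z
    rw [← prj_add, kap_prj, kap_prj]
    have : ∑ j, (ξ j : ℝ) * ((Pi.single i (1 / 2 / (ξ i : ℝ)) + z : Fin n → ℝ) j) = 1/2 + ∑ j, (ξ j : ℝ) * z j := by
      simp only [Pi.add_apply, mul_add, Finset.sum_add_distrib]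
      congr 1
      rw [Finset.sum_eq_single i]
      · simp; field_simp
      · intro j _ hj; simp [hj]
      · simp
    rw [this]
    push_cast
    rw [mul_add, Complex.exp_add, show 2 * (Real.pi:ℂ) * Complex.I * (1/2) = Real.pi * Complex.I by ring, Complex.exp_pi_mul_I]
    simp
  have h := integral_add_left_eq_self (μ := (volume : Measure (Tor n))) (kap ξ c) (prj (Pi.single i (1 / 2 / (ξ i : ℝ))))
  simp only [key, integral_neg] at h
  linarith

lemma lin_add (a b : Fin n → ℝ) : lin a + lin b = lin (fun i => a i + b i) := by
  ext v; simp [lin_apply, add_mul, Finset.sum_add_distrib]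

lemma kap_mode {U : ℝ → Tor n → ℝ} {φ : ℝ → Fin n → ℝ}
    (H : ∀ g G, IsTest g G → EntIneq volume U φ g G) (ξ : Fin n → ℤ) (c : ℂ) :
    Mode volume U φ (kap ξ c) (fun i => (ξ i : ℝ)) := by
  set c' : ℂ := c / (2 * Real.pi * Complex.I) with hc'
  have hcc : 2 * Real.pi * Complex.I * c' = c := by
    rw [hc']; field_simp [Complex.I_ne_zero, Real.pi_ne_zero]
  refine ⟨kap_cont _ _, kap ξ c', ‖c'‖, kap_cont _ _, IsTest.ker H ⟨?_, ?_, ?_, ?_⟩, IsTest.ker H ⟨?_, ?_, ?_, ?_⟩⟩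
  · intro x; have := abs_le.1 (kap_bound ξ c' x); linarith
  · exact continuous_const.add (kap_cont _ _)
  · exact fun i => continuous_const.mul (kap_cont _ _)
  · intro x
    have := (kap_deriv ξ c' x).const_add ‖c'‖
    rwa [hcc] at this
  · intro x; have := abs_le.1 (kap_bound ξ c' x); linarith
  · exact continuous_const.sub (kap_cont _ _)
  · exact fun i => (continuous_const.mul (kap_cont _ _)).neg
  · intro x
    have := (kap_deriv ξ c' x).const_sub ‖c'‖
    rw [hcc] at this
    refine this.congr_fderiv ?_
    ext v; simp [lin_apply]

lemma HK_torus {U : ℝ → Tor n → ℝ} {M : ℝ} (hU : Sys volume U M) {φ : ℝ → Fin n → ℝ} {I : ℝ}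
    (H : ∀ g G, IsTest g G → EntIneq volume U φ g G)
    (hnd : ∀ ξ : Fin n → ℤ, ξ ≠ 0 → ∀ δ : ℝ, 0 < δ →
      ¬ ∃ α β : ℝ, ∀ l ∈ Ioo (I - δ) (I + δ), ∑ i, (ξ i : ℝ) * φ l i = α * l + β) :
    HK volume U φ I (Fin n → ℤ) := by
  intro ε hε
  have hM : 0 ≤ M := (abs_nonneg _).trans (hU.bdd 0 0)
  have hf : Integrable (fun x => U 1 x) (volume : Measure (Tor n)) := hU.integrable1 (h := fun p => p.1) (by fun_prop) 1
  obtain ⟨h, -, hh, hhc, hhi⟩ := hf.exists_hasCompactSupport_integral_sub_le (ε := ε / 8) (by linarith)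
  have huc := CompactSpace.uniformContinuous_of_continuous hhc
  obtain ⟨r, hr, hr'⟩ := Metric.uniformContinuous_iff.1 huc (ε / 8) (by linarith)
  set χ : Tor n → ℝ := fun z => max 0 (r - ‖z‖) with hχ
  have hχc : Continuous χ := by fun_prop
  have hχ0 : ∀ z, 0 ≤ χ z := fun z => le_max_left _ _
  have hχI : Integrable χ (volume : Measure (Tor n)) :=
    hχc.integrable_of_hasCompactSupport (HasCompactSupport.of_compactSpace _)
  set c0 : ℝ := ∫ z, χ z with hc0
  have hc0p : 0 < c0 := hχc.integral_pos_of_hasCompactSupport_nonneg_nonzero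
    (HasCompactSupport.of_compactSpace _) hχ0 (x := 0) (by simp [hχ, hr.ne', hr.le])
  set δ : ℝ := c0 * ε / (8 * (M + 1)) with hδ
  have hδp : 0 < δ := by positivity
  have hδM : 4 * M * δ ≤ c0 * ε / 2 := by
    rw [hδ, mul_div_assoc', div_le_iff₀ (by positivity)]
    nlinarith [mul_pos hc0p hε]
  set χC : C(Tor n, ℂ) := ⟨fun z => (χ z : ℂ), by fun_prop⟩ with hχC
  have hmem : χC ∈ closure ((Submodule.span ℂ (range (UnitAddTorus.mFourier (d := Fin n))) : Submodule ℂ C(Tor n, ℂ)) : Set C(Tor n, ℂ)) := by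
    rw [← Submodule.topologicalClosure_coe, UnitAddTorus.span_mFourier_closure_eq_top]; trivial
  obtain ⟨P, hP, hPd⟩ := Metric.mem_closure_iff.1 hmem δ hδp
  obtain ⟨c, hc⟩ := Finsupp.mem_span_range_iff_exists_finsupp.1 hP
  have hPx : ∀ x, (P x).re = ∑ j ∈ c.support, kap j (c j) x := by
    intro x
    rw [← hc, Finsupp.sum]
    simp [ContinuousMap.sum_apply, kap]
  have hclose : ∀ x, |χ x - (P x).re| ≤ δ := by
    intro x
    have h1 : dist (χC x) (P x) ≤ δ := (ContinuousMap.dist_apply_le_dist x).trans hPd.le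
    rw [dist_eq_norm] at h1
    have h2 := (Complex.abs_re_le_norm (χC x - P x)).trans h1
    simpa [hχC] using h2
  set S := c.support.erase 0 with hS
  set r0 : ℝ := (c 0).re + δ with hr0
  set ρ : Tor n → ℝ := fun x => δ + (P x).re with hρ
  have hρe : ∀ x, ρ x = r0 + ∑ j ∈ S, kap j (c j) x := by
    intro x
    have h0 : kap 0 (c 0) x = (c 0).re := by simp [kap, UnitAddTorus.mFourier_zero]
    have : ∑ j ∈ c.support, kap j (c j) x = kap 0 (c 0) x + ∑ j ∈ S, kap j (c j) x := by
      by_cases h : (0 : Fin n → ℤ) ∈ c.support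
      · rw [hS]; exact (Finset.add_sum_erase _ (fun j => kap j (c j) x) h).symm
      · rw [hS, Finset.erase_eq_of_notMem h, h0, Finsupp.notMem_support_iff.1 h]; simp
    simp only [hρ, hPx, this, h0, hr0]; ring
  have hρc : Continuous ρ := by
    have : Continuous fun x => P x := P.continuous
    simp only [hρ]; fun_prop
  have hρ1 : ∀ x, χ x ≤ ρ x := fun x => by have := abs_le.1 (hclose x); simp only [hρ]; linarith
  have hρ2 : ∀ x, ρ x ≤ χ x + 2 * δ := fun x => by have := abs_le.1 (hclose x); simp only [hρ]; linarith
  have hS0 : ∀ j ∈ S, j ≠ 0 := fun j hj => (Finset.mem_erase.1 hj).1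
  have hkI : ∀ j ξ, Integrable (kap j ξ) (volume : Measure (Tor n)) := fun j ξ =>
    (kap_cont j ξ).integrable_of_hasCompactSupport (HasCompactSupport.of_compactSpace _)
  have hρI : ∫ x, ρ x = r0 := by
    simp only [hρe]
    rw [integral_add (integrable_const _) (integrable_finsetSum _ fun j _ => hkI _ _),
      integral_finsetSum _ fun j _ => hkI _ _, Finset.sum_eq_zero fun j hj => kap_integral (hS0 j hj) _]
    simp
  have hρint : Integrable ρ (volume : Measure (Tor n)) :=
    hρc.integrable_of_hasCompactSupport (HasCompactSupport.of_compactSpace _)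
  have hr0c : c0 ≤ r0 := by rw [← hρI]; exact integral_mono hχI hρint hρ1
  refine ⟨ρ, fun i x => ∑ j ∈ c.support, (j i : ℝ) * kap j (2 * Real.pi * Complex.I * c j) x, r0, S,
    fun j => kap j (c j), fun j i => (j i : ℝ), hρc, ?_, fun x => (hχ0 x).trans (hρ1 x),
    hc0p.trans_le hr0c, ?_, ?_, hρe, fun j hj => ⟨kap_mode H _ _, kap_integral (hS0 j hj) _, hnd j (hS0 j hj)⟩⟩
  · intro i
    exact continuous_finsetSum _ fun j _ => continuous_const.mul (kap_cont _ _)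
  · refine IsTest.ker H ⟨fun x => (hχ0 x).trans (hρ1 x), hρc, fun i => continuous_finsetSum _ fun j _ => continuous_const.mul (kap_cont _ _), fun x => ?_⟩
    have := (HasFDerivAt.fun_sum (u := c.support) fun j _ => kap_deriv j (c j) x).const_add δ
    simp only [hρ, hPx]
    refine this.congr_fderiv ?_
    ext v
    simp only [sum_apply, lin_apply]
    rw [Finset.sum_comm]
    exact Finset.sum_congr rfl fun i _ => by rw [Finset.sum_mul]
  · have hX : Integrable (fun x => |U 1 x - h x|) (volume : Measure (Tor n)) := (hf.sub hhi).abs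
    have hcomp : ∀ g : Tor n → ℝ, Integrable g (volume : Measure (Tor n)) →
        Integrable (fun p : Tor n × Tor n => g p.1 * χ (p.1 - p.2)) (volume.prod volume) ∧
        ∫ p : Tor n × Tor n, g p.1 * χ (p.1 - p.2) ∂(volume.prod volume) = (∫ x, g x) * c0 := by
      intro g hg
      have hi : Integrable (fun p : Tor n × Tor n => g p.1 * χ (p.1 - p.2)) (volume.prod volume) := by
        refine (hg.comp_fst volume).mul_bdd (c := r) ?_ ?_
        · exact (hχc.comp (by fun_prop : Continuous fun p : Tor n × Tor n => p.1 - p.2)).aestronglyMeasurable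
        · refine Eventually.of_forall fun p => ?_
          rw [Real.norm_of_nonneg (hχ0 _)]
          exact max_le hr.le (by linarith [norm_nonneg (p.1 - p.2)])
      refine ⟨hi, ?_⟩
      rw [integral_prod _ hi]
      simp only [integral_const_mul, integral_sub_left_eq_self χ volume, integral_mul_const, ← hc0]
    have hcomp2 : ∀ g : Tor n → ℝ, Integrable g (volume : Measure (Tor n)) →
        Integrable (fun p : Tor n × Tor n => g p.2 * χ (p.1 - p.2)) (volume.prod volume) ∧
        ∫ p : Tor n × Tor n, g p.2 * χ (p.1 - p.2) ∂(volume.prod volume) = (∫ x, g x) * c0 := by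
      intro g hg
      have hχn : ∀ z, χ (-z) = χ z := fun z => by simp [hχ]
      have h1 := hcomp g hg
      have e : (fun p : Tor n × Tor n => g p.2 * χ (p.1 - p.2)) = (fun p : Tor n × Tor n => g p.1 * χ (p.1 - p.2)) ∘ Prod.swap := by
        funext p; simp only [Function.comp, Prod.fst_swap, Prod.snd_swap]; rw [← hχn, neg_sub]
      rw [e]
      exact ⟨h1.1.swap, (integral_prod_swap (fun p : Tor n × Tor n => g p.1 * χ (p.1 - p.2))).trans h1.2⟩
    obtain ⟨i1, e1⟩ := hcomp _ hX
    obtain ⟨i2, e2⟩ := hcomp2 _ hX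
    obtain ⟨i3, e3⟩ := hcomp _ (integrable_const (ε / 8))
    have hW : W volume U (fun q => |q.1 - q.2.1| * ρ q.2.2) 1 1 ≤
        ∫ p : Tor n × Tor n, ((|U 1 p.1 - h p.1| * χ (p.1 - p.2) + |U 1 p.2 - h p.2| * χ (p.1 - p.2)
          + ε / 8 * χ (p.1 - p.2)) + 4 * M * δ) ∂(volume.prod volume) := by
      refine integral_mono (hU.integrable_h (fun q => |q.1 - q.2.1| * ρ q.2.2) (by fun_prop) 1 1) (((i1.add i2).add i3).add (integrable_const _)) fun p => ?_
      simp only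
      have hb1 := abs_le.1 (hU.bdd 1 p.1)
      have hb2 := abs_le.1 (hU.bdd 1 p.2)
      have hb : |U 1 p.1 - U 1 p.2| ≤ 2 * M := abs_le.2 ⟨by linarith, by linarith⟩
      have s1 : |U 1 p.1 - U 1 p.2| * ρ (p.1 - p.2) ≤ |U 1 p.1 - U 1 p.2| * χ (p.1 - p.2) + 4 * M * δ := by
        have := mul_le_mul_of_nonneg_left (hρ2 (p.1 - p.2)) (abs_nonneg (U 1 p.1 - U 1 p.2))
        nlinarith
      have s2 : |U 1 p.1 - U 1 p.2| * χ (p.1 - p.2) ≤ (|U 1 p.1 - h p.1| + |U 1 p.2 - h p.2| + ε / 8) * χ (p.1 - p.2) := by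
        by_cases hz : ‖p.1 - p.2‖ < r
        · have hd := hr' (a := p.1) (b := p.2) (by rwa [dist_eq_norm])
          rw [Real.dist_eq] at hd
          refine mul_le_mul_of_nonneg_right ?_ (hχ0 _)
          have t1 := abs_le.1 (le_refl |U 1 p.1 - h p.1|)
          have t2 := abs_le.1 (le_refl |U 1 p.2 - h p.2|)
          have t3 := abs_lt.1 hd
          exact abs_le.2 ⟨by linarith, by linarith⟩
        · have : χ (p.1 - p.2) = 0 := max_eq_left (by linarith)
          rw [this]; simp
      linarith
    refine hW.trans ?_
    have hE : ∫ p : Tor n × Tor n, ((|U 1 p.1 - h p.1| * χ (p.1 - p.2) + |U 1 p.2 - h p.2| * χ (p.1 - p.2)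
          + ε / 8 * χ (p.1 - p.2)) + 4 * M * δ) ∂(volume.prod volume)
        = (∫ x, |U 1 x - h x|) * c0 + (∫ x, |U 1 x - h x|) * c0 + ε / 8 * c0 + 4 * M * δ := by
      refine (integral_add ((i1.add i2).add i3) (integrable_const _)).trans ?_
      congr 1
      · refine (integral_add (i1.add i2) i3).trans ?_
        congr 1
        · exact (integral_add i1 i2).trans (by rw [e1, e2])
        · rw [e3]; simp
      · simp
    rw [hE]
    simp only [Real.norm_eq_abs] at hh
    nlinarith [mul_le_mul_of_nonneg_right hh hc0p.le, mul_le_mul_of_nonneg_left hr0c hε.le, mul_pos hc0p hε]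

end Decay
end PartG

section PartH
open MeasureTheory Filter Topology Set
set_option linter.unusedSectionVars false
set_option linter.unusedVariables false
namespace Decay

lemma step_props {ε : ℝ} (hε : 0 < ε) :
    ∃ Θ Θ' : ℝ → ℝ, ContDiff ℝ 1 Θ ∧ (∀ t, HasDerivAt Θ (Θ' t) t) ∧ Continuous Θ' ∧ (∀ t, 0 ≤ Θ' t) ∧
      Monotone Θ ∧ (∀ t, t ≤ 0 → Θ t = 0) ∧ (∀ t, ε ≤ t → Θ t = 1) ∧
      (∀ t, t ∉ Icc 0 ε → Θ' t = 0) ∧ (∀ t, 0 ≤ Θ t ∧ Θ t ≤ 1) ∧ Integrable Θ' ∧ ∫ t, Θ' t = 1 := by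
  set Θ : ℝ → ℝ := fun t => Real.smoothTransition (t / ε) with hΘ
  have hcd : ContDiff ℝ 1 Θ := Real.smoothTransition.contDiff.comp (contDiff_id.div_const ε)
  have hd : ∀ t, HasDerivAt Θ (deriv Θ t) t := fun t =>
    (hcd.differentiable (by norm_num) t).hasDerivAt
  have hc : Continuous (deriv Θ) := hcd.continuous_deriv (by norm_num)
  have hm : Monotone Θ := by
    intro a b hab
    exact Real.smoothTransition.monotone (div_le_div_of_nonneg_right hab hε.le)
  have h0 : ∀ t, t ≤ 0 → Θ t = 0 := fun t ht => Real.smoothTransition.zero_of_nonpos (div_nonpos_of_nonpos_of_nonneg ht hε.le)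
  have h1 : ∀ t, ε ≤ t → Θ t = 1 := fun t ht => Real.smoothTransition.one_of_one_le (by rwa [le_div_iff₀ hε, one_mul])
  have hz : ∀ t, t ∉ Icc 0 ε → deriv Θ t = 0 := by
    intro t ht
    rw [mem_Icc, not_and_or, not_le, not_le] at ht
    rcases ht with ht | ht
    · have : Θ =ᶠ[𝓝 t] fun _ => 0 := by
        filter_upwards [Iio_mem_nhds ht] with s hs using h0 s (le_of_lt hs)
      rw [this.deriv_eq]; simp
    · have : Θ =ᶠ[𝓝 t] fun _ => 1 := by
        filter_upwards [Ioi_mem_nhds ht] with s hs using h1 s (le_of_lt hs)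
      rw [this.deriv_eq]; simp
  have hcs : HasCompactSupport (deriv Θ) := HasCompactSupport.intro isCompact_Icc hz
  refine ⟨Θ, deriv Θ, hcd, hd, hc, fun t => hm.deriv_nonneg, hm, h0, h1, hz,
    fun t => ⟨Real.smoothTransition.nonneg _, Real.smoothTransition.le_one _⟩,
    hc.integrable_of_hasCompactSupport hcs, ?_⟩
  have : ∫ t, deriv Θ t = ∫ t in (0:ℝ)..ε, deriv Θ t := by
    rw [intervalIntegral.integral_of_le hε.le, ← integral_Icc_eq_integral_Ioc]
    exact (setIntegral_eq_integral_of_forall_compl_eq_zero hz).symm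
  rw [this, intervalIntegral.integral_eq_sub_of_hasDerivAt (fun t _ => hd t) (hc.intervalIntegrable _ _),
    h0 0 le_rfl, h1 ε le_rfl]
  simp

lemma one_dim {A Bf : ℝ → ℝ} {C : ℝ} (hA : ContinuousOn A (Ioi 0)) (hAm : AEStronglyMeasurable A)
    (hBm : AEStronglyMeasurable Bf) (hAb : ∀ t, |A t| ≤ C) (hBb : ∀ t, |Bf t| ≤ C)
    (H : ∀ θ θ' : ℝ → ℝ, ContDiff ℝ 1 θ → (∀ t, HasDerivAt θ (θ' t) t) → Continuous θ' →
      (∀ t, 0 ≤ θ t) → (∃ a b, 0 < a ∧ (∀ t, t ∉ Icc a b → θ t = 0 ∧ θ' t = 0)) →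
      0 ≤ ∫ t, (θ' t * A t + θ t * Bf t)) {t1 t2 : ℝ} (h1 : 0 < t1) (h12 : t1 ≤ t2) :
    A t2 - A t1 ≤ ∫ t in t1..t2, Bf t := by
  rcases h12.eq_or_lt with rfl | h12
  · simp
  have hC : 0 ≤ C := (abs_nonneg _).trans (hAb 0)
  refine le_of_forall_pos_le_add fun r hr => ?_
  have h2 : 0 < t2 := h1.trans h12
  have c1 := Metric.continuousAt_iff.1 (hA.continuousAt (Ioi_mem_nhds h1)) (r / 4) (by linarith)
  have c2 := Metric.continuousAt_iff.1 (hA.continuousAt (Ioi_mem_nhds h2)) (r / 4) (by linarith)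
  obtain ⟨d1, hd1, c1⟩ := c1
  obtain ⟨d2, hd2, c2⟩ := c2
  obtain ⟨ε, hε, e1, e2, e3, e4⟩ : ∃ ε : ℝ, 0 < ε ∧ ε < d1 ∧ ε < d2 ∧ ε ≤ t2 - t1 ∧ 2 * C * ε ≤ r / 2 := by
    refine ⟨min (min (d1 / 2) (d2 / 2)) (min (t2 - t1) (r / (4 * (C + 1)))), ?_, ?_, ?_, ?_, ?_⟩
    · have : 0 < t2 - t1 := by linarith
      positivity
    · exact ((min_le_left _ _).trans (min_le_left _ _)).trans_lt (by linarith)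
    · exact ((min_le_left _ _).trans (min_le_right _ _)).trans_lt (by linarith)
    · exact ((min_le_right _ _).trans (min_le_left _ _))
    · have := ((min_le_right (min (d1 / 2) (d2 / 2)) (min (t2 - t1) (r / (4 * (C + 1))))).trans (min_le_right _ _))
      have h3 : 2 * C * (r / (4 * (C + 1))) ≤ r / 2 := by
        rw [mul_div_assoc', div_le_iff₀ (by positivity)]; nlinarith
      nlinarith
  obtain ⟨Θ, Θ', hcd, hd, hc, hnn, hm, z0, z1, hz, h01, hI, hI1⟩ := step_props hε
  have key := H (fun t => Θ (t - t1) - Θ (t - t2)) (fun t => Θ' (t - t1) - Θ' (t - t2))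
    ((hcd.comp (contDiff_id.sub contDiff_const)).sub (hcd.comp (contDiff_id.sub contDiff_const)))
    (fun t => by
      exact ((hd (t - t1)).comp_sub_const t t1).fun_sub ((hd (t - t2)).comp_sub_const t t2)) (by fun_prop)
    (fun t => sub_nonneg.2 (hm (by linarith)))
    ⟨t1, t2 + ε, h1, fun t ht => by
      rw [mem_Icc, not_and_or, not_le, not_le] at ht
      rcases ht with ht | ht
      · exact ⟨by rw [z0 _ (by linarith), z0 _ (by linarith), sub_self], by
          rw [hz _ (fun h => by linarith [h.1]), hz _ (fun h => by linarith [h.1]), sub_self]⟩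
      · exact ⟨by rw [z1 _ (by linarith), z1 _ (by linarith), sub_self], by
          rw [hz _ (fun h => by linarith [h.2]), hz _ (fun h => by linarith [h.2]), sub_self]⟩⟩
  have hBi : IntegrableOn Bf (Ioc t1 t2) := by
    refine Measure.integrableOn_of_bounded (M := C) (by simp) hBm (Eventually.of_forall hBb)
  have hBind : Integrable ((Ioc t1 t2).indicator Bf) := (integrable_indicator_iff measurableSet_Ioc).2 hBi
  have hCi : ∀ a : ℝ, Integrable ((Icc a (a + ε)).indicator fun _ => C) := fun a =>
    (integrable_indicator_iff measurableSet_Icc).2 (integrableOn_const (by simp))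
  have hCe : ∀ a : ℝ, ∫ t, ((Icc a (a + ε)).indicator fun _ => C) t = C * ε := fun a => by
    rw [integral_indicator measurableSet_Icc, setIntegral_const]
    simp [hε.le, mul_comm]
  have hS : ∀ a : ℝ, Integrable (fun t => Θ' (t - a)) := fun a => hI.comp_sub_right a
  have hSe : ∀ a : ℝ, ∫ t, Θ' (t - a) = 1 := fun a => by rw [integral_sub_right_eq_self Θ' a, hI1]
  have hi : Integrable (fun t => (Θ' (t - t1) * (A t1 + r / 4) - Θ' (t - t2) * (A t2 - r / 4)) +
      ((Ioc t1 t2).indicator Bf t + (((Icc t1 (t1 + ε)).indicator fun _ => C) t + ((Icc t2 (t2 + ε)).indicator fun _ => C) t))) :=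
    (((hS t1).mul_const _).sub ((hS t2).mul_const _)).add (hBind.add ((hCi t1).add (hCi t2)))
  have hθs : ∀ t, t ∉ Icc t1 (t2 + ε) → Θ (t - t1) - Θ (t - t2) = 0 := fun t ht => by
      rw [mem_Icc, not_and_or, not_le, not_le] at ht
      rcases ht with ht | ht
      · rw [z0 _ (by linarith), z0 _ (by linarith), sub_self]
      · rw [z1 _ (by linarith), z1 _ (by linarith), sub_self]
  have hθi : Integrable fun t => Θ (t - t1) - Θ (t - t2) := by
    have hΘc := hcd.continuous
    exact Continuous.integrable_of_hasCompactSupport (by fun_prop) (HasCompactSupport.intro isCompact_Icc hθs)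
  have hl : Integrable (fun t => (Θ' (t - t1) - Θ' (t - t2)) * A t + (Θ (t - t1) - Θ (t - t2)) * Bf t) :=
    (((hS t1).sub (hS t2)).mul_bdd hAm (Eventually.of_forall hAb)).add (hθi.mul_bdd hBm (Eventually.of_forall hBb))
  have hle := key.trans (integral_mono hl hi fun t => by
    simp only
    have q1 : Θ' (t - t1) * A t ≤ Θ' (t - t1) * (A t1 + r / 4) := by
      by_cases ht : t - t1 ∈ Icc 0 ε
      · have := c1 (x := t) (by rw [Real.dist_eq, abs_of_nonneg ht.1]; linarith [ht.2])
        rw [Real.dist_eq] at this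
        exact mul_le_mul_of_nonneg_left (by linarith [(abs_lt.1 this).2]) (hnn _)
      · rw [hz _ ht]; simp
    have q2 : Θ' (t - t2) * (A t2 - r / 4) ≤ Θ' (t - t2) * A t := by
      by_cases ht : t - t2 ∈ Icc 0 ε
      · have := c2 (x := t) (by rw [Real.dist_eq, abs_of_nonneg ht.1]; linarith [ht.2])
        rw [Real.dist_eq] at this
        exact mul_le_mul_of_nonneg_left (by linarith [(abs_lt.1 this).1]) (hnn _)
      · rw [hz _ ht]; simp
    have q3 : (Θ (t - t1) - Θ (t - t2)) * Bf t ≤ (Ioc t1 t2).indicator Bf t +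
        (((Icc t1 (t1 + ε)).indicator fun _ => C) t + ((Icc t2 (t2 + ε)).indicator fun _ => C) t) := by
      have b := abs_le.1 (hBb t)
      have g1 := h01 (t - t1)
      have g2 := h01 (t - t2)
      have n1 : 0 ≤ ((Icc t1 (t1 + ε)).indicator fun _ => C) t := indicator_nonneg (fun _ _ => hC) _
      have n2 : 0 ≤ ((Icc t2 (t2 + ε)).indicator fun _ => C) t := indicator_nonneg (fun _ _ => hC) _
      by_cases ht : t ∈ Icc t1 (t2 + ε)
      · by_cases k2 : t ≤ t2
        · rw [z0 (t - t2) (by linarith)]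
          by_cases k1 : t1 + ε ≤ t
          · rw [z1 _ (by linarith), indicator_of_mem (show t ∈ Ioc t1 t2 from ⟨by linarith, k2⟩)]
            linarith
          · have m1 : t ∈ Icc t1 (t1 + ε) := ⟨ht.1, by linarith⟩
            rw [indicator_of_mem m1]
            by_cases k3 : t = t1
            · rw [z0 (t - t1) (by linarith), indicator_of_notMem (by simp [k3])]
              linarith
            · rw [indicator_of_mem (show t ∈ Ioc t1 t2 from ⟨lt_of_le_of_ne ht.1 (Ne.symm k3), k2⟩)]
              nlinarith
        · rw [z1 (t - t1) (by linarith), indicator_of_notMem (show t ∉ Ioc t1 t2 from fun h => k2 h.2),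
            indicator_of_mem (show t ∈ Icc t2 (t2 + ε) from ⟨by linarith, ht.2⟩)]
          nlinarith
      · rw [hθs t ht, indicator_of_notMem (show t ∉ Ioc t1 t2 from fun h => ht ⟨h.1.le, by linarith [h.2]⟩)]
        linarith
    nlinarith)
  have hE : ∫ t, ((Θ' (t - t1) * (A t1 + r / 4) - Θ' (t - t2) * (A t2 - r / 4)) +
      ((Ioc t1 t2).indicator Bf t + (((Icc t1 (t1 + ε)).indicator fun _ => C) t + ((Icc t2 (t2 + ε)).indicator fun _ => C) t)))
      = (1 * (A t1 + r / 4) - 1 * (A t2 - r / 4)) + ((∫ t in t1..t2, Bf t) + (C * ε + C * ε)) := by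
    refine (integral_add (((hS t1).mul_const _).sub ((hS t2).mul_const _)) (hBind.add ((hCi t1).add (hCi t2)))).trans ?_
    congr 1
    · refine (integral_sub ((hS t1).mul_const _) ((hS t2).mul_const _)).trans ?_
      rw [integral_mul_const, integral_mul_const, hSe, hSe]
    · refine (integral_add hBind ((hCi t1).add (hCi t2))).trans ?_
      congr 1
      · rw [integral_indicator measurableSet_Ioc, intervalIntegral.integral_of_le h12.le]
      · exact (integral_add (hCi t1) (hCi t2)).trans (by rw [hCe, hCe])
  rw [hE] at hle
  linarith

end Decay
end PartH

section PartI
open MeasureTheory Filter Topology Set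
set_option linter.unusedSectionVars false
set_option linter.unusedVariables false
namespace Decay
variable {n : ℕ}

/-- representative in the unit cube -/
noncomputable def rep (w : Tor n) : Fin n → ℝ := fun i => (AddCircle.equivIco 1 0 (w i) : ℝ)

lemma rep_mem (w : Tor n) : rep w ∈ univ.pi fun _ : Fin n => Ico (0:ℝ) 1 := by
  intro i _
  have := (AddCircle.equivIco 1 0 (w i)).2
  exact ⟨this.1, this.2.trans_eq (zero_add 1)⟩

instance prodInv (n : ℕ) : (volume : Measure (ℝ × (Fin n → ℝ))).IsAddRightInvariant := by
  have : (volume : Measure (ℝ × (Fin n → ℝ))).IsAddLeftInvariant :=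
    inferInstanceAs (((volume : Measure ℝ).prod (volume : Measure (Fin n → ℝ))).IsAddLeftInvariant)
  infer_instance

lemma prj_rep (w : Tor n) : prj (rep w) = w := by
  funext i; exact AddCircle.coe_equivIco

lemma rep_meas : Measurable (rep (n := n)) :=
  measurable_pi_lambda _ fun i =>
    measurable_subtype_coe.comp ((AddCircle.measurableEquivIco 1 0).measurable.comp (measurable_pi_apply i))

lemma prj_meas : Measurable (prj (n := n)) := prj_cont.measurable

lemma rep_prj (x : Fin n → ℝ) : ∃ m : Fin n → ℤ, rep (prj x) = x + fun i => (m i : ℝ) := by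
  have : ∀ i, ∃ m : ℤ, rep (prj x) i = x i + m := by
    intro i
    have h : ((rep (prj x) i - x i : ℝ) : UnitAddCircle) = 0 := by
      have := congrFun (prj_rep (prj x)) i
      simp only [prj] at this
      rw [AddCircle.coe_sub, sub_eq_zero]
      exact this
    obtain ⟨m, hm⟩ := (AddCircle.coe_eq_zero_iff 1).1 h
    exact ⟨m, by simp at hm; linarith⟩
  choose m hm using this
  exact ⟨m, funext hm⟩

lemma rep_prj_self {x : Fin n → ℝ} (hx : x ∈ univ.pi fun _ : Fin n => Ico (0:ℝ) 1) : rep (prj x) = x := by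
  funext i
  refine (AddCircle.coe_eq_coe_iff_of_mem_Ico (p := (1:ℝ)) (a := 0) ?_ ?_).1 (congrFun (prj_rep (prj x)) i)
  · rw [zero_add]; exact rep_mem _ i trivial
  · rw [zero_add]; exact hx i trivial

lemma avg {F : ℝ × Tor n → ℝ} (hF : Measurable F) {C a b : ℝ} (hC : ∀ p, |F p| ≤ C)
    (hs : ∀ t w, t ∉ Icc a b → F (t, w) = 0) {χ : (Fin n → ℝ) → ℝ} (hχ : Continuous χ)
    (hχs : HasCompactSupport χ) :
    (∀ w : Tor n, Integrable fun z : ℝ × (Fin n → ℝ) => F (z.1, prj z.2) * χ (z.2 - rep w)) ∧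
    Integrable (fun w : Tor n => ∫ z : ℝ × (Fin n → ℝ), F (z.1, prj z.2) * χ (z.2 - rep w)) ∧
    ∫ w : Tor n, ∫ z : ℝ × (Fin n → ℝ), F (z.1, prj z.2) * χ (z.2 - rep w) =
      (∫ t, ∫ w, F (t, w)) * ∫ y, χ y := by
  have hC0 : 0 ≤ C := (abs_nonneg _).trans (hC 0)
  have hχi : Integrable χ := hχ.integrable_of_hasCompactSupport hχs
  have hdom : Integrable (fun z : ℝ × (Fin n → ℝ) => (Icc a b).indicator (fun _ => C) z.1 * χ z.2) := by
    refine Integrable.mul_prod ?_ hχi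
    exact (integrable_indicator_iff measurableSet_Icc).2 (integrableOn_const (by simp))
  have hbd : ∀ t w, |F (t, w)| ≤ (Icc a b).indicator (fun _ => C) t := by
    intro t w
    by_cases ht : t ∈ Icc a b
    · rw [indicator_of_mem ht]; exact hC _
    · rw [indicator_of_notMem ht, hs t w ht]; simp
  have hjoint : Integrable (Function.uncurry fun (w : Tor n) (z : ℝ × (Fin n → ℝ)) => F (z.1, prj z.2 + w) * χ z.2)
      (volume.prod volume) := by
    refine Integrable.mono' (hdom.norm.comp_snd volume) ?_ (Eventually.of_forall ?_)
    · refine Measurable.aestronglyMeasurable ?_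
      refine Measurable.mul (hF.comp ?_) (hχ.measurable.comp (by fun_prop))
      exact (by fun_prop : Measurable fun p : Tor n × (ℝ × (Fin n → ℝ)) => p.2.1).prodMk
        ((prj_meas.comp (by fun_prop)).add measurable_fst)
    · rintro ⟨w, z⟩
      simp only [Function.uncurry, norm_mul, Real.norm_eq_abs]
      exact mul_le_mul_of_nonneg_right ((hbd _ _).trans (le_abs_self _)) (abs_nonneg _)
  have hw : ∀ w : Tor n, Integrable fun z : ℝ × (Fin n → ℝ) => F (z.1, prj z.2 + w) * χ z.2 := by
    intro w
    refine Integrable.mono' hdom.norm ?_ (Eventually.of_forall ?_)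
    · refine Measurable.aestronglyMeasurable ?_
      refine Measurable.mul (hF.comp ?_) (hχ.measurable.comp (by fun_prop))
      exact measurable_fst.prodMk ((prj_meas.comp (by fun_prop)).add measurable_const)
    · rintro z
      simp only [norm_mul, Real.norm_eq_abs]
      exact mul_le_mul_of_nonneg_right ((hbd _ _).trans (le_abs_self _)) (abs_nonneg _)
  have hshift : ∀ w : Tor n, (fun z : ℝ × (Fin n → ℝ) => F (z.1, prj z.2) * χ (z.2 - rep w)) =
      fun z => (fun z : ℝ × (Fin n → ℝ) => F (z.1, prj z.2 + w) * χ z.2) (z - (0, rep w)) := by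
    intro w; funext z
    simp only [Prod.fst_sub, Prod.snd_sub, sub_zero, prj_sub, prj_rep, sub_add_cancel]
  have h_intble : ∀ w : Tor n, ∫ z : ℝ × (Fin n → ℝ), F (z.1, prj z.2) * χ (z.2 - rep w) =
      ∫ z : ℝ × (Fin n → ℝ), F (z.1, prj z.2 + w) * χ z.2 := by
    intro w
    rw [hshift w]
    exact integral_sub_right_eq_self (fun z : ℝ × (Fin n → ℝ) => F (z.1, prj z.2 + w) * χ z.2) _
  refine ⟨fun w => ?_, ?_, ?_⟩
  · rw [hshift w]; exact (hw w).comp_sub_right _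
  · simp only [h_intble]; exact hjoint.integral_prod_left
  · simp only [h_intble]
    rw [integral_integral_swap hjoint]
    have : ∀ z : ℝ × (Fin n → ℝ), ∫ w : Tor n, F (z.1, prj z.2 + w) * χ z.2 = (∫ w, F (z.1, w)) * χ z.2 := by
      intro z
      rw [integral_mul_const, integral_add_left_eq_self (fun w => F (z.1, w)) (prj z.2)]
    simp only [this]
    exact integral_prod_mul (fun t => ∫ w, F (t, w)) χ

lemma A_cont {U : ℝ → Tor n → ℝ} {M : ℝ} (hU : Sys volume U M) (k : ℝ) {g : Tor n → ℝ} (hg : Continuous g) :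
    ContinuousOn (fun t => ∫ x, |U t x - k| * g x) (Ioi 0) := by
  obtain ⟨S, hS0, hS⟩ := unif_bound1 (fun q : ℝ × Tor n => g q.2) (by fun_prop) M
  intro t ht
  apply ContinuousAt.continuousWithinAt
  have hi : ∀ t, Integrable (fun x => |U t x - k| * g x) (volume : Measure (Tor n)) := fun t =>
    hU.integrable1 (fun q => |q.1 - k| * g q.2) (by fun_prop) t
  have hi2 : ∀ s t, Integrable (fun x => |U s x - U t x|) (volume : Measure (Tor n)) := fun s t =>
    ((hU.integrable1 (fun q => q.1) (by fun_prop) s).sub (hU.integrable1 (fun q => q.1) (by fun_prop) t)).abs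
  have h0 : Tendsto (fun s => (∫ x, |U s x - U t x|) * S) (𝓝 t) (𝓝 0) := by
    simpa using (hU.cont t ht).mul_const S
  rw [ContinuousAt, tendsto_iff_dist_tendsto_zero]
  refine squeeze_zero (fun _ => dist_nonneg) (fun s => ?_) h0
  rw [Real.dist_eq, ← integral_sub (hi s) (hi t), ← integral_mul_const]
  refine abs_integral_le_integral_abs.trans (integral_mono ((hi s).sub (hi t)).abs ((hi2 s t).mul_const S) fun x => ?_)
  simp only
  rw [← sub_mul, abs_mul]
  refine mul_le_mul ?_ (hS 0 x ?_) (abs_nonneg _) (abs_nonneg _)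
  · have := abs_abs_sub_abs_le_abs_sub (U s x - k) (U t x - k)
    simpa using this
  · simpa using (abs_nonneg _).trans (hU.bdd 0 0)

end Decay
end PartI

section PartJ
open MeasureTheory Filter Topology Set
set_option linter.unusedSectionVars false
set_option linter.unusedVariables false
namespace Decay
variable {n : ℕ}

lemma IsTest.contDiff {g : Tor n → ℝ} {G} (h : IsTest g G) : ContDiff ℝ 1 (fun y => g (prj y)) := by
  refine contDiff_one_iff_hasFDerivAt.2 ⟨_, ?_, h.deriv⟩
  unfold lin
  refine continuous_finsetSum _ fun i _ => ?_
  exact (((h.contG i).comp prj_cont)).smul continuous_const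

lemma lin_single (l : (Fin n → ℝ) →L[ℝ] ℝ) (v : Fin n → ℝ) : l v = ∑ i, l (Pi.single i 1) * v i := by
  conv_lhs => rw [← Finset.univ_sum_single v]
  rw [map_sum]
  refine Finset.sum_congr rfl fun i _ => ?_
  have : (Pi.single i (v i) : Fin n → ℝ) = v i • Pi.single i 1 := by
    rw [← Pi.single_smul]; simp
  rw [this, map_smul, smul_eq_mul, mul_comm]

lemma torus_weak {v : ℝ × (Fin n → ℝ) → ℝ} {ψ : ℝ → Fin n → ℝ} (hψ : Continuous ψ)
    (hent : IsEntropySolution n ψ v)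
    (hper : ∀ m : Fin n → ℤ, ∀ᵐ z : ℝ × (Fin n → ℝ), v (z.1, z.2 + fun i => (m i : ℝ)) = v z)
    {U : ℝ → Tor n → ℝ} {M : ℝ} (hUv : ∀ t w, U t w = v (t, rep w)) (hU : Sys volume U M)
    {g : Tor n → ℝ} {G} (hg : IsTest g G) (k : ℝ)
    {θ θ' : ℝ → ℝ} (hθ : ContDiff ℝ 1 θ) (hd : ∀ t, HasDerivAt θ (θ' t) t) (hθ' : Continuous θ')
    (hnn : ∀ t, 0 ≤ θ t) {a b : ℝ} (ha : 0 < a) (hs : ∀ t, t ∉ Icc a b → θ t = 0 ∧ θ' t = 0) :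
    0 ≤ ∫ t, (θ' t * (∫ x, |U t x - k| * g x) + θ t * ∫ x, ∑ i, G i x * sf ψ i (U t x) k) := by
  have hsf : ∀ i, Continuous fun a : ℝ => sf ψ i a k := fun i =>
    (sf_cont hψ i).comp (by fun_prop : Continuous fun a : ℝ => (a, k))
  have hgc := hg.cont
  have hGc := hg.contG
  have hθc := hθ.continuous
  have haeU : ∀ᵐ z : ℝ × (Fin n → ℝ), v z = U z.1 (prj z.2) := by
    filter_upwards [ae_all_iff.2 hper] with z hz
    obtain ⟨m, hm⟩ := rep_prj z.2
    rw [hUv, hm, hz m]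
  obtain ⟨χ, hχd, hχs, hχ0, hχp⟩ : ∃ χ : (Fin n → ℝ) → ℝ, ContDiff ℝ 1 χ ∧ HasCompactSupport χ ∧
      (∀ y, 0 ≤ χ y) ∧ 0 < ∫ y, χ y := by
    let bump : ContDiffBump (0 : Fin n → ℝ) := ⟨1, 2, by norm_num, by norm_num⟩
    exact ⟨fun y => bump y, bump.contDiff, bump.hasCompactSupport, fun y => bump.nonneg, bump.integral_pos⟩
  set χ' : Fin n → (Fin n → ℝ) → ℝ := fun i y => fderiv ℝ χ y (Pi.single i 1) with hχ'
  have hχ'c : ∀ i, Continuous (χ' i) := fun i => (hχd.continuous_fderiv (by norm_num)).clm_apply continuous_const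
  have hχ's : ∀ i, HasCompactSupport (χ' i) := fun i => hχs.fderiv_apply ℝ _
  have hχ'0 : ∀ i, ∫ y, χ' i y = 0 := by
    intro i
    have := integral_mul_fderiv_eq_neg_fderiv_mul_of_integrable (μ := (volume : Measure (Fin n → ℝ)))
      (f := fun _ => (1:ℝ)) (g := χ) (v := Pi.single i 1) (by simp)
      (by simpa using (hχ'c i).integrable_of_hasCompactSupport (hχ's i))
      (by simpa using hχd.continuous.integrable_of_hasCompactSupport hχs)
      (by intro x _; fun_prop) (fun x _ => hχd.differentiable (by norm_num) x)
    simpa using this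
  have bθ : ∃ C, ∀ t, |θ t| ≤ C ∧ |θ' t| ≤ C := by
    obtain ⟨C1, h1⟩ := isCompact_Icc.exists_bound_of_continuousOn (s := Icc a b) hθc.continuousOn
    obtain ⟨C2, h2⟩ := isCompact_Icc.exists_bound_of_continuousOn (s := Icc a b) hθ'.continuousOn
    refine ⟨max (max C1 C2) 0, fun t => ?_⟩
    by_cases ht : t ∈ Icc a b
    · exact ⟨(h1 t ht).trans ((le_max_left _ _).trans (le_max_left _ _)), (h2 t ht).trans ((le_max_right _ _).trans (le_max_left _ _))⟩
    · rw [(hs t ht).1, (hs t ht).2]; simp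
  obtain ⟨C, hC⟩ := bθ
  have hC0 : 0 ≤ C := (abs_nonneg _).trans (hC 0).1
  have mk_meas : ∀ (η : ℝ → ℝ) (h : ℝ × Tor n → ℝ), Continuous η → Continuous h →
      Measurable fun p : ℝ × Tor n => η p.1 * h (U p.1 p.2, p.2) := fun η h hη hh =>
    (hη.measurable.comp measurable_fst).mul (hh.measurable.comp (hU.meas.prodMk measurable_snd))
  obtain ⟨S1, hS10, hS1⟩ := unif_bound1 (fun q : ℝ × Tor n => |q.1 - k| * g q.2) (by fun_prop) M
  obtain ⟨S2, hS20, hS2⟩ := unif_bound1 (fun q : ℝ × Tor n => ∑ i, G i q.2 * sf ψ i q.1 k) (by fun_prop) M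
  set F1 : ℝ × Tor n → ℝ := fun p => θ' p.1 * (|U p.1 p.2 - k| * g p.2) + θ p.1 * ∑ i, G i p.2 * sf ψ i (U p.1 p.2) k with hF1
  have hF1m : Measurable F1 :=
    (mk_meas θ' (fun q : ℝ × Tor n => |q.1 - k| * g q.2) hθ' (by fun_prop)).add
      (mk_meas θ (fun q : ℝ × Tor n => ∑ i, G i q.2 * sf ψ i q.1 k) hθc (by fun_prop))
  have hF1b : ∀ p, |F1 p| ≤ C * S1 + C * S2 := by
    intro p
    refine (abs_add_le _ _).trans (add_le_add ?_ ?_)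
    · rw [abs_mul]
      exact mul_le_mul (hC _).2 (hS1 _ _ (hU.bdd _ _)) (abs_nonneg _) hC0
    · rw [abs_mul]
      exact mul_le_mul (hC _).1 (hS2 _ _ (hU.bdd _ _)) (abs_nonneg _) hC0
  have hF1s : ∀ t w, t ∉ Icc a b → F1 (t, w) = 0 := by
    intro t w ht; simp only [hF1, (hs t ht).1, (hs t ht).2]; ring
  set F2 : Fin n → ℝ × Tor n → ℝ := fun i p => θ p.1 * (g p.2 * sf ψ i (U p.1 p.2) k) with hF2
  have hF2m : ∀ i, Measurable (F2 i) := fun i =>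
    (mk_meas θ (fun q : ℝ × Tor n => g q.2 * sf ψ i q.1 k) hθc (by have := hsf i; fun_prop))
  have hF2b : ∀ i, ∃ C', ∀ p, |F2 i p| ≤ C' := by
    intro i
    obtain ⟨S3, hS30, hS3⟩ := unif_bound1 (fun q : ℝ × Tor n => g q.2 * sf ψ i q.1 k) (by have := hsf i; fun_prop) M
    refine ⟨C * S3, fun p => ?_⟩
    rw [abs_mul]
    exact mul_le_mul (hC _).1 (hS3 _ _ (hU.bdd _ _)) (abs_nonneg _) hC0
  have hF2s : ∀ i t w, t ∉ Icc a b → F2 i (t, w) = 0 := by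
    intro i t w ht; simp only [hF2, (hs t ht).1]; ring
  obtain ⟨p1, p2, p3⟩ := avg hF1m hF1b hF1s hχd.continuous hχs
  choose C2 hC2 using hF2b
  have q := fun i => avg (hF2m i) (hC2 i) (hF2s i) (hχ'c i) (hχ's i)
  have hJ : ∀ w : Tor n, 0 ≤ (∫ z : ℝ × (Fin n → ℝ), F1 (z.1, prj z.2) * χ (z.2 - rep w)) +
      ∑ i, ∫ z : ℝ × (Fin n → ℝ), F2 i (z.1, prj z.2) * χ' i (z.2 - rep w) := by
    intro w
    set f : ℝ × (Fin n → ℝ) → ℝ := fun z => θ z.1 * (g (prj z.2) * χ (z.2 - rep w)) with hf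
    have hfd : ContDiff ℝ 1 f := by
      refine (hθ.comp contDiff_fst).mul ((hg.contDiff.comp contDiff_snd).mul (hχd.comp (contDiff_snd.sub contDiff_const)))
    have hD : ∀ z, HasFDerivAt f (θ z.1 • (g (prj z.2) • (fderiv ℝ χ (z.2 - rep w)).comp (ContinuousLinearMap.snd ℝ ℝ (Fin n → ℝ))
        + χ (z.2 - rep w) • (lin fun i => G i (prj z.2)).comp (ContinuousLinearMap.snd ℝ ℝ (Fin n → ℝ)))
        + (g (prj z.2) * χ (z.2 - rep w)) • (θ' z.1 • ContinuousLinearMap.fst ℝ ℝ (Fin n → ℝ))) z := by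
      intro z
      have d1 : HasFDerivAt (fun z : ℝ × (Fin n → ℝ) => θ z.1) (θ' z.1 • ContinuousLinearMap.fst ℝ ℝ (Fin n → ℝ)) z :=
        (hd z.1).comp_hasFDerivAt z hasFDerivAt_fst
      have d2 : HasFDerivAt (fun z : ℝ × (Fin n → ℝ) => g (prj z.2)) ((lin fun i => G i (prj z.2)).comp (ContinuousLinearMap.snd ℝ ℝ (Fin n → ℝ))) z :=
        (hg.deriv z.2).comp z hasFDerivAt_snd
      have d3 : HasFDerivAt (fun z : ℝ × (Fin n → ℝ) => χ (z.2 - rep w)) ((fderiv ℝ χ (z.2 - rep w)).comp (ContinuousLinearMap.snd ℝ ℝ (Fin n → ℝ))) z :=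
        ((hχd.differentiable (by norm_num) (z.2 - rep w)).hasFDerivAt).comp z (hasFDerivAt_snd.sub_const (rep w))
      exact d1.mul (d2.mul d3)
    obtain ⟨R, hR⟩ := hχs.isCompact.isBounded.subset_closedBall (0 : Fin n → ℝ)
    have hKs : ∀ z, z ∉ Icc a b ×ˢ Metric.closedBall (rep w) R → f z = 0 := by
      rintro ⟨t, y⟩ hz
      by_cases ht : t ∈ Icc a b
      · have : χ (y - rep w) = 0 := by
          by_contra hne
          have h1 := hR (subset_tsupport _ hne)
          exact hz ⟨ht, by simpa [dist_eq_norm] using h1⟩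
        simp [hf, this]
      · simp [hf, (hs t ht).1]
    have hK : IsCompact (Icc a b ×ˢ Metric.closedBall (rep w) R) := isCompact_Icc.prod (isCompact_closedBall _ _)
    have hts : tsupport f ⊆ Icc a b ×ˢ Metric.closedBall (rep w) R := by
      refine closure_minimal (fun z hz => ?_) hK.isClosed
      by_contra h; exact hz (hKs z h)
    have hpos := hent k f hfd (HasCompactSupport.intro hK hKs)
      (hts.trans (prod_mono (fun t ht => lt_of_lt_of_le ha ht.1) (subset_univ _)))
      (fun z => mul_nonneg (hnn _) (mul_nonneg (hg.nonneg _) (hχ0 _)))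
    rw [setIntegral_eq_integral_of_forall_compl_eq_zero] at hpos
    · rw [← integral_finsetSum _ (fun i _ => (q i).1 w), ← integral_add (p1 w) (integrable_finsetSum _ fun i _ => (q i).1 w)]
      refine hpos.trans_eq (integral_congr_ae ?_)
      filter_upwards [haeU] with z hz
      rw [(hD z).fderiv, hz]
      simp only [add_apply, smul_apply, ContinuousLinearMap.comp_apply,
        ContinuousLinearMap.coe_fst', ContinuousLinearMap.coe_snd', map_zero, smul_eq_mul, lin_apply]
      rw [lin_single (fderiv ℝ χ (z.2 - rep w))]
      simp only [hF1, hF2, sf, hχ']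
      simp only [Finset.mul_sum, Finset.sum_mul, mul_add, add_mul, mul_zero, add_zero, zero_add]
      rw [add_assoc, ← Finset.sum_add_distrib, ← Finset.sum_add_distrib]
      simp only [mul_one]
      congr 1
      · ring
      · exact Finset.sum_congr rfl fun i _ => by ring
    · intro z hz
      have hz' : z ∉ tsupport f := fun h => hz ⟨lt_of_lt_of_le ha (hts h).1.1, trivial⟩
      have h0 : fderiv ℝ f z = 0 := by
        have := notMem_subset (support_fderiv_subset ℝ (f := f)) hz'
        simpa using this
      rw [h0]; simp
  have hJi := integral_nonneg (μ := (volume : Measure (Tor n))) (Pi.le_def.2 hJ)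
  rw [integral_add p2 (integrable_finsetSum _ fun i _ => (q i).2.1), integral_finsetSum _ (fun i _ => (q i).2.1), p3] at hJi
  rw [Finset.sum_eq_zero (fun i _ => by rw [(q i).2.2, hχ'0, mul_zero]), add_zero] at hJi
  have := nonneg_of_mul_nonneg_left hJi hχp
  refine this.trans_eq (integral_congr_ae (Eventually.of_forall fun t => ?_))
  simp only [hF1]
  rw [integral_add, integral_const_mul, integral_const_mul]
  · exact (hU.integrable1 (fun q : ℝ × Tor n => |q.1 - k| * g q.2) (by fun_prop) t).const_mul _
  · exact (hU.integrable1 (fun q : ℝ × Tor n => ∑ i, G i q.2 * sf ψ i q.1 k) (by fun_prop) t).const_mul _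

lemma torus_ent {v : ℝ × (Fin n → ℝ) → ℝ} {ψ : ℝ → Fin n → ℝ} (hψ : Continuous ψ)
    (hent : IsEntropySolution n ψ v)
    (hper : ∀ m : Fin n → ℤ, ∀ᵐ z : ℝ × (Fin n → ℝ), v (z.1, z.2 + fun i => (m i : ℝ)) = v z)
    {U : ℝ → Tor n → ℝ} {M : ℝ} (hUv : ∀ t w, U t w = v (t, rep w)) (hU : Sys volume U M)
    (g : Tor n → ℝ) (G) (hg : IsTest g G) : EntIneq volume U ψ g G := by
  intro k t1 t2 h1 h12
  have hsf : ∀ i, Continuous fun a : ℝ => sf ψ i a k := fun i =>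
    (sf_cont hψ i).comp (by fun_prop : Continuous fun a : ℝ => (a, k))
  have hgc := hg.cont
  have hGc := hg.contG
  have key : ∀ h : ℝ × Tor n → ℝ, Continuous h → ∃ S, AEStronglyMeasurable (fun t => ∫ x, h (U t x, x)) ∧
      ∀ t, |∫ x, h (U t x, x)| ≤ S := by
    intro h hh
    obtain ⟨S, hS0, hS⟩ := unif_bound1 h hh M
    have hm : Measurable (fun q : ℝ × Tor n => h (U q.1 q.2, q.2)) :=
      hh.measurable.comp (hU.meas.prodMk measurable_snd)
    refine ⟨S, (hm.stronglyMeasurable.integral_prod_right' (ν := volume)).aestronglyMeasurable, fun t => ?_⟩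
    have := norm_integral_le_of_norm_le_const (μ := (volume : Measure (Tor n))) (f := fun x => h (U t x, x)) (C := S)
      (Eventually.of_forall fun x => hS _ _ (hU.bdd t x))
    simpa using this
  obtain ⟨S1, m1, b1⟩ := key (fun q : ℝ × Tor n => |q.1 - k| * g q.2) (by fun_prop)
  obtain ⟨S2, m2, b2⟩ := key (fun q : ℝ × Tor n => ∑ i, G i q.2 * sf ψ i q.1 k) (by fun_prop)
  exact one_dim (C := max S1 S2) (A_cont hU k hgc) m1 m2 (fun t => (b1 t).trans (le_max_left _ _))
    (fun t => (b2 t).trans (le_max_right _ _))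
    (fun θ θ' c1 c2 c3 c4 ⟨a, b, ha, hs⟩ => torus_weak hψ hent hper hUv hU hg k c1 c2 c3 c4 ha hs) h1 h12

end Decay
end PartJ

section PartK
open MeasureTheory Filter Topology Set
set_option linter.unusedSectionVars false
set_option linter.unusedVariables false
namespace Decay
variable {n : ℕ}

lemma prj_mp : MeasurePreserving (prj (n := n)) (volume.restrict (univ.pi fun _ : Fin n => Ico (0:ℝ) 1)) volume := by
  have h1 : MeasurePreserving (fun x : ℝ => (x : UnitAddCircle)) (volume.restrict (Ico (0:ℝ) 1)) volume := by
    have := UnitAddCircle.measurePreserving_mk 0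
    rw [zero_add] at this
    rw [Measure.restrict_congr_set Ico_ae_eq_Ioc]
    exact this
  have h2 := measurePreserving_pi (fun _ : Fin n => volume.restrict (Ico (0:ℝ) 1)) (fun _ : Fin n => (volume : Measure UnitAddCircle)) (fun _ => h1)
  rw [← Measure.restrict_pi_pi] at h2
  exact h2

lemma cube_integral {k : (Fin n → ℝ) → ℝ} (hk : Measurable k) :
    ∫ x in (univ.pi fun _ : Fin n => Ico (0:ℝ) 1), k x = ∫ w : Tor n, k (rep w) := by
  have h0 := integral_map (μ := volume.restrict (univ.pi fun _ : Fin n => Ico (0:ℝ) 1)) (φ := prj) (f := fun w => k (rep w)) prj_mp.measurable.aemeasurable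
    (hk.comp rep_meas).aestronglyMeasurable
  rw [prj_mp.map_eq] at h0
  rw [h0]
  refine setIntegral_congr_fun (MeasurableSet.univ_pi fun _ => measurableSet_Ico) fun x hx => ?_
  rw [rep_prj_self hx]

/-- multiplication by an invertible matrix as a continuous linear equivalence -/
noncomputable def Be (B : Matrix (Fin n) (Fin n) ℝ) (hB : IsUnit B.det) : (Fin n → ℝ) ≃L[ℝ] (Fin n → ℝ) :=
  ContinuousLinearEquiv.equivOfInverse (LinearMap.toContinuousLinearMap (Matrix.toLin' B))
    (LinearMap.toContinuousLinearMap (Matrix.toLin' B⁻¹))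
    (fun x => by simp [Matrix.mulVec_mulVec, Matrix.nonsing_inv_mul B hB])
    (fun x => by simp [Matrix.mulVec_mulVec, Matrix.mul_nonsing_inv B hB])

lemma Be_apply (B : Matrix (Fin n) (Fin n) ℝ) (hB : IsUnit B.det) (x) : Be B hB x = B.mulVec x := rfl
lemma Be_symm (B : Matrix (Fin n) (Fin n) ℝ) (hB : IsUnit B.det) (x) : (Be B hB).symm x = B⁻¹.mulVec x := rfl

lemma Be_map (B : Matrix (Fin n) (Fin n) ℝ) (hB : IsUnit B.det) :
    Measure.map (Be B hB) volume = ENNReal.ofReal |B.det⁻¹| • (volume : Measure (Fin n → ℝ)) :=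
  Real.map_matrix_volume_pi_eq_smul_volume_pi hB.ne_zero

lemma F_integral (B : Matrix (Fin n) (Fin n) ℝ) (hB : IsUnit B.det) {h : (Fin n → ℝ) → ℝ} (hh : Measurable h) :
    ∫ x in B.mulVec '' (univ.pi fun _ : Fin n => Ico (0:ℝ) 1), h x = |B.det| * ∫ w : Tor n, h (B.mulVec (rep w)) := by
  have hE : MeasurableEmbedding (Be B hB) := (Be B hB).toHomeomorph.measurableEmbedding
  have h1 : ∫ x in (Be B hB) '' (univ.pi fun _ : Fin n => Ico (0:ℝ) 1), h x ∂(Measure.map (Be B hB) volume)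
      = ∫ y in (univ.pi fun _ : Fin n => Ico (0:ℝ) 1), h (B.mulVec y) := by
    rw [hE.setIntegral_map, preimage_image_eq _ (Be B hB).injective]
    rfl
  rw [Be_map, Measure.restrict_smul, integral_smul_measure, cube_integral (k := fun y => h (B.mulVec y)) (hh.comp (Be B hB).continuous.measurable)] at h1
  rw [ENNReal.toReal_ofReal (abs_nonneg _), smul_eq_mul, abs_inv] at h1
  have hd : |B.det| ≠ 0 := abs_ne_zero.2 hB.ne_zero
  rw [inv_mul_eq_iff_eq_mul₀ hd] at h1
  exact h1

/-- the space-time map -/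
noncomputable def Ph (B : Matrix (Fin n) (Fin n) ℝ) (hB : IsUnit B.det) : (ℝ × (Fin n → ℝ)) ≃L[ℝ] (ℝ × (Fin n → ℝ)) :=
  (ContinuousLinearEquiv.refl ℝ ℝ).prodCongr (Be B hB)

lemma Ph_apply (B : Matrix (Fin n) (Fin n) ℝ) (hB : IsUnit B.det) (z) : Ph B hB z = (z.1, B.mulVec z.2) := rfl
lemma Ph_symm (B : Matrix (Fin n) (Fin n) ℝ) (hB : IsUnit B.det) (z) : (Ph B hB).symm z = (z.1, B⁻¹.mulVec z.2) := rfl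

lemma Ph_map (B : Matrix (Fin n) (Fin n) ℝ) (hB : IsUnit B.det) :
    Measure.map (Ph B hB) volume = ENNReal.ofReal |B.det⁻¹| • (volume : Measure (ℝ × (Fin n → ℝ))) := by
  have h := Measure.map_prod_map (volume : Measure ℝ) (volume : Measure (Fin n → ℝ)) measurable_id (Be B hB).continuous.measurable
  rw [Be_map, Measure.map_id, Measure.prod_smul_right] at h
  exact h.symm

lemma ent_transform (B : Matrix (Fin n) (Fin n) ℝ) (hB : IsUnit B.det) {φ : ℝ → Fin n → ℝ}
    {u : ℝ × (Fin n → ℝ) → ℝ} (hent : IsEntropySolution n φ u) :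
    IsEntropySolution n (fun l => B⁻¹.mulVec (φ l)) (fun z => u (z.1, B.mulVec z.2)) := by
  intro k f hf hfc hfs hf0
  set Φ := Ph B hB with hΦ
  have h := hent k (f ∘ Φ.symm) (hf.comp Φ.symm.contDiff) (hfc.comp_homeomorph Φ.symm.toHomeomorph) ?_ (fun z => hf0 _)
  · have hE : MeasurableEmbedding Φ := Φ.toHomeomorph.measurableEmbedding
    set H : ℝ × (Fin n → ℝ) → ℝ := fun z => |u z - k| * fderiv ℝ (f ∘ Φ.symm) z (1, 0) +
          Real.sign (u z - k) * fderiv ℝ (f ∘ Φ.symm) z (0, fun i => φ (u z) i - φ k i) with hH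
    have h1 : ∫ x in Ioi (0:ℝ) ×ˢ (univ : Set (Fin n → ℝ)), H x ∂(Measure.map Φ volume)
      = ∫ y in Ioi (0:ℝ) ×ˢ (univ : Set (Fin n → ℝ)), H (Φ y) := by
      rw [hE.setIntegral_map]
      have : Φ ⁻¹' (Ioi (0:ℝ) ×ˢ (univ : Set (Fin n → ℝ))) = Ioi (0:ℝ) ×ˢ (univ : Set (Fin n → ℝ)) := by
        ext z; simp [hΦ, Ph_apply]
      rw [this]
    rw [hΦ, Ph_map, Measure.restrict_smul, integral_smul_measure, ← hΦ] at h1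
    have h2 : 0 ≤ ∫ y in Ioi (0:ℝ) ×ˢ (univ : Set (Fin n → ℝ)), H (Φ y) := by
      rw [← h1]; exact smul_nonneg ENNReal.toReal_nonneg h
    refine h2.trans_eq (integral_congr_ae (Eventually.of_forall fun z => ?_))
    have hD : fderiv ℝ (f ∘ Φ.symm) (Φ z) = (fderiv ℝ f z).comp (Φ.symm : (ℝ × (Fin n → ℝ)) →L[ℝ] (ℝ × (Fin n → ℝ))) := by
      have h3 : HasFDerivAt f (fderiv ℝ f z) (Φ.symm (Φ z)) := by
        rw [Φ.symm_apply_apply]; exact (hf.differentiable (by norm_num) z).hasFDerivAt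
      exact (h3.comp (Φ z) Φ.symm.hasFDerivAt).fderiv
    simp only [hH, hD, ContinuousLinearMap.comp_apply, ContinuousLinearEquiv.coe_coe]
    have e1 : Φ.symm (1, 0) = (1, 0) := by rw [hΦ, Ph_symm]; simp
    have e2 : Φ.symm (0, fun i => φ (u (Φ z)) i - φ k i) =
        (0, fun i => B⁻¹.mulVec (φ (u (z.1, B.mulVec z.2))) i - B⁻¹.mulVec (φ k) i) := by
      rw [hΦ, Ph_symm, Ph_apply]
      have : (fun i => φ (u (z.1, B.mulVec z.2)) i - φ k i) = φ (u (z.1, B.mulVec z.2)) - φ k := rfl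
      simp only [this, Matrix.mulVec_sub]
      rfl
    rw [e1, e2]
    rfl
  · rw [show tsupport (f ∘ Φ.symm) = Φ.symm ⁻¹' tsupport f from tsupport_comp_eq_preimage f Φ.symm.toHomeomorph]
    intro z hz
    have := hfs hz
    rw [hΦ, Ph_symm] at this
    exact ⟨this.1, trivial⟩

lemma per_transform (B : Matrix (Fin n) (Fin n) ℝ) (hB : IsUnit B.det) {u : ℝ × (Fin n → ℝ) → ℝ} {m : Fin n → ℝ}
    (h : ∀ᵐ z : ℝ × (Fin n → ℝ), u (z.1, z.2 + B.mulVec m) = u z) :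
    ∀ᵐ z : ℝ × (Fin n → ℝ), u (z.1, B.mulVec (z.2 + m)) = u (z.1, B.mulVec z.2) := by
  have hq : Measure.QuasiMeasurePreserving (Ph B hB) volume volume := by
    refine ⟨(Ph B hB).continuous.measurable, ?_⟩
    rw [Ph_map]
    exact Measure.smul_absolutelyContinuous
  filter_upwards [hq.ae h] with z hz
  rw [Ph_apply] at hz
  rw [Matrix.mulVec_add]
  exact hz

lemma test_one : IsTest (n := n) (fun _ => 1) (fun _ _ => 0) := by
  refine ⟨fun _ => zero_le_one, continuous_const, fun _ => continuous_const, fun x => ?_⟩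
  refine (hasFDerivAt_const (1:ℝ) x).congr_fderiv ?_
  ext v; simp [lin_apply]

theorem main
    (n : ℕ) (B : Matrix (Fin n) (Fin n) ℝ) (hB : IsUnit B.det)
    (L L' F : Set (Fin n → ℝ))
    (hL : L = {e | ∃ m : Fin n → ℤ, e = B.mulVec fun i => (m i : ℝ)})
    (hL' : L' = {ξ | ∀ e ∈ L, ∃ k : ℤ, ∑ i, ξ i * e i = (k : ℝ)})
    (hF : F = B.mulVec '' Set.univ.pi fun _ : Fin n => Set.Ico (0 : ℝ) 1)
    (φ : ℝ → Fin n → ℝ) (hφ : Continuous φ)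
    (u : ℝ × (Fin n → ℝ) → ℝ) (hmeas : Measurable u)
    (M : ℝ) (hbd : ∀ z, |u z| ≤ M)
    (hent : IsEntropySolution n φ u)
    (hper : ∀ e ∈ L, ∀ᵐ z : ℝ × (Fin n → ℝ), u (z.1, z.2 + e) = u z)
    (hcont : ∀ t : ℝ, 0 < t →
      Tendsto (fun s => ∫ x in F, |u (s, x) - u (t, x)|)
        (nhdsWithin t (Set.Ioi (0 : ℝ))) (nhds 0))
    (I : ℝ) (hmean : ∀ t : ℝ, 0 < t → (1 / |B.det|) * ∫ x in F, u (t, x) = I)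
    (hnd : ∀ ξ ∈ L', ξ ≠ (0 : Fin n → ℝ) → ∀ ε : ℝ, 0 < ε →
      ¬ ∃ α β : ℝ, ∀ l ∈ Set.Ioo (I - ε) (I + ε), ∑ i, ξ i * φ l i = α * l + β) :
    Tendsto (fun t => ∫ x in F, |u (t, x) - I|) atTop (nhds 0) := by
  have hd : |B.det| ≠ 0 := abs_ne_zero.2 hB.ne_zero
  have hut : ∀ t, Measurable fun x => u (t, x) := fun t => hmeas.comp (by fun_prop)
  have hBm : Measurable fun x : Fin n → ℝ => B.mulVec x := (Be B hB).continuous.measurable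
  set U : ℝ → Tor n → ℝ := fun t w => u (t, B.mulVec (rep w)) with hUdef
  set ψ : ℝ → Fin n → ℝ := fun l => B⁻¹.mulVec (φ l) with hψdef
  have hψ : Continuous ψ := (Be B hB).symm.continuous.comp hφ
  have hU : Sys volume U M := by
    refine ⟨?_, fun t x => hbd _, fun t ht => ?_⟩
    · exact hmeas.comp (measurable_fst.prodMk (hBm.comp (rep_meas.comp measurable_snd)))
    · have h := (hcont t ht).const_mul (|B.det|⁻¹)
      rw [nhdsWithin_eq_nhds.2 (Ioi_mem_nhds ht), mul_zero] at h
      refine h.congr fun s => ?_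
      rw [hF, F_integral B hB (h := fun x => |u (s, x) - u (t, x)|) (((hut s).sub (hut t)).abs), ← mul_assoc, inv_mul_cancel₀ hd, one_mul]
  have hm : ∀ t, 0 < t → ∫ x, U t x = I := by
    intro t ht
    rw [← hmean t ht, hF, F_integral B hB (hut t), ← mul_assoc, one_div, inv_mul_cancel₀ hd, one_mul]
  have hE := torus_ent hψ (ent_transform B hB hent)
    (fun m => per_transform B hB (hper _ (by rw [hL]; exact ⟨m, rfl⟩))) (U := U) (fun t w => rfl) hU
  have hHK : HK volume U ψ I (Fin n → ℤ) := by
    refine HK_torus hU hE fun ξ hξ δ hδ => ?_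
    set ξr : Fin n → ℝ := fun i => (ξ i : ℝ) with hξr
    set η : Fin n → ℝ := Matrix.vecMul ξr B⁻¹ with hη
    have hηL : η ∈ L' := by
      rw [hL']
      intro e he
      rw [hL] at he
      obtain ⟨m, rfl⟩ := he
      refine ⟨∑ i, ξ i * m i, ?_⟩
      change η ⬝ᵥ (B.mulVec fun i => (m i : ℝ)) = _
      rw [hη, Matrix.dotProduct_mulVec, Matrix.vecMul_vecMul, Matrix.nonsing_inv_mul B hB, Matrix.vecMul_one]
      simp [dotProduct, hξr]
    have hη0 : η ≠ 0 := by
      intro h0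
      have : Matrix.vecMul η B = ξr := by
        rw [hη, Matrix.vecMul_vecMul, Matrix.nonsing_inv_mul B hB, Matrix.vecMul_one]
      rw [h0, Matrix.zero_vecMul] at this
      refine hξ (funext fun i => ?_)
      have := congrFun this i
      simp only [hξr, Pi.zero_apply] at this
      exact_mod_cast this.symm
    rintro ⟨α, β, h⟩
    refine hnd η hηL hη0 δ hδ ⟨α, β, fun l hl => ?_⟩
    rw [← h l hl]
    change η ⬝ᵥ φ l = ξr ⬝ᵥ (B⁻¹.mulVec (φ l))
    rw [Matrix.dotProduct_mulVec]
  have hfin := (mk_tendsto hU hψ (hE _ _ test_one) hm hHK).const_mul |B.det|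
  rw [mul_zero] at hfin
  refine hfin.congr fun t => ?_
  rw [hF, F_integral B hB (h := fun x => |u (t, x) - I|) ((hut t).sub_const I).abs]
  rfl

end Decay
end PartK

/-- decay of space-periodic entropy solutions of a multidimensional scalar
conservation law `u_t + div_x φ(u) = 0` with merely continuous flux, under the
non-degeneracy condition: for every nonzero `ξ` in the dual lattice `L'`, the function
`λ ↦ ξ·φ(λ)` is not affine in any neighborhood of the mean value `I`. Then
`∫_F |u(t,x) − I| dx → 0` as `t → +∞`, where `F` is a fundamental domain of the
lattice of periods `L`. -/
theorem decay_of_periodic_entropy_solutions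
    (n : ℕ) (hn : 1 ≤ n) (B : Matrix (Fin n) (Fin n) ℝ) (hB : IsUnit B.det)
    (L L' F : Set (Fin n → ℝ))
    (hL : L = {e | ∃ m : Fin n → ℤ, e = B.mulVec fun i => (m i : ℝ)})
    (hL' : L' = {ξ | ∀ e ∈ L, ∃ k : ℤ, ∑ i, ξ i * e i = (k : ℝ)})
    (hF : F = B.mulVec '' Set.univ.pi fun _ : Fin n => Set.Ico (0 : ℝ) 1)
    (φ : ℝ → Fin n → ℝ) (hφ : Continuous φ)
    (u : ℝ × (Fin n → ℝ) → ℝ) (hmeas : Measurable u)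
    (M : ℝ) (hbd : ∀ z, |u z| ≤ M)
    (hent : IsEntropySolution n φ u)
    (hper : ∀ e ∈ L, ∀ᵐ z : ℝ × (Fin n → ℝ), u (z.1, z.2 + e) = u z)
    (hcont : ∀ t : ℝ, 0 < t →
      Tendsto (fun s => ∫ x in F, |u (s, x) - u (t, x)|)
        (nhdsWithin t (Set.Ioi (0 : ℝ))) (nhds 0))
    (I : ℝ) (hmean : ∀ t : ℝ, 0 < t → (1 / |B.det|) * ∫ x in F, u (t, x) = I)
    (hnd : ∀ ξ ∈ L', ξ ≠ (0 : Fin n → ℝ) → ∀ ε : ℝ, 0 < ε →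
      ¬ ∃ α β : ℝ, ∀ l ∈ Set.Ioo (I - ε) (I + ε), ∑ i, ξ i * φ l i = α * l + β) :
    Tendsto (fun t => ∫ x in F, |u (t, x) - I|) atTop (nhds 0) := by
  exact Decay.main n B hB L L' F hL hL' hF φ hφ u hmeas M hbd hent hper hcont I hmean hnd
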